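/- arXiv:math/0602456 — 4 statements merged into one kernel-verified Lean document; each statement's English description precedes it below -/
import Mathlib

section
/- Every good normalized fully ternary string s of length n has flip grouping distance d_g(s) = n − 3. -/
/-- Prefix reversal (flip) of the first `i` symbols of `s`. -/
def pflip (i : ℕ) (s : List ℕ) : List ℕ := (s.take i).reverse ++ s.drop i

/-- One flip step: `t` is obtained from `s` by some flip `f^(i)` with `1 ≤ i ≤ |s|`. -/
def FlipStep (s t : List ℕ) : Prop := ∃ i, 1 ≤ i ∧ i ≤ s.length ∧ t = pflip i s

/-- `ReachIn m s t`: `t` can be obtained from `s` by exactly `m` flips. -/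
def ReachIn : ℕ → List ℕ → List ℕ → Prop
  | 0 => fun s t => s = t
  | (m+1) => fun s t => ∃ u, FlipStep s u ∧ ReachIn m u t

/-- Flip distance: minimum number of flips transforming `s` into `t`. -/
noncomputable def flipDist (s t : List ℕ) : ℕ := sInf {m | ReachIn m s t}

/-- Two strings are compatible if every symbol occurs equally often in both. -/
def Compatible (s t : List ℕ) : Prop := ∀ a, s.count a = t.count a

/-- A string is fully `k`-ary if the set of symbols occurring in it is exactly `{0,…,k-1}`. -/
def FullyKary (k : ℕ) (s : List ℕ) : Prop := ∀ a, a ∈ s ↔ a < k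

/-- A string is normalized if no two adjacent symbols are equal. -/
def Normalized (s : List ℕ) : Prop := s.Chain' (· ≠ ·)

/-- A string is grouped if the occurrences of each symbol are consecutive. -/
def Grouped (s : List ℕ) : Prop :=
  ∀ i j l : Fin s.length, i < j → j < l → s.get i = s.get l → s.get j = s.get i

/-- Flip grouping distance: minimum number of flips transforming `s` into some grouped string. -/
noncomputable def groupDist (s : List ℕ) : ℕ := sInf {m | ∃ t, Grouped t ∧ ReachIn m s t}

/-- Flip sorting distance: flip distance from `s` to its non-descending rearrangement `I(s)`. -/
noncomputable def sortDist (s : List ℕ) : ℕ := flipDist s (s.insertionSort (· ≤ ·))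

/-- `rep w m` is the concatenation of `m` copies of the string `w`. -/
def rep (w : List ℕ) (m : ℕ) : List ℕ := (List.replicate m w).flatten

/-- Generic base forms (types I--IV) of bad ternary strings, before relabeling. -/
def GBaseForm (s : List ℕ) : Prop :=
  -- type I: 0(12)^{≥2} and 02(12)^+
  (∃ j, 2 ≤ j ∧ s = 0 :: rep [1,2] j) ∨
  (∃ j, 1 ≤ j ∧ s = 0 :: 2 :: rep [1,2] j) ∨
  -- type II: ({0,1}2)^+ and (2{0,1})^+2
  (∃ xs : List ℕ, xs ≠ [] ∧ (∀ x ∈ xs, x = 0 ∨ x = 1) ∧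
    s = (xs.map (fun x => [x,2])).flatten) ∨
  (∃ xs : List ℕ, xs ≠ [] ∧ (∀ x ∈ xs, x = 0 ∨ x = 1) ∧
    s = (xs.map (fun x => [2,x])).flatten ++ [2]) ∨
  -- type III: 0(21)^+02(12)^*
  (∃ i j, 1 ≤ i ∧ s = 0 :: (rep [2,1] i ++ 0 :: 2 :: rep [1,2] j)) ∨
  -- type IV: eight exceptional strings
  s = [2,1,0,2,1,2] ∨ s = [0,2,1,0,1,2] ∨ s = [0,1,2,0,2,1,2] ∨ s = [1,2,0,1,2,1,2] ∨
  s = [0,2,1,0,1,2,1,2] ∨ s = [2,0,2,1,0,2,1,2] ∨ s = [0,2,0,2,1,0,2,1,2] ∨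
  s = [1,2,0,1,2,0,2,1,2]

/-- A normalized fully ternary string is bad if some bijective relabeling of `{0,1,2}`
turns it into one of the base forms. -/
def BadTernary (s : List ℕ) : Prop :=
  ∃ f : ℕ → ℕ, Set.BijOn f {x | x < 3} {x | x < 3} ∧ GBaseForm (s.map f)

/-- Transition table of the recognizing automaton, packed in base 256. -/
def autT : ℕ := 3272503081339560172267374572868652559520374752900387640552912855380868360219505615379160905920263427533709923843816609205479807216794305122422793457426784221183087403384907969581528438742386988183839756001350348449632509834594212097170637525661392599796725117606234402764013472080801306964212906811828050544064833517836403074844785455927397435060320995300610097683373924460422197814927163203058976109833479481368861044587846089900090922179523596626325705555326859862720653564823946270757565361066848281759293698688018106188191579803935709991288754058307469875581008538846549688858175371249911156414149796359332886787545638359039657136272698030215332604038101896912452237679615094092249232279405128316080735736135210253062943303405185296188831927251299373521886406947673250906141033885552682484073134227962292623263265560974632423005307490960614131834284255596385930621482029214693167846017778261889590405845259490419692049535931377864646744813827601466338507296906427455881487098877595067587872480304983915159890234936690195717450484336980076737136966709980269936166107643607017797971052548742477057163043503741804206317568583987513719122422852273725976677191495846610643328120524085263048628856577811616413260210131522019356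314528816253133988905709307820727260602807153171158923488635386960813664814761792479754614542053044095284167317649954820091879449395271956158188625219080376114256123730891837031332805068531668372432048166150738271951324218256637347086507578862088560428317962678324359819596151892648445455258449122700418500499310478529027690056668340864473911787520

/-- Accepting states, as a bit mask. -/
def autF : ℕ := 3101171915434222398413079322793071339070989130160086370883127498112

/-- Canonical transition table, packed in base 256. -/
def canT : ℕ := 240048519583675583001035687410805375343117998036623882620424573060569818151172352802338082717841119982734380687973554719679773011803177205966099936673565302540765559304416487183771150879590226812979721306478763702074473294395393981258548641792

/-- The six relabelings, indexed by the first two letters. -/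
def relT : ℕ := 342940863556865159518235488578888139008

/-- Prefixes of the exceptional strings, in canonical labeling. -/
def wordsT : List (List ℕ) :=
  [[0,1],
   [0,1,0],
   [0,1,2],
   [0,1,0,1],
   [0,1,0,2],
   [0,1,2,0],
   [0,1,0,1,2],
   [0,1,0,2,1],
   [0,1,2,0,1],
   [0,1,2,0,2],
   [0,1,0,1,2,0],
   [0,1,0,2,1,0],
   [0,1,2,0,1,0],
   [0,1,2,0,1,2],
   [0,1,2,0,2,1],
   [0,1,0,1,2,0,1],
   [0,1,0,2,1,0,2],
   [0,1,2,0,1,0,1],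
   [0,1,2,0,1,2,1],
   [0,1,2,0,2,1,2],
   [0,1,0,1,2,0,1,2],
   [0,1,0,2,1,0,2,0],
   [0,1,2,0,1,2,1,0],
   [0,1,2,0,2,1,2,1],
   [0,1,0,1,2,0,1,2,1],
   [0,1,2,0,1,2,1,0,1]]

/-- Summaries of all prefixes for which every reduction can still be bad. -/
def sigT : List (ℕ × ℕ × ℕ × List ℕ) :=
  [(18, 1, 155835506101682700476814448246800977070479701572417629110976097736143226034885977609557323439271720647215450503171694868879275494737964819532502760664286045588297383493345153898765653421919948136935641412401677651423204287889668777693358795435658488489062120642801967410826201797877424035289368571518776651057938536570258185035375367894125248313871122218212465320333574554030383378747102017937824363801009643135560341072691797811840876947972561841929263866127607382528076967588594320851835864253203634176, [88]),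
   (19, 2, 553892975397394322876111278724574864061752514553292465561533017747536528385359225059476896096063392312399700447953378064076700523252727399620224321653137074266685113344280537185002903550712010490022201119054497692702229958420046628851986669210269196944862441966236260372451924662728633202943777254154967201401395387376361084296821501068217777587782316810178669015066627995807027244961512225062182051768260610958746648317825623852756982726982819013769184599995325649768123179264, [89]),
   (20, 0, 142474959405516678957247264172538528869076791512169443400637166732731155989463378792460756871310802436856442580814468396922351112754297882429079301476390207140294349568231773550233331440606448560191187350575501361489565883733379451887456994620837186834551103732560346118919801916989679406894984883428606441692028857539520163824275819478777275314965645287670000139040400725521575945308666120078414624209501758723912694951223280245790544800005561705023521533245530509736316378297600, [197]),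
   (8, 1, 180441099883360909405348285326885528663205393964711295612660704740524329281982734134525572719545257738653582341752677805763518211163833665738439729315446971360845253394402305230083724888143972961462745591147783602584800037362479462377996414028027494219320981425964025550029017578014005508486239723202153447907418699194903260694864315357968473971933359042790211810886173409228558408424626655437953383801687306252839835858222965096074994648346366799285032168382786299806310766627631515900277033306646150144, []),
   (5, 0, 171342939161748779166792603840677464167216523382042328653749178386663899528742109944770219284223406300799449888821712006454838529772773236154743563936528240938060859222140419648959211381116735420413294828551734127621901119675924799073240661917693652830328153106952682615049281077642433700592075134355768699971598812274831074085531294923878330749963743503214862550588304824109758580189027406676826017603151020228374431662245539860055112172106689912714754413738996095378316518830935406830443569254815854994512624488960, [90]),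
   (21, 2, 2492741048197279527487507137294198806266647955677359945249327898514537506367117853322715690284947092086950168655487158219860596351968783753825465892016407140028218697779910432928217910479722473185327982370169070256754081891939685173565456965045926609081466804255425386553322982526818340186058215712795554299076356355911702570508049294721547804697112046861694470529615294482719290652802750972541112532331619479801272472731394296715494524519871101745386838336723335439738768090228355546112, [91]),
   (14, 0, 8451611432713121144464379667345500949528486683481613379406925220423108626602972786829249764405468649858794098985250065836711605228189320402882600435499665300721055657861612226057178090561224863086505466016859840758657892917290737804244761584166715440975299978508238572267007441486604396754741474280533150343918795498066295467995735606335706875108621340859375917134466798230015788253127690676929469695074295444032416275398000739637857334958396766098723116841967577106233088, [80, 152]),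
   (22, 1, 244189753448469215427719251920572457040473433816799076377437815311917489958779460820227108809832928237462968805758384995529253777297097234227359262948620782819047586063349527725318017262780863889994137431917792001882417048186343535727811128890125508196860201314835206181315942544462085983246134748405000793840885962817163852177069056229092555081201878831147227290216500103853574183818232299520, [92]),
   (23, 1, 505705607334627788441214513965946995253126123622811163634285534516460000921329873179370700553391051096797860092657563534105001006602685421718830834977194499303568140407993832191329958115430027788058578754460984555612339335175359126928494407768597468004916961043130737590618472552873282454419647236840644760420396403705197765071247768271934236064238713611522644769796351964554995354136669692111165246133172101958982215835581925944758935109256079714008028469091316447814285155328, [188]),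
   (24, 2, 33651433108395868744053584938507854785019867132270418050382568184748155597365626947455126692558937214799834854930293550992694519582720804034091493773192876338258144264771038332225809738754823319115268735126795052997804634105585812305445155359820730617844293566033353877408247081744033088204958472759790463647567155846807678336549524332232894965627280370857772278087444244455442951336047958116868339480853271810473102957274455918886040770297416918328114984220084742229148709976384256, [200]),
   (11, 0, 164110224326126745552342099612688914326405334623013831270791807729163944689628467841599260607494915566228810574273123066031117562505547865007209402317864170886516731320692162503579262362287389821436117433961839393222777023945375704231539429394235391748097932667141354812426163797076436751680960121068316489970905511747535355551470673173232274757829968302708186778228350362887477778195226743916513536911666835921203995933764561438406816201951390463151496683966213281371405648385780496023422976, [127]),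
   (7, 2, 33647245844979644069711259226593309919745929735816270125442056847109639704344064348167987796623997217406973272202866683167176881684670114985567225321148068154009662393866710498021639608301335372968169155974915293999088634444905031326312061239241094397546492786338468576488097504129679739405075816481523202255063084135372544139755030986905034346401586845266055158185595767415065730631378677662497050860049625282663939792126964729587863593867550898170969042091208479615719016032355840, []),
   (6, 1, 155835495353811694784755717902824841006080189223542969993043296918407588627297430275480375679541336882213179789950305680399018988792637643320906614246114319777123907032406595856672724011465299246810893692157518778519318958496109699968191107271031980076771674906102292812695834690452980231957194409150292290437118766485925865028074353373369517285593100978464303715603235823495213399721622679696039629253533242433617606918560360949124515658521536564930798807599978662934289271656605081858000209688041770240, [77]),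
   (13, 2, 577736305714041097591141788141893471529995985248449383475373544361490184617619227653875578028660782352216122058164952865235618628104967368437196178459219167819427431078683972260842360570032227053187892208279395125403796345790499205493533622935588015815979346239240255493721972400156373694825289089007024401661474200465809337984325641856127114370296971847384104333748155189706575159506350618421204783980749908406425619687417728500176210213101385446125300271448645263761620440832, [93]),
   (25, 0, 148578945510392284942038863113297222711779476823956366022922347525980184783057900907120607078883294053112817592996360024230395378496640696010604351990194378586232964205510266074183582487640280540035194012904252217596256908506442773733327150540200844361693817131269259644808677168008961234585501542545815608339078261910873172342038849408298876810134158084682696854859869215924390950448720797415216697382896169073736983177395285880831641086998304333298372978190462982173853000678400, [94, 187]),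
   (12, 1, 2185416695192946081742799544245440100988277085361509965231206458383166355582355840597607504336400170642900062735462975035623002491515401737107128632206779878717322360549013293860774856218863210455061125169929647185298542686860031652104782418769490022229020784132548609801778518091184281813043787134886807802603706545562454087423983652721356359692089399584272592192853779862720884146678643116624530918633644648096401677259357706624338179329286462761388234622166694019508319528884795898368, [86]),
   (13, 1, 211449228339309221247188345466017980177052272857408409033763173325826476515234266695956460045991829411399110940405676374393009235202332841482761429253763925131600545956793695624799268275352546669531597488751153375523443945984453075052875492022798954982351329886823199518426884778925806988877801712559349865173467168777545451076944757372154340706293694948662456864656177054798983359122505552640, [83, 151]),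
   (13, 2, 211449228339309221247188345466017980177052272857408409033763173325826476515234266695956461299656899819331876450064020782036003960439546867708283877547511302472542222977798793109771899289854246576498787257672821155852761192477368218033503489328735963507796907768989251308897078813995763595729409552785046411744502682507891151613616268291174054148281497929181435578455660297951987412536503936256, [79, 155]),
   (26, 0, 819041816126920221353025536734992695092869655749455666939408848161153962382222269739194795411894913958681947049192544088591653642921723391352632313721603206824530474483251192608675846141700633742769891131722088901012115397951159161562766513294785041844200276253005802706827254596547804494079613409097758968514628351222208637656240676425929077941441385627350522693717122255194766382047696640, [95, 132]),
   (0, 2, 13292279957849158913505511342130383360, [96]),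
   (27, 0, 7683283120648292056140045240579024110541037111509820463410213022044909282513556559516681060357188352888103274015621753771227606765839035644367972983575970692289835729702788814720780383329672504503530139625849252717848031766127879196160446852782426815439073526683358956833607822407227620855666937938958793520992754996285515493992103594379406449022501846941902892536448235129075815184137775222206479175643071851548410537651639472516447013291050649192389887674268688352024064, [95, 187]),
   (28, 2, 8492049764927059523146027416950024877516661260914539759212699982243314884409775886694496863675769283742705343598384760994047734620268876409068834236108838687199738661668673502287615308103756523549625372494527140123323183358980958525659129897467742244036264508716931539273434360299343898631913648313427711129078004768925955672282452220134210997996876326281460643996039370580523959951017189917732021020567850519193525221987592499954247618730009888260285511240928973767625472, [191]),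
   (0, 0, 1998007604737663078383654979914855771047551667234181874308302153971910114856109858760897598590005870159573355680311876524250709396159962421448164452621396242194092847836840829487485932583584553192495998525367449891346867255042240705942397112986408078036868842705861776700809623846075612160853445710795601994284321718193264787407580542483558351907942473295015559322142185338204600338668534105350759799711525882529742466137478235378181359078039912158419359544435681958024984832, [166, 204]),
   (29, 1, 1998007604737663078383654979914855771047551667234181874308302153971910114856109858760897598590005870159573355680311876524250709396159962421448164452621396242194092847836842383174966352671199928408817135527992763928323840278773034144005534122010539235414483978609957686822981467383417961256585729407124419244982842965237934186140100216077086205184383221546188988274888876991776545078344788206589302022475583940625255068336667715435917541221914130965020842098075029630164498176, [203]),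
   (12, 1, 2195198426817906771559203243339853921137757316954180289881478467463792165857705054090184156503158443900273441801908825926744638713694882760419884273275873327046735516986292327392388947049228655944635710390917608722124905458101651836233554738760989983787154547503615317876480547725908133420517273765783874950004464366341355672615089971518900628242953215836193382287159838946627310961342123675229681106615204903102561731473312244931855944825143470557150772190302904846438507715558078436864, [122]),
   (0, 2, 9089514837875589420512430517616862334070987179278444429213029400502769162625355660612415774687672843720226570183475960208097578928317613075484863923686450108722626503710821994781802191787531772447721098826775308288, [130]),
   (9, 0, 2006580531167018014664164302831014843781044677649962266827126403477793842263228299179846314392030470354306842018759407166615329809122248233780315291414657011269868079483268838046815860402537153013223860515048343795516461194889012108472799476092709423584836464979786329210670096106622049715965000065382681034477381402711463399650735580386222505660886044551053537261885558455609810911714923292821718443109475302351418926891020689726170574252144328069619580264371854330730392320, [201]),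
   (8, 1, 2185416695192883998951230330560265893005682563067269623635920750867066364655436644814039273505285544898734171923255298585980408530545911089044838913002898372267332160964454935261471448498962149516451919895906845137332344550287482638271063911443819467091982969008609657349560581736400936726987571220528278181679234472823447573268972829805034104955091563668620814023235727484986627194914582854352821043900606730686957590276946193349463544564722556804580849496152592425227985206372825854208, []),
   (5, 0, 171342939161748779166792603840667771360424516880315164988282895601243050935618463895798586111588967997890240213633613323853232604439761298287134815170871807599753607314649447715318259788510670776866155577868806833779661890701414966167282693643349794410385891945096397277247301288792259005364299320987310186750365110019041718137332817771405810135987325965336886532358916365608851041514465479435541441588824837134908412056377092741282940826621747990870572363904204812396812915467542419264136180894160507896919943546368, [78]),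
   (11, 2, 130764525179491513165063582554148670548662304912192646584766452158558652238681569893897474335842642495613790651761252442194549819280714053809082972294934687202587961264927835554563607388045653721861294537564180133331538092818031705909240209083392758334378814969382042885288589661169333577405857734713921327017292688723614308755186505046208592305778624198596704522837476498094703869475112637748036288436013368098406071029050025241986497301314885840491900833839075970127836349512704, [85]),
   (14, 0, 8815556422638566552599209413786216301422057880377950797658898076804964978791963181973299020151796016616347764296701838389926622759607114322643720950307905497334155114549593702371018878873751656672005752267826147493128524464338821113234197613055354590435337097599311325732430568432751274912525116093747569000427857770524860689396385814396022046283120001275979875712443617998632821270869774774193299047424787401229472129028933877223831197839573693594885047275639241948803328, [84, 152]),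
   (0, 1, 12440731451434789700263595085817956028742596352277327502547775543353790193566852905162513074702182011857989720171859385037465665132030238096854356739035659105311820781191713089196606808964755398232441707219175365315114105131824182119579151886216691397107839569626316176734691675101097197495506085695462887197803337911746463395600690270691039785161737991093933504980828118595835053211648, [97]),
   (30, 1, 505798777252048702465697030381035818383210877849216626013358039567693756147490254720527573520085842770148115157143180610448685535748941833615607820139662767531080208192801651170360459217435898075354710232220743290815619898966354916625549453844112925051513944356719744674770110069748360024101163571124875707095376849340944718309655569779269377408690675393672649930946324551046989486905644933734405421677712751151529286756140608362470993782083059117816883026913681874992230327040, [98, 188]),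
   (11, 0, 130260993536896706703860293423201462759777823053852629543310525075237646526370648923345097426486352441453630924236556065159259294494174157219724863081521936565988316257617228902788884968347011305032358762172133112751051845129168398847055468494671373765744746633913203617437042090978565331692882839726020708413937624132441638138893212554147348245656214524963262782820372693330044502560864296970302079352583818966476290453920563177429076140904689921241484429905977153492522524216320, [85, 121]),
   (11, 2, 130260993536896706703860293423201462759777823053852629543310525075237646526370648923345097426486352441453630924236556065159259294494174157219724863081521936565988316257617228902788884968347011305032358762172133112751051845129168398847055468494671373765744746633913203617437042090978565331692882839726020708413937624132441638138893212554147348245656214524963262782820372693330044502560864296970302079352583818966476290453920563177429076137420198483971074564041021173390452138754048, [85]),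
   (14, 0, 3547529166261883714296310910711158982308203347656496198109709439377318801813841642957150190496996264146078923291460229199508449555331812604526281925942658793982914786494311518130732780323230040093325573314811384134081757851352670160608961575382007924392835625876877590702406811950452691770687516542055269757103864046443818241005587181217847166299281323112842949368070586379467006712237112104390233344, [84, 152]),
   (14, 0, 3547529166261883714296310910711158982308203347656496198109709439377318801813841642957150190496996264165208334155839086360576490579963525755987690282407973647573800922484086615309474499585128721598076008003456509234278347300114088762870193895463229682131025829933613255870438839462424158255946743976620003234733852981955259003296101027272359375805711261511396263098310528658489591502899241285415088384, [80, 156]),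
   (31, 2, 14554842678475995591129828270298213370407280798912032501188446177517545645949464791751491094297547102240573975764189846833262955925389845457476900643876878254401712360786487827292186090542370746364529189672159970366352876636024825915517873029800379626719456644302326471159191943125451197150423788347456761958009466987204322373273593378774995993509149263146698868968242243667741154454528, [100, 137]),
   (32, 1, 503531642594806461203289130947207788884481858340017041455927083321005712310920970552376909356290054160159727524696377035290524786539896589358109213412750636599645007310606651774722419698642416828935775392047020580486247688863307062184740588721384568634068335468839267851547570190768245712974894987900618603355064591172670616293292492061244060122409673633441740017103804764659366914248340777734209083429549131929780575129462064557421163894687356520826269798054796738200254570752, [99, 188]),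
   (0, 2, 0, [100, 189]),
   (33, 1, 29747518595561187365665939739687568882225971887768304211190893837638862878400001651779632165714453270744944100949576646690304, [192]),
   (34, 2, 33651433108395868744053584938507854785019867132270418050382568184748155597365626947455126692558937214799834854930293550992694519582720804034091493773192876338258144264771012265675354235174161244190002294268157592331609970660281164943677284121828932978190050836821604784658555227229863094918132746933833909158022197655849039608453191828767478562218650937223866210631963706111851628958080817025740731135337055186575038300050145433472889024465524502362557150122478588452216790458548480, [207]),
   (11, 0, 130260993536896706703860293423201462759777823053852629543310525075237646526370648923345097426486352441453630924236556065159259294494174157219724863081521936565988316257617228902788884968347011305032358762172133112751051845129168398847055468494671373765744746633913203617437042090978565331692882839726020708413937624132441638138893212554147348245656214524963262782820372693330044502560864296970302079352583818966476290453920563177429076137420198483971074564041021173390451534728192, [85, 121]),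
   (11, 2, 130844030175690693132621996145179520391597085057314367453239801129180434786076503189784574164865251137867082940032921258551531501779349628254347335825173494621049642804125093587542347953721695588085512799616755536518999353889524824978994802641263846860098300245694461429763388308107613871725574289091413712028595833041501482662603805728084714033002549843184024718761661668498784563065977853074013460805990109145116251072584942407667527530773697922393600342042483013698471980351488, [121]),
   (0, 1, 35505917335451521173876681709440868492464793669056423551613396095713942041505295549267249119873722045782135039779202969562881167688740676076112749701900195737197759780117885431665357884785719652906520555179575040, [134]),
   (10, 1, 29747518595561187365665939739687568882225971887768304211190893837638862878400001651779632165714453270744944100949585236590592, [192]),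
   (0, 2, 33651433108395868744053584938507854785019867132270418050382568184748155597365626947455126692558937214799834854930293550992694519582720804034091493773192876338258144264771012265675354235174161244190002294268157592331609970660281164943677284121828932978190050836821604784658555227229863094918132746933833909158022197655849039608453191828767478562218650937223866210631963706111851628958080817025740731135337055186575038300050145433472889024465524552873220989949281758796885081111633152, [205]),
   (11, 0, 130260993536896706703860293423201462759777823053852629543310525075237646526370648923345097426486352441453630924236556065159259294494174157219724863081521936565988316257617228902788884968347011305032358762172133112751051845129168398847055468494671373765744746633913203617437042090978565331692882839726020708413937624132441638138893212554147348245656214524963262782820372693330044502560864296970302079352583818966476290453920563177429076138291321343288677030507260888991718535333888, [121]),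
   (7, 2, 33646684009673169864607179767606676518755267537885661541637943181094022108384711434056691573585195733208611218442190185798998873921286218622570225483776913016247512388285530192052695362151792495386317934811559566936184975936463233315675828789972559832564661180130752091687128479593173565357407950175771096269761686224969268289577637142573785612097416740323042423956415979857175853845801022781160747165194524675764523102803524509602305549099009860764870140863309306723947998752782848, []),
   (13, 2, 212264544115710451613670041766715776529522318249273343220382277931766185985931125902708966459683584153299619300517073285880811573528537665073676947480920695857591949592912585474175696006706175426826456753340125626935775365318339917851963400852919678590919197818019247428629095082834534340682333386257463206561744980150880549572282824829078309445710738617318497531575548398430808950794810922752, [83]),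
   (12, 1, 2185416695192946081742799544245440100988277085361509965231206458383166355582355840597607504336400170628426532027257795062320715161274720284970279569601518508820431748268995835877508191795592736796047805623437090280126516226967259838029964030887432398708996598191181010807393974750351186189904162258427613603472562829300934304114380228351627871957633681393974923557020752676485320591760692877655624070324685829517155176017070653871826327751556638359612627167134391904448510626122775165440, [86]),
   (13, 1, 211449228339309221247188345466017980177052272857408409033763173325826476515234266695956460045991829411399110940405676374393009235202332841482761429253763925131600545956793695622450806960203653639994756181680959610987177036256807581045835006915120522446259437722667183065789634490322082781473049919533842065027405360830048757312623425577745359599603805861619488864589919410988313016197264003840, [83, 151]),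
   (13, 2, 211449228339309221247188345466017980177052272857408409033763173325826476515234266695956460045991829411399110940405676374393009235202332841482761429253763925131600545956793695622450806960203653639994756181680959610987177036256807581045835006915120522446259437722667183065789634490322082781473049919533842065027405360830048757312623425577745359599603805861619488864589919410988313015260963511040, [83, 155]),
   (35, 2, 8855994754852504931280857163390740229410232457810877177464672838625171236598766281838531889827299257767139189245326465461565426597832985380853932527000511450918753446074216389119123548823676229902838564811866816099722041634164797896972252454150918278325045566912249540812393296069171577256596472377504368980417962582959674536453240487690534239949135151973853646791096466199983995654010341763083200509919430064957454021627186960547766608804624870614703465015768090146821376, [103, 191]),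
   (12, 1, 2185416695192946081742799544245440100988277085361509965231206458383166355582355840597607504336400170628426532027257795062320715161274720284970279569601518508820431748268995835877508191795592736796047805623437090280126516226967259838029964030887432398708996598191181010807393974750351186189904162258427613603472562829300934304114380228351627871957633681393974923557020752676485320591760692877655624070324685829517155176017070653871826327751556638359612627167134391904448510626122775156224, [86, 122]),
   (13, 1, 211449228339309221247188345466017980177052272857408409033763173325826476515234266695956460045991829411399110940405676374393009235202332841482761429253763925131600545956793695622450806960203653639994756181680959610987177036256807581045835006915120522446259437722667183065789634490322082781473049919533842065027405360830048757312623425577745359599603805861619488864589919410988313015260961133312, [83, 151]),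
   (13, 1, 211449228339309221247188345466017980177052272857408409033763173325826476515234266695956460045991829411399110940405676374393009235202332841482761429253763925131600545956793695622450806960203653639994756181680959610987177036256807581045835006915120522446259437722667183065789634490322082781473049919533842065027405360830048757312623425577745359599603805861619488864589919410988313015260961133312, [83, 155]),
   (13, 2, 211449228339309221247188345466017980177052272857408409033763173325826476515234266695956461299656899819331876450064020782036003960439546867708283877547511302472542222977798793109771899289854246576498787257672821155852761192477368218033503489328735963507796907768989251308897078813995763595729409552785046411744502682507891151613616268291174054148281497929181435578455660297951987412536503933696, [79, 155]),
   (36, 0, 768799163136, [105, 142, 177]),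
   (0, 0, 7683283120648292056140045240579024110541037111509820463410213022044909282513556559516681060357188352888103274015621753771227606765839035644367972983575970692289835729702788814720780383329672504503530139625849252717848031766127879196160446852782426815439073526683358956833607822407227620855666937938958793520992754996285515493992103594379406449022501846941902892536448235129075815184137775222206479175643071851548410537651639472516447013291050649192389887674268686724628480, [102, 104, 187]),
   (37, 0, 0, [139, 191]),
   (9, 2, 1949533378678697948141074085841820096997776419982063038696623702704413615998495644192134698222120390565608869439032041999373816320, [191]),
   (38, 1, 1998007604737663078383654979914855771047551667234181874308302153971910114856109858760897598590005870159573355680311876524250709396159962421448164452621396242194092847836840829487485932583584553192495998525367449891346867255042240705942397112986408078036868840960674927828696455107687509193689208046460165389619625201489602892793529703749736691691497165728454944459316573635364353339472168825105529201179504936753073894214054891946652992607603368639431211561983634808292538112, [212]),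
   (12, 1, 2185416695192946081742799544245440100988277085361509965231206458383166355582355840597607504336400170628426532027257795062320715161274720284970279569601518508820431748268995835877508191795592736796047805623437090280126516226967259838029964030887432398708996598191181010807393974750351186189904162258427613603472562829300934304114380228351627871957633681393974923557020752676485320591760692877655624070324685829517155176017070653871826327751556638359612627167134391904448510626122775165440, [122]),
   (9, 2, 1949533378678697948141074085841820096997776419982063038696623702704413615998495644192134698222120390565608869439032041999373816832, [191]),
   (0, 1, 1998007604737663078383654979914855771047551667234181874308302153971910114856109858760897598590005870159573355680311876524250709396159962421448164452621396242194092847836840829487485932583584553192495998525367449891346867255042240705942397112986408078036868840960674927828696455107687509193689208046460165389619625201489602892793529703749736691691497165728454944459316573635364353339472168825105529201179504936753073894214054891946652992607603368639431211561983634808295028480, [210]),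
   (12, 1, 2185416695192946081742799544245440100988277085361509965231206458383166355582355840597607504336400170628426532027257795062320715161274720284970279569601518508820431748268995835877508191795592736796047805623437090280126516226967259838029964030887432398708996598191181010807393974750351186189904162258427613603472562829300934304114380228351627871957633681393974923557020752676485320591760692877655624070324685829517155176017070653871826327751556638359612627167134391904448510626122775156224, [122]),
   (9, 0, 1998007604737663078383654979914855771047551667234181874308302153971910114856109858760897598590005870159573355680311876524250709396159962421448164452621396242194092847836840829487485932583584553192495998525367449891346867255042240705942397112986408078036868840960674927828696455107687509193689208046460165389619625201489602892793529703749736691693446699107133642407457647721206173436469945245087592239876128639457487510212550536138787690829723759205040081001015676653044509440, [191]),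
   (14, 0, 3547529166261883714296310910711158982308203347656496198109709439377318801813841642957150190496996264146078923291460229199508449555331812604526281925942658793982914786494311518130732780323230040093325573314811384134081757851352670160608961575382007924392835625876877590702406811950452691770687516542055269757103864046443818241005587181217847166299281323112842949368070586379467006712237112104390242560, [84, 152]),
   (14, 0, 3547529166261883714296310910711158982308203347656496198109709439377318801813841642957150190496996264146078923291460229199508449555331812604526281925942658793982914786494311518130732780323230040093325573314811384134081757851352670160608961575382007924392835625876877590702406811950452691770687516542055269757103864046443818241005587181217847166299281323112842949368070586379467006712237112104390242560, [84, 156]),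
   (39, 1, 940597874688, [108, 192]),
   (11, 2, 130260993536896706703860293423201462759777823053852629543310525075237646526370648923345097426486352441453630924236556065159259294494174157219724863081521936565988316257617228902788884968347011305032358762172133112751051845129168398847055468494671373765744746633913203617437042090978565331692882839726020708413937624132441638138893212554147348245656214524963262782820372693330044502560864296970302079352583818966476290453920563177429076137420198483971074564041021173390452138754048, [85, 121]),
   (14, 0, 3547529166261883714296310910711158982308203347656496198109709439377318801813841642957150190496996264146078923291460229199508449555331812604526281925942658793982914786494311518130732780323230040093325573314811384134081757851352670160608961575382007924392835625876877590702406811950452691770687516542055269757103864046443818241005587181217847166299281323112842949368070586379467006712237112104390233344, [84, 156]),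
   (0, 2, 45824, [81, 146, 181]),
   (40, 1, 0, [144, 192]),
   (10, 1, 29747518595561187365665939739687568882225971887768304211190893837638862878400001651779632165714453270744944100948674703523840, [192]),
   (11, 0, 130260993536896706703860293423201462759777823053852629543310525075237646526370648923345097426486352441453630924236556065159259294494174157219724863081521936565988316257617228902788884968347011305032358762172133112751051845129168398847055468494671373765744746633913203617437042090978565331692882839726020708413937624132441638138893212554147348245656214524963262782820372693330044502560864296970302079352583818966476290453920563177429076137420198483971074564041021173390451534728192, [121]),
   (11, 2, 130260993536896706703860293423201462759777823053852629543310525075237646526370648923345097426486352441453630924236556065159259294494174157219724863081521936565988316257617228902788884968347011305032358762172133112751051845129168398847055468494671373765744746633913203617437042090978565331692882839726020708413937624132441638138893212554147348245656214524963262782820372693330044502560864296970302079352583818966476290453920563177429076137420198483971074564041021173390452138754048, [121]),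
   (12, 1, 2185416695192946081742799544245440100988277085361509965231206458383166355582355840597607504336400170628426532027257795062320715161274720284970279569601518508820431748268995835877508191795592736796047805623437090280126516226967259838029964030887432398708996598191181010807393974750351186189904162258427613603472562829300934304114380228351627871957633681393974923557020752676485320591760692877655624070324685829517155176017070653871826327751556638359612627167134391904448510626122775165440, [86, 122]),
   (9, 2, 1949533378678697948141074085841820096997776419982063038696623702704413615998495644192134698222120390565608869439032041999373762560, [191])]

/-- Transition function of the automaton. -/
def dl (q x : ℕ) : ℕ := autT / 256 ^ (3 * q + x) % 256

/-- Acceptance of an automaton state. -/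
def acc (q : ℕ) : Bool := autF / 2 ^ q % 2 == 1

/-- Canonical transitions. -/
def cd (c x : ℕ) : ℕ := canT / 256 ^ (3 * c + x) % 256

/-- Relabeling number `i`. -/
def rel (i x : ℕ) : ℕ := relT / 256 ^ (3 * i + x) % 256

/-- Read an entry of a packed function. -/
def look (h i : ℕ) : ℕ := h / 256 ^ i % 256

/-- Pack the first `n` values of a function in base 256. -/
def pk (f : ℕ → ℕ) : ℕ → ℕ
  | 0 => 0
  | n+1 => pk f n + f n * 256 ^ n

/-- State of the automaton given relabeling and canonical state. -/
def enc (i c : ℕ) : ℕ := if c = 0 then 0 else 4 + 36 * i + c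

/-- Index of the relabeling sending `a` to 0 and `b` to 1. -/
def pidx (a b : ℕ) : ℕ := 2 * a + (if b < a then b else b - 1)

/-- Possible values of the reductions after reading one more letter. -/
def stepS (h : ℕ) (S : List ℕ) (x : ℕ) : List ℕ :=
  if x = 0 then dl (look h 1) 0 :: S.map (fun p => dl p x) else S.map (fun p => dl p x)

/-- Check of one transition of the summaries. -/
def okStep (q l h : ℕ) (S : List ℕ) (x : ℕ) : Bool :=
  x == l || (stepS h S x).contains 0 ||
    sigT.any (fun τ => τ.1 == dl q x && (τ.2.1 == x &&
      (τ.2.2.2.all (fun m => (stepS h S x).contains m) &&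
        τ.2.2.1 == pk (fun i => look h (dl i x)) 221)))

/-- Check of the acceptance condition of a summary. -/
def okFin (q : ℕ) (S : List ℕ) : Bool := acc q || S.any (fun m => !acc m)

theorem dl_lt : ∀ i < 221, ∀ x < 3, dl i x < 221 := by decide +kernel

theorem sig_ok : sigT.all (fun σ => okFin σ.1 σ.2.2.2 &&
    (okStep σ.1 σ.2.1 σ.2.2.1 σ.2.2.2 0 && (okStep σ.1 σ.2.1 σ.2.2.1 σ.2.2.2 1 &&
      okStep σ.1 σ.2.1 σ.2.2.1 σ.2.2.2 2))) = true := by decide +kernel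

theorem dead_ok : acc 0 = false ∧ ∀ x < 3, dl 0 x = 0 := by decide +kernel

theorem dl_first : ∀ a < 3, dl 1 a = 2 + a := by decide +kernel

theorem dl_second : ∀ a < 3, ∀ b < 3, a ≠ b → dl (2 + a) b = enc (pidx a b) 11 := by
  decide +kernel

theorem dl_enc : ∀ i < 6, ∀ c < 37, ∀ x < 3, dl (enc i c) x = enc i (cd c (rel i x)) := by
  decide +kernel

theorem cd_lt : ∀ c < 37, ∀ x < 3, cd c x < 37 := by decide +kernel

theorem rel_lt : ∀ i < 6, ∀ x < 3, rel i x < 3 := by decide +kernel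

theorem rel_inj : ∀ i < 6, ∀ x < 3, ∀ y < 3, rel i x = rel i y → x = y := by decide +kernel

theorem pidx_ok : ∀ a < 3, ∀ b < 3, a ≠ b → pidx a b < 6 ∧ rel (pidx a b) a = 0 ∧
    rel (pidx a b) b = 1 := by decide +kernel

/-- Index of the relabeling `j` precomposed with the inverse of relabeling `i`. -/
def pact (i j : ℕ) : ℕ :=
  ((List.range 6).filter (fun k => (List.range 3).all (fun x => rel k (rel i x) == rel j x))).headD 0

/-- Action of relabelings on states. -/
def act (i q : ℕ) : ℕ :=
  if q < 2 then q else if q < 5 then 2 + rel i (q - 2)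
    else 5 + 36 * pact i ((q - 5) / 36) + (q - 5) % 36

theorem act_ok : ∀ i < 6, ∀ q < 221, (acc (act i q) = acc q ∧
    ∀ x < 3, dl (act i q) (rel i x) = act i (dl q x)) := by decide +kernel

theorem acc_enc : ∀ i < 6, ∀ c < 37, acc (enc i c) = true → c ∈ 
      [3, 4, 6, 8, 10, 19, 23, 25, 28, 29, 30, 32, 34, 35, 36] := by
  decide +kernel

/-- Run of the automaton. -/
def run (q : ℕ) (s : List ℕ) : ℕ := s.foldl dl q

theorem run_append (q : ℕ) (s t : List ℕ) : run q (s ++ t) = run (run q s) t := by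
  simp [run]

theorem run_lt (s : List ℕ) (hs : ∀ x ∈ s, x < 3) : ∀ q < 221, run q s < 221 := by
  induction s with
  | nil => intro q hq; exact hq
  | cons x s ih =>
    intro q hq
    exact ih (fun y hy => hs y (by simp [hy])) _ (dl_lt q hq x (hs x (by simp)))

theorem pk_lt (f : ℕ → ℕ) (hf : ∀ i, f i < 256) (n : ℕ) : pk f n < 256 ^ n := by
  induction n with
  | zero => simp [pk]
  | succ n ih =>
    have h1 := hf n
    have h2 : (f n + 1) * 256 ^ n ≤ 256 * 256 ^ n := Nat.mul_le_mul_right _ h1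
    rw [pk, pow_succ]
    linarith

theorem look_pk (f : ℕ → ℕ) (hf : ∀ i, f i < 256) (n i : ℕ) (hi : i < n) :
    look (pk f n) i = f i := by
  induction n with
  | zero => omega
  | succ n ih =>
    rw [pk, look]
    rcases Nat.lt_succ_iff_lt_or_eq.1 hi with h | h
    · obtain ⟨k, rfl⟩ : ∃ k, n = i + (k + 1) := ⟨n - i - 1, by omega⟩
      have : f (i + (k + 1)) * 256 ^ (i + (k + 1)) = 256 ^ i * (256 * (f (i + (k + 1)) * 256 ^ k)) := by
        ring
      rw [this, Nat.add_mul_div_left _ _ (by positivity), Nat.add_mul_mod_self_left]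
      exact ih h
    · subst h
      rw [Nat.add_mul_div_right _ _ (by positivity), Nat.div_eq_of_lt (pk_lt f hf i), zero_add,
        Nat.mod_eq_of_lt (hf i)]

/-- One reduction of a normalized string. -/
def Red (s t : List ℕ) : Prop :=
  ∃ a w v, s = a :: (w ++ a :: v) ∧ t = w.reverse ++ a :: v

theorem Red.append {s t : List ℕ} (h : Red s t) (u : List ℕ) : Red (s ++ u) (t ++ u) := by
  obtain ⟨a, w, v, rfl, rfl⟩ := h
  exact ⟨a, w, v ++ u, by simp, by simp⟩

/-- Correctness of a summary of the string `0 :: u`. -/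
def SigInv (u : List ℕ) (q l h : ℕ) (S : List ℕ) : Prop :=
  q = run 1 (0 :: u) ∧ u.getLast? = some l ∧ (∀ i < 221, look h i = run i u.reverse) ∧
    ∀ m ∈ S, ∃ t, Red (0 :: u) t ∧ run 1 t = m

theorem stepS_ok {u : List ℕ} {q l h : ℕ} {S : List ℕ} (H : SigInv u q l h S) (x : ℕ) :
    ∀ m ∈ stepS h S x, ∃ t, Red (0 :: (u ++ [x])) t ∧ run 1 t = m := by
  obtain ⟨-, -, h3, h4⟩ := H
  have key : ∀ m ∈ S.map (fun p => dl p x), ∃ t, Red (0 :: (u ++ [x])) t ∧ run 1 t = m := by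
    intro m hm
    obtain ⟨p, hp, rfl⟩ := List.mem_map.1 hm
    obtain ⟨t, ht, rfl⟩ := h4 p hp
    exact ⟨t ++ [x], ht.append [x], by rw [run_append]; rfl⟩
  intro m hm
  unfold stepS at hm
  split_ifs at hm with hx
  · rcases List.mem_cons.1 hm with rfl | hm
    · subst hx
      refine ⟨u.reverse ++ [0], ⟨0, u, [], rfl, rfl⟩, ?_⟩
      rw [run_append, h3 1 (by norm_num)]; rfl
    · exact key m hm
  · exact key m hm

theorem run_dead (s : List ℕ) (hs : ∀ x ∈ s, x < 3) : run 0 s = 0 := by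
  induction s with
  | nil => rfl
  | cons x s ih =>
    have : dl 0 x = 0 := dead_ok.2 x (hs x (by simp))
    show run (dl 0 x) s = 0
    rw [this]
    exact ih (fun y hy => hs y (by simp [hy]))

theorem sig_main (v : List ℕ) : ∀ (u : List ℕ) (σ : ℕ × ℕ × ℕ × List ℕ), σ ∈ sigT →
    SigInv u σ.1 σ.2.1 σ.2.2.1 σ.2.2.2 → (∀ x ∈ v, x < 3) → (u ++ v).IsChain (· ≠ ·) →
    acc (run 1 (0 :: (u ++ v))) = true ∨
      ∃ t, Red (0 :: (u ++ v)) t ∧ acc (run 1 t) = false := by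
  induction v with
  | nil =>
    intro u σ hσ H _ _
    have h := List.all_eq_true.1 sig_ok σ hσ
    rw [Bool.and_eq_true] at h
    have h := h.1
    obtain ⟨h1, -, -, h4⟩ := H
    rw [okFin, Bool.or_eq_true, List.any_eq_true] at h
    rw [List.append_nil, ← h1]
    rcases h with h | ⟨m, hm, h⟩
    · exact Or.inl h
    · obtain ⟨t, ht, rfl⟩ := h4 m hm
      exact Or.inr ⟨t, ht, by simpa using h⟩
  | cons x v ih =>
    intro u σ hσ H hv hc
    have hx : x < 3 := hv x (by simp)
    have hv' : ∀ y ∈ v, y < 3 := fun y hy => hv y (by simp [hy])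
    have h := List.all_eq_true.1 sig_ok σ hσ
    have e : u ++ x :: v = (u ++ [x]) ++ v := by simp
    have hst : okStep σ.1 σ.2.1 σ.2.2.1 σ.2.2.2 x = true := by
      simp only [Bool.and_eq_true] at h
      interval_cases x
      · exact h.2.1
      · exact h.2.2.1
      · exact h.2.2.2
    simp only [okStep, Bool.or_eq_true] at hst
    have hS := stepS_ok H x
    rcases hst with (hl | hd) | hn
    · exfalso
      have hl : x = σ.2.1 := by simpa using hl
      have h2 := H.2.1
      rw [List.isChain_append] at hc
      exact hc.2.2 _ h2 x (by simp) hl.symm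
    · right
      obtain ⟨t, ht, hr⟩ := hS 0 (by simpa using hd)
      refine ⟨t ++ v, ?_, ?_⟩
      · rw [e]; exact ht.append v
      · rw [run_append, hr, run_dead v hv']; exact dead_ok.1
    · obtain ⟨τ, hτ, hn⟩ := List.any_eq_true.1 hn
      simp only [Bool.and_eq_true, beq_iff_eq, List.all_eq_true, List.contains_iff_mem] at hn
      obtain ⟨n1, n2, n3, n4⟩ := hn
      rw [e] at hc ⊢
      refine ih (u ++ [x]) τ hτ ⟨?_, ?_, ?_, ?_⟩ hv' hc
      · rw [n1, H.1]
        show _ = run 1 ((0 :: u) ++ [x])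
        rw [run_append]; rfl
      · rw [n2]; simp
      · intro i hi
        rw [n4, look_pk (fun i => look σ.2.2.1 (dl i x)) (fun j => Nat.mod_lt _ (by norm_num)) _ _ hi,
          H.2.2.1 _ (dl_lt i hi x hx)]
        simp [run]
      · intro m hm
        exact hS m (n3 m hm)

/-- The function read backwards along `u`. -/
def bk (u : List ℕ) : ℕ := pk (fun i => run i u.reverse % 256) 221

theorem base_look (u : List ℕ) (hu : ∀ x ∈ u, x < 3) (i : ℕ) (hi : i < 221) :
    look (bk u) i = run i u.reverse := by
  rw [bk, look_pk _ (fun j => Nat.mod_lt _ (by norm_num)) _ _ hi]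
  exact Nat.mod_eq_of_lt (lt_trans (run_lt _ (by simpa using hu) i hi) (by norm_num))

theorem base_ok : ∀ u ∈ [[1,0,1],[1,0,2],[1,2,0],[1,2,1]],
    ∃ σ ∈ sigT, σ.1 = run 1 (0 :: u) ∧ u.getLast? = some σ.2.1 ∧ σ.2.2.1 = bk u ∧
      ∀ m ∈ σ.2.2.2, (u = [1,0,1] ∧ m = run 1 [1,0,1]) ∨ (u = [1,0,2] ∧ m = run 1 [1,0,2])
        ∨ (u = [1,2,0] ∧ m = run 1 [2,1,0]) := by
  decide +kernel

theorem base_inv : ∀ u ∈ [[1,0,1],[1,0,2],[1,2,0],[1,2,1]],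
    ∃ σ ∈ sigT, SigInv u σ.1 σ.2.1 σ.2.2.1 σ.2.2.2 := by
  intro u hu
  obtain ⟨σ, hσ, h1, h2, h3, h4⟩ := base_ok u hu
  have hu3 : ∀ x ∈ u, x < 3 := by
    fin_cases hu <;> simp
  refine ⟨σ, hσ, h1, h2, ?_, ?_⟩
  · intro i hi; rw [h3]; exact base_look u hu3 i hi
  · intro m hm
    rcases h4 m hm with ⟨rfl, hm⟩ | ⟨rfl, hm⟩ | ⟨rfl, hm⟩
    · exact ⟨[1, 0, 1], ⟨0, [1], [1], by simp, by simp⟩, hm.symm⟩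
    · exact ⟨[1, 0, 2], ⟨0, [1], [2], by simp, by simp⟩, hm.symm⟩
    · exact ⟨[2, 1, 0], ⟨0, [1, 2], [], by simp, by simp⟩, hm.symm⟩

theorem step_canonical (s : List ℕ) (h3 : ∀ x ∈ s, x < 3) (hc : s.IsChain (· ≠ ·))
    (hl : 4 ≤ s.length) (h0 : s[0]? = some 0) (h1 : s[1]? = some 1) (ha : acc (run 1 s) = false) :
    ∃ t, Red s t ∧ acc (run 1 t) = false := by
  match s, hl with
  | a :: b :: c :: d :: v, _ =>
    have g0 : a = 0 := by simpa using h0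
    have g1 : b = 1 := by simpa using h1
    subst g0
    subst g1
    have hc3 : c < 3 := h3 c (by simp)
    have hd3 : d < 3 := h3 d (by simp)
    have hu : [1, c, d] ∈ [[1,0,1],[1,0,2],[1,2,0],[1,2,1]] := by
      simp only [List.isChain_cons_cons] at hc
      obtain ⟨-, h1c, hcd, -⟩ := hc
      interval_cases c <;> interval_cases d <;> simp_all
    obtain ⟨σ, hσ, H⟩ := base_inv _ hu
    have := sig_main v [1, c, d] σ hσ H (fun x hx => h3 x (by simp [hx]))
      (by simpa using hc.tail)
    rcases this with h | h
    · simp only [List.cons_append, List.nil_append] at h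
      rw [ha] at h; cases h
    · simpa using h

theorem run_map (i : ℕ) (hi : i < 6) (s : List ℕ) : ∀ q < 221, (∀ x ∈ s, x < 3) →
    run (act i q) (s.map (rel i)) = act i (run q s) := by
  induction s with
  | nil => intro q _ _; rfl
  | cons x s ih =>
    intro q hq hs
    have hx := hs x (by simp)
    show run (dl (act i q) (rel i x)) (s.map (rel i)) = act i (run (dl q x) s)
    rw [(act_ok i hi q hq).2 x hx]
    exact ih _ (dl_lt q hq x hx) (fun y hy => hs y (by simp [hy]))

theorem acc_map (i : ℕ) (hi : i < 6) (s : List ℕ) (hs : ∀ x ∈ s, x < 3) :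
    acc (run 1 (s.map (rel i))) = acc (run 1 s) := by
  have h := run_map i hi s 1 (by norm_num) hs
  have e : act i 1 = 1 := by simp [act]
  rw [e] at h
  rw [h]
  exact (act_ok i hi _ (run_lt s hs 1 (by norm_num))).1

theorem step_main (s : List ℕ) (h3 : ∀ x ∈ s, x < 3) (hc : s.IsChain (· ≠ ·))
    (hl : 4 ≤ s.length) (ha : acc (run 1 s) = false) :
    ∃ t, Red s t ∧ acc (run 1 t) = false := by
  obtain ⟨a, b, r, rfl⟩ : ∃ a b r, s = a :: b :: r := by
    match s, hl with
    | a :: b :: r, _ => exact ⟨a, b, r, rfl⟩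
  have ha3 := h3 a (by simp)
  have hb3 := h3 b (by simp)
  have hab : a ≠ b := by
    rw [List.isChain_cons_cons] at hc; exact hc.1
  obtain ⟨hi, r0, r1⟩ := pidx_ok a ha3 b hb3 hab
  set i := pidx a b
  have hmap3 : ∀ x ∈ (a :: b :: r).map (rel i), x < 3 := by
    intro x hx
    obtain ⟨y, hy, rfl⟩ := List.mem_map.1 hx
    exact rel_lt i hi y (h3 y hy)
  have hmapc : ((a :: b :: r).map (rel i)).IsChain (· ≠ ·) := by
    rw [List.isChain_map]
    have : (a :: b :: r).IsChain (fun x y => x ≠ y ∧ x < 3 ∧ y < 3) := by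
      refine List.IsChain.imp_of_mem_imp ?_ hc
      intro x y hx hy hxy
      exact ⟨hxy, h3 x hx, h3 y hy⟩
    refine this.imp ?_
    rintro x y ⟨hxy, hx, hy⟩ h
    exact hxy (rel_inj i hi x hx y hy h)
  obtain ⟨t', ⟨a', w', v', e1, rfl⟩, ht⟩ := step_canonical ((a :: b :: r).map (rel i)) hmap3 hmapc
    (by simpa using hl) (by simp [r0]) (by simp [r1]) (by rw [acc_map i hi _ h3]; exact ha)
  rw [List.map_eq_cons_iff] at e1
  obtain ⟨a1, l1, e2, e3, e4⟩ := e1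
  rw [List.map_eq_append_iff] at e4
  obtain ⟨w, l2, e5, e6, e7⟩ := e4
  rw [List.map_eq_cons_iff] at e7
  obtain ⟨a2, v, e8, e9, e10⟩ := e7
  subst e5 e8
  rw [e2] at h3 ⊢
  have haa : a1 = a2 := rel_inj i hi _ (h3 a1 (by simp)) _ (h3 a2 (by simp)) (by rw [e3, e9])
  subst haa
  refine ⟨w.reverse ++ a1 :: v, ⟨a1, w, v, rfl, rfl⟩, ?_⟩
  rw [← acc_map i hi]
  · rw [← ht]
    simp [e6, e9, e10]
  · intro x hx
    apply h3
    simp only [List.mem_append, List.mem_reverse, List.mem_cons] at hx ⊢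
    tauto

/-- The strings leading to each canonical state. -/
def cform : ℕ → List ℕ → Prop
  | 0, _ => True
  | 1, s => ∃ k, s = rep [0,1] k ++ [0]
  | 2, s => ∃ k, s = rep [0,1] k
  | 3, s => ∃ j, 2 ≤ j ∧ s = 0 :: rep [1,2] j
  | 4, s => ∃ j, 1 ≤ j ∧ s = 0 :: (rep [1,2] j ++ [1])
  | 5, s => ∃ i j, 1 ≤ i ∧ s = 0 :: (rep [1,2] i ++ 0 :: rep [1,2] j)
  | 6, s => ∃ i j, 1 ≤ i ∧ s = 0 :: (rep [1,2] i ++ 0 :: (rep [1,2] j ++ [1]))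
  | 7, s => ∃ (xs : List ℕ) (y : ℕ), (∀ x ∈ xs, x = 0 ∨ x = 2) ∧ (y = 0 ∨ y = 2) ∧
      s = (xs.map (fun x => [x,1])).flatten ++ [y]
  | 8, s => ∃ xs : List ℕ, xs ≠ [] ∧ (∀ x ∈ xs, x = 0 ∨ x = 2) ∧
      s = (xs.map (fun x => [x,1])).flatten
  | 9, s => ∃ xs : List ℕ, xs ≠ [] ∧ (∀ x ∈ xs, x = 1 ∨ x = 2) ∧
      s = (xs.map (fun x => [0,x])).flatten
  | 10, s => ∃ xs : List ℕ, xs ≠ [] ∧ (∀ x ∈ xs, x = 1 ∨ x = 2) ∧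
      s = (xs.map (fun x => [0,x])).flatten ++ [0]
  | n+11, s => wordsT[n]? = some s

theorem rep_succ (a b k : ℕ) : rep [a,b] (k+1) = rep [a,b] k ++ [a,b] := by
  simp [rep, List.replicate_succ']

theorem rep_succ' (a b k : ℕ) : rep [a,b] (k+1) = a :: b :: rep [a,b] k := by
  simp [rep, List.replicate_succ]

theorem rep_shift (a b k : ℕ) : rep [a,b] k ++ [a] = a :: rep [b,a] k := by
  induction k with
  | zero => simp [rep]
  | succ k ih => rw [rep_succ', rep_succ', List.cons_append, List.cons_append, ih]

theorem rep_left (a b k : ℕ) : rep [a,b] k = ((List.replicate k a).map (fun x => [x,b])).flatten := by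
  simp [rep]

theorem rep_right (a b k : ℕ) : rep [a,b] k = ((List.replicate k b).map (fun x => [a,x])).flatten := by
  simp [rep]

theorem cd_fam : ∀ c < 11, ∀ x < 3, cd c x =
    (([[0,0,0],[0,2,9],[1,0,7],[5,4,0],[7,0,3],[0,6,0],[0,0,5],[0,8,0],[7,0,7],[10,0,0],[0,9,9]] :
      List (List ℕ)).getD c []).getD x 0 := by decide +kernel

theorem cd_word : ∀ n < 26, ∀ x < 3, cd (n + 11) x = 0 ∨
    (10 < cd (n + 11) x ∧ (wordsT[cd (n + 11) x - 11]? == some (wordsT.getD n [] ++ [x])) = true) ∨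
    (cd (n + 11) x, wordsT.getD n [] ++ [x]) ∈ [(4, 0 :: (rep [1,2] 1 ++ [1])),
      (1, rep [0,1] 2 ++ [0]), (10, [0,1,0,2,0]), (8, [0,1,0,1,2,1]),
      (5, 0 :: (rep [1,2] 1 ++ 0 :: rep [1,2] 2))] := by
  decide +kernel

theorem cform_step (c : ℕ) (hc : c < 37) (x : ℕ) (hx : x < 3) (s : List ℕ) (h : cform c s) :
    cform (cd c x) (s ++ [x]) := by
  by_cases h11 : c < 11
  · rw [cd_fam c h11 x hx]
    interval_cases c
    · interval_cases x <;> trivial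
    · obtain ⟨k, rfl⟩ := h
      interval_cases x
      · trivial
      · exact ⟨k + 1, by rw [rep_succ]; simp⟩
      · refine ⟨List.replicate k 1 ++ [2], by simp, ?_, ?_⟩
        · intro y hy
          simp only [List.mem_append, List.mem_replicate, List.mem_singleton] at hy
          tauto
        · rw [rep_right]; simp
    · obtain ⟨k, rfl⟩ := h
      interval_cases x
      · exact ⟨k, rfl⟩
      · trivial
      · refine ⟨List.replicate k 0, 2, ?_, by simp, ?_⟩
        · intro y hy
          exact Or.inl (List.eq_of_mem_replicate hy)
        · rw [rep_left]
    · obtain ⟨j, hj, rfl⟩ := h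
      interval_cases x
      · exact ⟨j, 0, by omega, by simp [rep]⟩
      · exact ⟨j, by omega, by simp⟩
      · trivial
    · obtain ⟨j, hj, rfl⟩ := h
      interval_cases x
      · refine ⟨0 :: List.replicate j 2, 0, ?_, by simp, ?_⟩
        · intro y hy
          rcases List.mem_cons.1 hy with hy | hy
          · exact Or.inl hy
          · exact Or.inr (List.eq_of_mem_replicate hy)
        · rw [rep_shift, rep_left]; simp
      · trivial
      · exact ⟨j + 1, by omega, by rw [rep_succ]; simp⟩
    · obtain ⟨i, j, hi, rfl⟩ := h
      interval_cases x
      · trivial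
      · exact ⟨i, j, hi, by simp⟩
      · trivial
    · obtain ⟨i, j, hi, rfl⟩ := h
      interval_cases x
      · trivial
      · trivial
      · exact ⟨i, j + 1, hi, by rw [rep_succ]; simp⟩
    · obtain ⟨xs, y, hxs, hy, rfl⟩ := h
      interval_cases x
      · trivial
      · refine ⟨xs ++ [y], by simp, ?_, by simp⟩
        intro z hz
        rcases List.mem_append.1 hz with hz | hz
        · exact hxs z hz
        · rw [List.mem_singleton.1 hz]; exact hy
      · trivial
    · obtain ⟨xs, hne, hxs, rfl⟩ := h
      interval_cases x
      · exact ⟨xs, 0, hxs, by simp, rfl⟩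
      · trivial
      · exact ⟨xs, 2, hxs, by simp, rfl⟩
    · obtain ⟨xs, hne, hxs, rfl⟩ := h
      interval_cases x
      · exact ⟨xs, hne, hxs, rfl⟩
      · trivial
      · trivial
    · obtain ⟨xs, hne, hxs, rfl⟩ := h
      have key : ∀ y, (y = 1 ∨ y = 2) → cform 9 ((xs.map (fun x => [0,x])).flatten ++ [0] ++ [y]) := by
        intro y hy
        refine ⟨xs ++ [y], by simp, ?_, by simp⟩
        intro z hz
        rcases List.mem_append.1 hz with hz | hz
        · exact hxs z hz
        · rw [List.mem_singleton.1 hz]; exact hy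
      interval_cases x
      · trivial
      · exact key 1 (by simp)
      · exact key 2 (by simp)
  · obtain ⟨n, rfl⟩ : ∃ n, c = n + 11 := ⟨c - 11, by omega⟩
    have hs : wordsT[n]? = some s := h
    have hg : wordsT.getD n [] = s := by
      rw [List.getD_eq_getElem?_getD, hs]; rfl
    have hw := cd_word n (by omega) x hx
    rw [hg] at hw
    simp only [List.mem_cons, List.not_mem_nil, or_false, Prod.mk.injEq, beq_iff_eq] at hw
    rcases hw with hw | ⟨h1, h2⟩ | ⟨h1, h2⟩ | ⟨h1, h2⟩ | ⟨h1, h2⟩ | ⟨h1, h2⟩ | ⟨h1, h2⟩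
    · rw [hw]; trivial
    · obtain ⟨m, hm⟩ : ∃ m, cd (n + 11) x = m + 11 := ⟨cd (n + 11) x - 11, by omega⟩
      rw [hm] at h2 ⊢
      exact h2
    · rw [h1, h2]; exact ⟨1, by simp, rfl⟩
    · rw [h1, h2]; exact ⟨2, rfl⟩
    · rw [h1, h2]; exact ⟨[1, 2], by simp, by simp, rfl⟩
    · rw [h1, h2]; exact ⟨[0, 0, 2], by simp, by simp, rfl⟩
    · rw [h1, h2]; exact ⟨1, 2, by simp, rfl⟩

theorem run_enc (i : ℕ) (hi : i < 6) (r : List ℕ) : ∀ (c : ℕ) (p : List ℕ), c < 37 → cform c p →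
    (∀ x ∈ r, x < 3) → ∃ c' < 37, run (enc i c) r = enc i c' ∧ cform c' (p ++ r.map (rel i)) := by
  induction r with
  | nil => intro c p hc h _; exact ⟨c, hc, rfl, by simpa using h⟩
  | cons x r ih =>
    intro c p hc h hr
    have hx := hr x (by simp)
    have hrx := rel_lt i hi x hx
    obtain ⟨c', hc', e, h'⟩ := ih (cd c (rel i x)) (p ++ [rel i x]) (cd_lt c hc _ hrx)
      (cform_step c hc _ hrx p h) (fun y hy => hr y (by simp [hy]))
    refine ⟨c', hc', ?_, by simpa using h'⟩
    show run (dl (enc i c) x) r = _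
    rw [dl_enc i hi c hc x hx]; exact e

theorem swap12_bij (u v w : ℕ) (hu : u < 3) (hv : v < 3) (hw : w < 3) (huv : u ≠ v) (huw : u ≠ w)
    (hvw : v ≠ w) : Set.BijOn (fun x => if x = 0 then u else if x = 1 then v else w)
    {x | x < 3} {x | x < 3} := by
  refine ⟨?_, ?_, ?_⟩
  · intro x _
    simp only [Set.mem_ofPred_eq]
    split_ifs <;> assumption
  · intro x hx y hy h
    simp only [Set.mem_ofPred_eq] at hx hy h
    interval_cases x <;> interval_cases y <;> simp_all
  · intro y hy
    simp only [Set.mem_ofPred_eq] at hy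
    have : y = u ∨ y = v ∨ y = w := by omega
    rcases this with h | h | h
    · exact ⟨0, by simp, by simp [h]⟩
    · exact ⟨1, by simp, by simp [h]⟩
    · exact ⟨2, by simp, by simp [h]⟩

/-- The map with prescribed values on `0, 1, 2`. -/
def tri (u v w x : ℕ) : ℕ := if x = 0 then u else if x = 1 then v else w

theorem rep_map (f : ℕ → ℕ) (a b k : ℕ) : (rep [a,b] k).map f = rep [f a, f b] k := by
  simp [rep]

/-- Bounded search for a relabeling to one of the exceptional strings. -/
theorem word_bad : ∀ c ∈ [23, 25, 28, 30, 32, 34, 35, 36], ∃ u < 3, ∃ v < 3, ∃ w < 3,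
    u ≠ v ∧ u ≠ w ∧ v ≠ w ∧ (wordsT.getD (c - 11) []).map (tri u v w) ∈
      [[2,1,0,2,1,2], [0,2,1,0,1,2], [0,1,2,0,2,1,2], [1,2,0,1,2,1,2],
       [0,2,1,0,1,2,1,2], [2,0,2,1,0,2,1,2], [0,2,0,2,1,0,2,1,2], [1,2,0,1,2,0,2,1,2]] := by
  decide +kernel

theorem cform_bad (c : ℕ) (s : List ℕ) (h : cform c s)
    (hc : c ∈ [3, 4, 6, 8, 10, 19, 23, 25, 28, 29, 30, 32, 34, 35, 36]) : BadTernary s := by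
  have bij : ∀ u v w, u < 3 → v < 3 → w < 3 → u ≠ v → u ≠ w → v ≠ w →
      Set.BijOn (tri u v w) {x | x < 3} {x | x < 3} := swap12_bij
  have h021 := bij 0 2 1 (by simp) (by simp) (by simp) (by simp) (by simp) (by simp)
  have six : ∀ s, cform 6 s → BadTernary s := by
    rintro s ⟨i, j, hi, rfl⟩
    refine ⟨_, h021, Or.inr (Or.inr (Or.inr (Or.inr (Or.inl ⟨i, j, hi, ?_⟩))))⟩
    rw [rep_shift]
    simp [rep_map, tri]
  have words : ∀ c ∈ [23, 25, 28, 30, 32, 34, 35, 36], cform c s → BadTernary s := by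
    intro c hc h
    obtain ⟨u, hu, v, hv, w, hw, huv, huw, hvw, hm⟩ := word_bad c hc
    have h11 : 11 ≤ c := by fin_cases hc <;> simp
    obtain ⟨n, rfl⟩ : ∃ n, c = n + 11 := ⟨c - 11, by omega⟩
    have hs : wordsT[n]? = some s := h
    have hg : wordsT.getD n [] = s := by
      rw [List.getD_eq_getElem?_getD, hs]; rfl
    rw [Nat.add_sub_cancel, hg] at hm
    refine ⟨_, bij u v w hu hv hw huv huw hvw, Or.inr (Or.inr (Or.inr (Or.inr (Or.inr ?_))))⟩
    simpa using hm
  by_cases hw : c ∈ [23, 25, 28, 30, 32, 34, 35, 36]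
  · exact words c hw h
  have hc' : c = 3 ∨ c = 4 ∨ c = 6 ∨ c = 8 ∨ c = 10 ∨ c = 19 ∨ c = 29 := by
    simp only [List.mem_cons, List.not_mem_nil, or_false] at hc hw
    omega
  rcases hc' with rfl | rfl | rfl | rfl | rfl | rfl | rfl
  · obtain ⟨j, hj, rfl⟩ := h
    refine ⟨_, bij 0 1 2 (by simp) (by simp) (by simp) (by simp) (by simp) (by simp),
      Or.inl ⟨j, hj, ?_⟩⟩
    simp [rep_map, tri]
  · obtain ⟨j, hj, rfl⟩ := h
    refine ⟨_, h021, Or.inr (Or.inl ⟨j, hj, ?_⟩)⟩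
    rw [rep_shift]
    simp [rep_map, tri]
  · exact six s h
  · obtain ⟨xs, hne, hxs, rfl⟩ := h
    refine ⟨_, h021, Or.inr (Or.inr (Or.inl ⟨xs.map (tri 0 2 1), by simpa using hne, ?_, ?_⟩))⟩
    · intro y hy
      obtain ⟨z, hz, rfl⟩ := List.mem_map.1 hy
      rcases hxs z hz with rfl | rfl <;> simp [tri]
    · simp [List.map_flatten, Function.comp_def, tri]
  · obtain ⟨xs, hne, hxs, rfl⟩ := h
    refine ⟨_, bij 2 0 1 (by simp) (by simp) (by simp) (by simp) (by simp) (by simp),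
      Or.inr (Or.inr (Or.inr (Or.inl ⟨xs.map (tri 2 0 1), by simpa using hne, ?_, ?_⟩)))⟩
    · intro y hy
      obtain ⟨z, hz, rfl⟩ := List.mem_map.1 hy
      rcases hxs z hz with rfl | rfl <;> simp [tri]
    · simp [List.map_flatten, Function.comp_def, tri]
  · refine six s ⟨1, 0, by simp, ?_⟩
    have hs : wordsT[8]? = some s := h
    exact (Option.some.inj hs).symm
  · refine six s ⟨1, 1, by simp, ?_⟩
    have hs : wordsT[18]? = some s := h
    exact (Option.some.inj hs).symm

theorem rel_surj : ∀ i < 6, ∀ y < 3, ∃ x < 3, rel i x = y := by decide +kernel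

theorem bad_comp (s : List ℕ) (i : ℕ) (hi : i < 6) (h : BadTernary (s.map (rel i))) :
    BadTernary s := by
  obtain ⟨f, hf, hb⟩ := h
  refine ⟨f ∘ rel i, hf.comp ?_, by simpa using hb⟩
  have hm : Set.MapsTo (rel i) {x | x < 3} {x | x < 3} := fun x hx => rel_lt i hi x hx
  have hin : Set.InjOn (rel i) {x | x < 3} := fun x hx y hy h => rel_inj i hi x hx y hy h
  refine ⟨hm, hin, ?_⟩
  intro y hy
  obtain ⟨x, hx, e⟩ := rel_surj i hi y hy
  exact ⟨x, hx, e⟩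

theorem acc_bad (s : List ℕ) (h3 : ∀ x ∈ s, x < 3) (hc : s.IsChain (· ≠ ·)) (hl : 2 ≤ s.length)
    (ha : acc (run 1 s) = true) : BadTernary s := by
  obtain ⟨a, b, r, rfl⟩ : ∃ a b r, s = a :: b :: r := by
    match s, hl with
    | a :: b :: r, _ => exact ⟨a, b, r, rfl⟩
  have ha3 := h3 a (by simp)
  have hb3 := h3 b (by simp)
  have hab : a ≠ b := by
    rw [List.isChain_cons_cons] at hc; exact hc.1
  obtain ⟨hi, r0, r1⟩ := pidx_ok a ha3 b hb3 hab
  have e : run 1 (a :: b :: r) = run (enc (pidx a b) 11) r := by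
    show run (dl (dl 1 a) b) r = _
    rw [dl_first a ha3, dl_second a ha3 b hb3 hab]
  obtain ⟨c', hc', e', h'⟩ := run_enc (pidx a b) hi r 11 [0, 1] (by norm_num) rfl
    (fun y hy => h3 y (by simp [hy]))
  rw [e, e'] at ha
  refine bad_comp _ (pidx a b) hi (cform_bad c' _ ?_ (acc_enc _ hi c' hc' ha))
  simpa [r0, r1] using h'

/-- `Blow t s`: the string `s` is obtained from `t` by repeating letters. -/
inductive Blow : List ℕ → List ℕ → Prop
  | nil : Blow [] []
  | cons (a k : ℕ) {t s : List ℕ} (h : Blow t s) : Blow (a :: t) (List.replicate (k+1) a ++ s)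

theorem Blow.refl (t : List ℕ) : Blow t t := by
  induction t with
  | nil => exact Blow.nil
  | cons a t ih => exact Blow.cons a 0 ih

theorem Blow.append {t1 s1 t2 s2 : List ℕ} (h1 : Blow t1 s1) (h2 : Blow t2 s2) :
    Blow (t1 ++ t2) (s1 ++ s2) := by
  induction h1 with
  | nil => exact h2
  | cons a k h ih => rw [List.append_assoc]; exact Blow.cons a k ih

theorem Blow.rev {t s : List ℕ} (h : Blow t s) : Blow t.reverse s.reverse := by
  induction h with
  | nil => exact Blow.nil
  | cons a k h ih =>
    rw [List.reverse_cons, List.reverse_append, List.reverse_replicate]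
    refine ih.append ?_
    have := Blow.cons a k Blow.nil
    simpa using this

theorem Blow.cons_inv {a : ℕ} {t s : List ℕ} (h : Blow (a :: t) s) :
    ∃ k s', s = List.replicate (k+1) a ++ s' ∧ Blow t s' := by
  cases h with
  | cons a k h => exact ⟨k, _, rfl, h⟩

theorem Blow.append_inv {t1 t2 s : List ℕ} (h : Blow (t1 ++ t2) s) :
    ∃ s1 s2, s = s1 ++ s2 ∧ Blow t1 s1 ∧ Blow t2 s2 := by
  induction t1 generalizing s with
  | nil => exact ⟨[], s, rfl, Blow.nil, h⟩
  | cons a t1 ih =>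
    obtain ⟨k, s', rfl, h'⟩ := Blow.cons_inv h
    obtain ⟨s1, s2, rfl, h1, h2⟩ := ih h'
    exact ⟨List.replicate (k+1) a ++ s1, s2, by simp, Blow.cons a k h1, h2⟩

theorem Blow.flip {t t' s : List ℕ} (hr : Red t t') (h : Blow t s) :
    ∃ s', FlipStep s s' ∧ Blow t' s' := by
  obtain ⟨a, w, v, rfl, rfl⟩ := hr
  obtain ⟨k, s', rfl, h1⟩ := h.cons_inv
  obtain ⟨s1, s2, rfl, h2, h3⟩ := h1.append_inv
  obtain ⟨m, s3, rfl, h4⟩ := h3.cons_inv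
  refine ⟨s1.reverse ++ (List.replicate (k+1+m+1) a ++ s3),
    ⟨(List.replicate (k+1) a ++ s1).length, ?_, ?_, ?_⟩, h2.rev.append (Blow.cons a (k+1+m) h4)⟩
  · simp only [List.length_append, List.length_replicate]; omega
  · simp only [List.length_append, List.length_replicate]; omega
  · rw [pflip, ← List.append_assoc (List.replicate (k+1) a), List.take_left, List.drop_left,
      List.reverse_append, List.reverse_replicate]
    rw [show k + 1 + m + 1 = (k + 1) + (m + 1) by omega, List.replicate_add]
    simp only [List.append_assoc]

theorem grouped_three (a b c i j k : ℕ) (hab : a ≠ b) (hac : a ≠ c) (hbc : b ≠ c) :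
    Grouped (List.replicate i a ++ (List.replicate j b ++ List.replicate k c)) := by
  intro x y z hxy hyz h
  simp only [List.get_eq_getElem, List.getElem_append, List.getElem_replicate,
    List.length_replicate, Fin.lt_def] at *
  split_ifs at * <;> first | rfl | omega

theorem Red.length {s t : List ℕ} (h : Red s t) : s.length = t.length + 1 := by
  obtain ⟨a, w, v, rfl, rfl⟩ := h
  simp

theorem Red.mem {s t : List ℕ} (h : Red s t) (x : ℕ) : x ∈ t ↔ x ∈ s := by
  obtain ⟨a, w, v, rfl, rfl⟩ := h
  simp only [List.mem_append, List.mem_reverse, List.mem_cons]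
  tauto

theorem Red.chain {s t : List ℕ} (h : Red s t) (hs : s.IsChain (· ≠ ·)) : t.IsChain (· ≠ ·) := by
  obtain ⟨a, w, v, rfl, rfl⟩ := h
  have hs : ((a :: w) ++ a :: v).IsChain (· ≠ ·) := hs
  rw [List.isChain_append] at hs ⊢
  obtain ⟨h1, h2, -⟩ := hs
  refine ⟨?_, h2, ?_⟩
  · rw [List.isChain_reverse]
    exact h1.tail.imp (fun _ _ h => h.symm)
  · intro x hx y hy
    have hy : a = y := by simpa using hy
    subst hy
    cases w with
    | nil => simp at hx
    | cons b w =>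
      have : b = x := by simpa using hx
      subst this
      rw [List.isChain_cons_cons] at h1
      exact h1.1.symm

theorem upper (n : ℕ) : ∀ t s : List ℕ, t.length = n + 3 → FullyKary 3 t →
    t.IsChain (· ≠ ·) → acc (run 1 t) = false → Blow t s → ∃ g, Grouped g ∧ ReachIn n s g := by
  induction n with
  | zero =>
    intro t s hl hf hc _ hb
    obtain ⟨a, b, c, rfl⟩ := List.length_eq_three.1 hl
    refine ⟨s, ?_, rfl⟩
    obtain ⟨i, s1, rfl, h1⟩ := hb.cons_inv
    obtain ⟨j, s2, rfl, h2⟩ := h1.cons_inv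
    obtain ⟨k, s3, rfl, h3⟩ := h2.cons_inv
    cases h3
    rw [List.append_nil]
    have h0 := (hf 0).2 (by norm_num)
    have h1 := (hf 1).2 (by norm_num)
    have h2 := (hf 2).2 (by norm_num)
    simp only [List.mem_cons, List.not_mem_nil, or_false] at h0 h1 h2
    apply grouped_three <;> omega
  | succ n ih =>
    intro t s hl hf hc ha hb
    obtain ⟨t', hr, ha'⟩ := step_main t (fun x hx => (hf x).1 hx) hc (by omega) ha
    obtain ⟨s', hs, hb'⟩ := hb.flip hr
    have := hr.length
    obtain ⟨g, hg, hreach⟩ := ih t' s' (by omega) (fun x => (hr.mem x).trans (hf x))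
      (hr.chain hc) ha' hb'
    exact ⟨g, hg, s', hs, hreach⟩

/-- Number of adjacent pairs of different symbols. -/
def chi : List ℕ → ℕ
  | [] => 0
  | [_] => 0
  | a :: b :: l => (if a = b then 0 else 1) + chi (b :: l)

theorem chi_append_le (s t : List ℕ) : chi (s ++ t) ≤ chi s + chi t + 1 := by
  induction s with
  | nil => simp [chi]
  | cons a s ih =>
    cases s with
    | nil =>
      cases t with
      | nil => simp [chi]
      | cons b t => simp only [List.cons_append, List.nil_append, chi]; split_ifs <;> omega
    | cons b s => simp only [List.cons_append, chi] at ih ⊢; omega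

theorem le_chi_append (s t : List ℕ) : chi s + chi t ≤ chi (s ++ t) := by
  induction s with
  | nil => simp [chi]
  | cons a s ih =>
    cases s with
    | nil =>
      cases t with
      | nil => simp [chi]
      | cons b t => simp only [List.cons_append, List.nil_append, chi]; split_ifs <;> omega
    | cons b s => simp only [List.cons_append, chi] at ih ⊢; omega

theorem chi_snoc (s : List ℕ) (a b : ℕ) :
    chi (s ++ [b, a]) = chi (s ++ [b]) + (if a = b then 0 else 1) := by
  induction s with
  | nil => simp [chi, eq_comm]
  | cons c s ih =>
    cases s with
    | nil => simp [chi, eq_comm]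
    | cons d s => simp only [List.cons_append, chi] at ih ⊢; omega

theorem chi_reverse (s : List ℕ) : chi s.reverse = chi s := by
  induction s with
  | nil => rfl
  | cons a s ih =>
    cases s with
    | nil => rfl
    | cons b s =>
      have e : (a :: b :: s).reverse = s.reverse ++ [b, a] := by simp
      rw [e, chi_snoc]
      rw [List.reverse_cons] at ih
      rw [ih, chi, add_comm]

theorem chi_step {s t : List ℕ} (h : FlipStep s t) : chi s ≤ chi t + 1 := by
  obtain ⟨i, -, -, rfl⟩ := h
  have h1 := chi_append_le (s.take i) (s.drop i)
  have h2 := le_chi_append (s.take i).reverse (s.drop i)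
  rw [List.take_append_drop] at h1
  rw [chi_reverse] at h2
  rw [pflip]
  omega

theorem step_perm {s t : List ℕ} (h : FlipStep s t) (x : ℕ) : x ∈ t ↔ x ∈ s := by
  obtain ⟨i, -, -, rfl⟩ := h
  rw [pflip, List.mem_append, List.mem_reverse, ← List.mem_append, List.take_append_drop]

theorem chi_reach (m : ℕ) : ∀ {s t : List ℕ}, ReachIn m s t →
    chi s ≤ chi t + m ∧ ∀ x, x ∈ t ↔ x ∈ s := by
  induction m with
  | zero => intro s t h; cases h; exact ⟨le_rfl, fun _ => Iff.rfl⟩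
  | succ m ih =>
    rintro s t ⟨u, hu, h⟩
    obtain ⟨h1, h2⟩ := ih h
    have := chi_step hu
    exact ⟨by omega, fun x => (h2 x).trans (step_perm hu x)⟩

theorem chi_normalized (s : List ℕ) (hs : s.IsChain (· ≠ ·)) : s.length ≤ chi s + 1 := by
  induction s with
  | nil => simp
  | cons a s ih =>
    cases s with
    | nil => simp
    | cons b s =>
      rw [List.isChain_cons_cons] at hs
      have := ih hs.2
      simp only [chi, if_neg hs.1, List.length_cons] at this ⊢
      omega

theorem Grouped.tail {a : ℕ} {l : List ℕ} (h : Grouped (a :: l)) : Grouped l := by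
  intro i j k hij hjk e
  exact h i.succ j.succ k.succ (by simpa using hij) (by simpa using hjk) (by simpa using e)

theorem chi_grouped (s : List ℕ) (hs : Grouped s) (hne : s ≠ []) : chi s + 1 ≤ s.toFinset.card := by
  induction s with
  | nil => exact absurd rfl hne
  | cons a s ih =>
    cases s with
    | nil => simp [chi]
    | cons b s =>
      have h := ih hs.tail (by simp)
      by_cases hab : a = b
      · subst hab
        simpa [chi] using h
      · have hn : a ∉ b :: s := by
          intro hm
          obtain ⟨k, hk⟩ := List.get_of_mem hm
          by_cases hk0 : k.val = 0
          · have : k = ⟨0, by simp⟩ := Fin.ext hk0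
            rw [this] at hk
            exact hab hk.symm
          · have := hs ⟨0, by simp⟩ ⟨1, by simp⟩ k.succ (by simp)
              (by rw [Fin.lt_def, Fin.val_succ]; show 1 < k.val + 1; omega) (by simpa using hk.symm)
            exact hab this.symm
        rw [List.toFinset_cons, Finset.card_insert_of_notMem (by simpa using hn)]
        simp only [chi, if_neg hab]
        omega

theorem grouping_good_ternary (n : ℕ) (s : List ℕ)
    (hlen : s.length = n) (hfull : FullyKary 3 s) (hnorm : Normalized s)
    (hgood : ¬ BadTernary s) :
    groupDist s = n - 3 := by
  have h3 : ∀ x ∈ s, x < 3 := fun x hx => (hfull x).1 hx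
  have hc : s.IsChain (· ≠ ·) := hnorm
  have hl : 3 ≤ s.length := by
    have hsub : Finset.range 3 ⊆ s.toFinset := by
      intro x hx
      exact List.mem_toFinset.2 ((hfull x).2 (Finset.mem_range.1 hx))
    have h1 := Finset.card_le_card hsub
    have h2 := List.toFinset_card_le s
    rw [Finset.card_range] at h1
    omega
  have ha : acc (run 1 s) = false := by
    by_contra h
    exact hgood (acc_bad s h3 hc (by omega) (by simpa using h))
  have hmem : n - 3 ∈ {m | ∃ t, Grouped t ∧ ReachIn m s t} :=
    upper (n - 3) s s (by omega) hfull hc ha (Blow.refl s)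
  apply le_antisymm
  · exact Nat.sInf_le hmem
  · refine le_csInf ⟨_, hmem⟩ ?_
    rintro m ⟨t, ht, hr⟩
    obtain ⟨h1, h2⟩ := chi_reach m hr
    have h4 := chi_normalized s hc
    have hne : t ≠ [] := by
      intro h
      have := (h2 0).2 ((hfull 0).2 (by norm_num))
      rw [h] at this
      cases this
    have h5 := chi_grouped t ht hne
    have hsub : t.toFinset ⊆ Finset.range 3 := by
      intro x hx
      exact Finset.mem_range.2 (h3 x ((h2 x).1 (List.mem_toFinset.1 hx)))
    have h6 := Finset.card_le_card hsub
    rw [Finset.card_range] at h6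
    omega
end

section
/- A normalized fully ternary string s of length n has flip grouping distance d_g(s) = n − 2 if and only if s is bad, and d_g(s) = n − 3 otherwise. -/
namespace FlipTernary

def alt (x y : ℕ) : ℕ → List ℕ
  | 0 => []
  | n+1 => x :: alt y x n

/-- Positions are numbered from `k`; the symbol `c` is exactly at the even positions. -/
def AltN (c : ℕ) : ℕ → List ℕ → Prop
  | _, [] => True
  | k, x :: s => (x = c ↔ k % 2 = 0) ∧ AltN c (k+1) s

instance decAltN (c : ℕ) : ∀ (k : ℕ) (s : List ℕ), Decidable (AltN c k s)
  | _, [] => isTrue trivial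
  | k, x :: s =>
    have := decAltN c (k+1) s
    inferInstanceAs (Decidable ((x = c ↔ k % 2 = 0) ∧ AltN c (k+1) s))

@[simp] theorem alt_length (n : ℕ) : ∀ x y, (alt x y n).length = n := by
  induction n with
  | zero => intros; rfl
  | succ n ih => intro x y; simp [alt, ih]

theorem mem_alt {n : ℕ} : ∀ {x y z : ℕ}, z ∈ alt x y n → z = x ∨ z = y := by
  induction n with
  | zero => intro x y z h; simp [alt] at h
  | succ n ih =>
    intro x y z h
    simp only [alt, List.mem_cons] at h
    rcases h with h | h
    · exact Or.inl h
    · exact (ih h).symm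

theorem map_alt (g : ℕ → ℕ) (n : ℕ) : ∀ x y, (alt x y n).map g = alt (g x) (g y) n := by
  induction n with
  | zero => intros; rfl
  | succ n ih => intro x y; simp [alt, ih]

theorem rep_alt (x y m : ℕ) : rep [x,y] m = alt x y (2*m) := by
  induction m with
  | zero => rfl
  | succ m ih =>
    have : 2 * (m+1) = 2*m+1+1 := by ring
    rw [this]
    simp only [alt, ← ih]
    simp [rep, List.replicate_succ]

theorem altN_congr (c : ℕ) (s : List ℕ) : ∀ {k k' : ℕ}, k % 2 = k' % 2 → (AltN c k s ↔ AltN c k' s) := by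
  induction s with
  | nil => intros; simp [AltN]
  | cons x s ih =>
    intro k k' h
    simp only [AltN]
    rw [ih (k := k+1) (k' := k'+1) (by omega), h]

theorem altN_append (c : ℕ) (s t : List ℕ) :
    ∀ k, (AltN c k (s ++ t) ↔ AltN c k s ∧ AltN c (k + s.length) t) := by
  induction s with
  | nil => intros; simp [AltN]
  | cons x s ih =>
    intro k
    simp only [AltN, List.cons_append, ih, List.length_cons]
    rw [show k + 1 + s.length = k + (s.length + 1) by ring, and_assoc]

theorem altN_reverse (c : ℕ) (s : List ℕ) :
    ∀ k, (AltN c k s.reverse ↔ AltN c (k + s.length + 1) s) := by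
  induction s with
  | nil => intros; simp [AltN]
  | cons x s ih =>
    intro k
    simp only [AltN, List.reverse_cons, altN_append, ih, List.length_cons, List.length_reverse]
    rw [altN_congr c s (k := k + (s.length+1) + 1 + 1) (k' := k + s.length + 1) (by omega),
      show (k + (s.length + 1) + 1) % 2 = (k + s.length) % 2 by omega]
    tauto

theorem altN_alt_even (c y : ℕ) (h : y ≠ c) (n : ℕ) :
    ∀ k, (k % 2 = 0 → AltN c k (alt c y n)) ∧ (k % 2 = 1 → AltN c k (alt y c n)) := by
  induction n with
  | zero => intro k; simp [alt, AltN]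
  | succ n ih =>
    intro k
    constructor
    · intro hk
      exact ⟨by simp [hk], (ih (k+1)).2 (by omega)⟩
    · intro hk
      exact ⟨by simp [hk, h], (ih (k+1)).1 (by omega)⟩

theorem altN_two (c b : ℕ) (l : List ℕ) : ∀ k, AltN c k l → (∀ x ∈ l, x = c ∨ x = b) → b ≠ c →
    (k % 2 = 0 → l = alt c b l.length) ∧ (k % 2 = 1 → l = alt b c l.length) := by
  induction l with
  | nil => intros; simp [alt]
  | cons x l ih =>
    intro k h hm hb
    have h1 := ih (k+1) h.2 (fun y hy => hm y (by simp [hy])) hb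
    have h2 := h.1
    have h3 := hm x (by simp)
    constructor
    · intro hk
      have : x = c := h2.2 hk
      simp only [alt, List.length_cons]
      rw [← h1.2 (by omega), this]
    · intro hk
      have : x = b := by
        rcases h3 with h3 | h3
        · have := h2.1 h3
          omega
        · exact h3
      simp only [alt, List.length_cons]
      rw [← h1.1 (by omega), this]

def ivList (p q r : ℕ) : List (List ℕ) :=
  [[q,r,p,q,r,q], [p,q,r,p,r,q], [p,r,q,p,q,r,q], [r,q,p,r,q,r,q],
   [p,q,r,p,r,q,r,q], [q,p,q,r,p,q,r,q], [p,q,p,q,r,p,q,r,q], [r,q,p,r,q,p,q,r,q]]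

def T1 (p q r : ℕ) (s : List ℕ) : Prop := ∃ j, s = p :: alt r q (2*j+4)
def T3 (p q r : ℕ) (s : List ℕ) : Prop :=
  ∃ i j, s = p :: (alt q r (2*i+2) ++ p :: q :: alt r q (2*j))

def Dist3 (p q r : ℕ) : Prop := p < 3 ∧ q < 3 ∧ r < 3 ∧ p ≠ q ∧ p ≠ r ∧ q ≠ r

instance (p q r : ℕ) : Decidable (Dist3 p q r) := by unfold Dist3; infer_instance

/-- Types I, II, III. -/
def B3 (s : List ℕ) : Prop := ∃ p q r, Dist3 p q r ∧
  (AltN q (s.length+1) s ∨ T1 p q r s ∨ T3 p q r s)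

def B4 (s : List ℕ) : Prop := ∃ p q r, Dist3 p q r ∧ s ∈ ivList p q r

def B (s : List ℕ) : Prop := B3 s ∨ B4 s

/-- Boolean equality of lists, for fast evaluation. -/
def eqB : List ℕ → List ℕ → Bool
  | [], [] => true
  | [], _ :: _ => false
  | _ :: _, [] => false
  | x :: s, y :: t => Nat.beq x y && eqB s t

theorem eqB_iff : ∀ s t : List ℕ, eqB s t = true ↔ s = t
  | [], [] => by simp [eqB]
  | [], _ :: _ => by simp [eqB]
  | _ :: _, [] => by simp [eqB]
  | x :: s, y :: t => by simp [eqB, eqB_iff s t]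

def altB (c : ℕ) : Bool → List ℕ → Bool
  | _, [] => true
  | b, x :: s => (Nat.beq x c == b) && altB c (!b) s

theorem altB_iff (c : ℕ) : ∀ (s : List ℕ) (k : ℕ),
    altB c (Nat.beq (k % 2) 0) s = true ↔ AltN c k s
  | [], _ => by simp [altB, AltN]
  | x :: s, k => by
    have h : (!Nat.beq (k % 2) 0) = Nat.beq ((k+1) % 2) 0 := by
      rcases Nat.mod_two_eq_zero_or_one k with h | h
      · rw [h, show (k+1) % 2 = 1 by omega]; rfl
      · rw [h, show (k+1) % 2 = 0 by omega]; rfl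
    simp only [altB, AltN, Bool.and_eq_true, h, altB_iff c s (k+1), beq_iff_eq]
    rw [Bool.eq_iff_iff, Nat.beq_eq, Nat.beq_eq]

def perms : List (ℕ × ℕ × ℕ) := [(0,1,2), (0,2,1), (1,0,2), (1,2,0), (2,0,1), (2,1,0)]

/-- Boolean version of `B`. -/
def BD (s : List ℕ) : Bool := perms.any fun x =>
  altB x.2.1 (Nat.beq ((s.length+1) % 2) 0) s ||
  eqB s (x.1 :: alt x.2.2 x.2.1 (2*((s.length-5)/2)+4)) ||
  ((List.range ((s.length-3)/2)).any fun i =>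
    eqB s (x.1 :: (alt x.2.1 x.2.2 (2*i+2) ++
      x.1 :: x.2.1 :: alt x.2.2 x.2.1 (2*((s.length-5-2*i)/2))))) ||
  (ivList x.1 x.2.1 x.2.2).any (eqB s)

theorem mem_perms {p q r : ℕ} (h : Dist3 p q r) : (p, q, r) ∈ perms := by
  obtain ⟨h1, h2, h3, h4, h5, h6⟩ := h
  have e : (p = 0 ∨ p = 1 ∨ p = 2) ∧ (q = 0 ∨ q = 1 ∨ q = 2) ∧ (r = 0 ∨ r = 1 ∨ r = 2) := by
    omega
  obtain ⟨e1, e2, e3⟩ := e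
  clear h1 h2 h3
  rcases e1 with rfl | rfl | rfl <;> rcases e2 with rfl | rfl | rfl <;>
    rcases e3 with rfl | rfl | rfl <;> simp_all [perms]

theorem dist3_of_mem : ∀ x ∈ perms, Dist3 x.1 x.2.1 x.2.2 := by decide

theorem B_iff_BD (s : List ℕ) : B s ↔ BD s = true := by
  constructor
  · intro hB
    have key : ∃ p q r, Dist3 p q r ∧
        (AltN q (s.length+1) s ∨ T1 p q r s ∨ T3 p q r s ∨ s ∈ ivList p q r) := by
      rcases hB with ⟨p, q, r, h, h2⟩ | ⟨p, q, r, h, h2⟩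
      · exact ⟨p, q, r, h, by tauto⟩
      · exact ⟨p, q, r, h, by tauto⟩
    obtain ⟨p, q, r, h, h2⟩ := key
    unfold BD
    rw [List.any_eq_true]
    refine ⟨_, mem_perms h, ?_⟩
    simp only [Bool.or_eq_true, List.any_eq_true, eqB_iff, altB_iff]
    rcases h2 with h2 | ⟨j, h2⟩ | ⟨i, j, h2⟩ | h2
    · exact Or.inl (Or.inl (Or.inl h2))
    · have := congrArg List.length h2
      simp at this
      refine Or.inl (Or.inl (Or.inr ?_))
      rw [show (s.length - 5)/2 = j by omega]
      exact h2
    · have := congrArg List.length h2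
      simp at this
      refine Or.inl (Or.inr ⟨i, by simp; omega, ?_⟩)
      rw [show (s.length - 5 - 2*i)/2 = j by omega]
      exact h2
    · exact Or.inr ⟨s, h2, rfl⟩
  · intro hB
    unfold BD at hB
    rw [List.any_eq_true] at hB
    obtain ⟨⟨p, q, r⟩, hm, h2⟩ := hB
    have h := dist3_of_mem _ hm
    simp only [Bool.or_eq_true, List.any_eq_true, eqB_iff, altB_iff] at h2
    rcases h2 with ((h2 | h2) | ⟨i, -, h2⟩) | ⟨t, h2, rfl⟩
    · exact Or.inl ⟨p, q, r, h, Or.inl h2⟩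
    · exact Or.inl ⟨p, q, r, h, Or.inr (Or.inl ⟨_, h2⟩)⟩
    · exact Or.inl ⟨p, q, r, h, Or.inr (Or.inr ⟨_, _, h2⟩)⟩
    · exact Or.inr ⟨p, q, r, h, h2⟩

def Child (s t : List ℕ) : Prop := ∃ a u v, s = a :: (u ++ a :: v) ∧ t = u.reverse ++ a :: v

/-- The unmerging of `t` at position `i`. -/
def par (t : List ℕ) (i : ℕ) : List ℕ :=
  match t.drop i with
  | [] => []
  | a :: v => a :: ((t.take i).reverse ++ a :: v)

/-- The merging of `s` at position `i + 1`. -/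
def chi (s : List ℕ) (i : ℕ) : Option (List ℕ) :=
  match s with
  | [] => none
  | a :: l => if (l.drop i).head? = some a then some ((l.take i).reverse ++ l.drop i) else none

theorem child_iff (s t : List ℕ) : Child s t ↔ ∃ i < s.length, chi s i = some t := by
  constructor
  · rintro ⟨a, u, v, rfl, rfl⟩
    refine ⟨u.length, by simp, by simp [chi]⟩
  · rintro ⟨i, hi, h⟩
    cases s with
    | nil => simp [chi] at h
    | cons a l =>
      simp only [chi] at h
      split_ifs at h with h1
      simp only [Option.some.injEq] at h
      obtain ⟨v, hv⟩ : ∃ v, l.drop i = a :: v := by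
        cases hd : l.drop i with
        | nil => simp [hd] at h1
        | cons b v => simp [hd] at h1; exact ⟨v, by rw [h1]⟩
      refine ⟨a, l.take i, v, ?_, ?_⟩
      · rw [← hv, List.take_append_drop]
      · rw [← h, hv]

theorem child_par {s t : List ℕ} (h : Child s t) : ∃ i < t.length, s = par t i := by
  obtain ⟨a, u, v, rfl, rfl⟩ := h
  refine ⟨u.length, by simp, ?_⟩
  have h1 : (u.reverse ++ a :: v).drop u.length = a :: v := by
    rw [List.drop_append]; simp
  have h2 : (u.reverse ++ a :: v).take u.length = u.reverse := by
    rw [List.take_append]; simp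
  simp [par, h1, h2]

def isNorm : List ℕ → Bool
  | [] => true
  | [_] => true
  | x :: y :: l => !(Nat.beq x y) && isNorm (y :: l)

theorem isNorm_of : ∀ l : List ℕ, l.IsChain (· ≠ ·) → isNorm l = true
  | [], _ => rfl
  | [_], _ => rfl
  | x :: y :: l, h => by
    rw [List.isChain_cons_cons] at h
    have := isNorm_of (y :: l) h.2
    have h1 : Nat.beq x y = false := by
      rw [Bool.eq_false_iff]; intro h2; exact h.1 (Nat.beq_eq ▸ h2)
    simp [isNorm, this, h1]

/-- Evaluates the list before passing it on (only for speed). -/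
def force (l : List ℕ) (k : List ℕ → Bool) : Bool :=
  match l with
  | [] => k []
  | x :: l => force l (fun l' => k (x :: l'))

theorem force_eq : ∀ (l : List ℕ) (k : List ℕ → Bool), force l k = k l
  | [], _ => rfl
  | x :: l, k => by rw [force, force_eq l]

def BF (s : List ℕ) : Bool := force s BD

theorem BF_eq (s : List ℕ) : BF s = BD s := force_eq s BD

def downB (s : List ℕ) : Bool := (List.range s.length).all fun i => (chi s i).all BF

def hasGood (s : List ℕ) : Bool := (List.range s.length).any fun i => (chi s i).any fun t => !(BF t)

def upB (t : List ℕ) : Bool := (List.range t.length).all fun i =>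
  force (par t i) fun s => !(isNorm s) || BD s || hasGood s

theorem iv_both_aux : (perms.all fun x => (ivList x.1 x.2.1 x.2.2).all fun s =>
    downB s && upB s) = true := by
  decide +kernel

theorem iv_both {p q r : ℕ} (h : Dist3 p q r) {s : List ℕ} (hs : s ∈ ivList p q r) :
    downB s = true ∧ upB s = true := by
  have h1 := iv_both_aux
  rw [List.all_eq_true] at h1
  have h2 := h1 _ (mem_perms h)
  rw [List.all_eq_true] at h2
  simpa using h2 s hs

theorem iv_down {s t : List ℕ} (hs : B4 s) (h : Child s t) : B t := by
  obtain ⟨p, q, r, hd, hs⟩ := hs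
  have h1 := (iv_both hd hs).1
  obtain ⟨i, hi, hc⟩ := (child_iff s t).1 h
  unfold downB at h1
  rw [List.all_eq_true] at h1
  have := h1 i (by simpa using hi)
  rw [hc] at this
  exact (B_iff_BD t).2 (by simpa [BF_eq] using this)

theorem iv_up {s t : List ℕ} (ht : B4 t) (h : Child s t) (hn : s.IsChain (· ≠ ·))
    (hall : ∀ t, Child s t → B t) : B s := by
  obtain ⟨p, q, r, hd, ht⟩ := ht
  have h1 := (iv_both hd ht).2
  obtain ⟨i, hi, rfl⟩ := child_par h
  unfold upB at h1
  rw [List.all_eq_true] at h1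
  have h2 := h1 i (by simpa using hi)
  rw [force_eq, isNorm_of _ hn] at h2
  simp only [Bool.not_true, Bool.false_or, Bool.or_eq_true] at h2
  rcases h2 with h2 | h2
  · exact (B_iff_BD _).2 h2
  · unfold hasGood at h2
    rw [List.any_eq_true] at h2
    obtain ⟨k, hk, h3⟩ := h2
    rw [Option.any_eq_true] at h3
    obtain ⟨t', h4, h5⟩ := h3
    have := (B_iff_BD t').1 (hall t' ((child_iff _ _).2 ⟨k, by simpa using hk, h4⟩))
    simp [BF_eq, this] at h5

end FlipTernary

namespace FlipTernary

def Full (s : List ℕ) : Prop := ∀ a, a ∈ s ↔ a < 3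

theorem L1 {t : List ℕ} (hB : B3 t) (hodd : t.length % 2 = 1) {x y z : ℕ} {w : List ℕ}
    (ht : t = x :: y :: z :: y :: x :: w) (hxz : x ≠ z) (hyz : y ≠ z) : False := by
  obtain ⟨p, q, r, ⟨-, -, -, hpq, hpr, hqr⟩, h | ⟨j, h⟩ | ⟨i, j, h⟩⟩ := hB
  · subst ht
    simp only [AltN] at h
    have h1 := h.1.2 (by omega)
    have h2 := h.2.2.1.2 (by omega)
    omega
  · rw [ht] at h
    simp only [alt, List.cons.injEq] at h
    omega
  · rw [ht] at h
    cases i with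
    | zero => simp [alt] at h; omega
    | succ i =>
      rw [show 2 * (i+1) + 2 = 2*i+1+1+1+1 by ring] at h
      simp [alt] at h; omega

theorem L2 {t : List ℕ} (hB : B3 t) (hodd : t.length % 2 = 1) {x y z : ℕ} {w : List ℕ}
    (ht : t = x :: y :: z :: x :: w) (hxz : x ≠ z) :
    ∃ j, w = y :: alt z y (2*j) := by
  obtain ⟨p, q, r, ⟨-, -, -, hpq, hpr, hqr⟩, h | ⟨j, h⟩ | ⟨i, j, h⟩⟩ := hB
  · subst ht
    simp only [AltN] at h
    have h1 := h.1.2 (by omega)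
    have h2 := h.2.2.1.2 (by omega)
    omega
  · rw [ht] at h
    simp only [alt, List.cons.injEq] at h
    omega
  · rw [ht] at h
    cases i with
    | zero =>
      simp [alt] at h
      obtain ⟨rfl, rfl, rfl, -, h⟩ := h
      exact ⟨j, h⟩
    | succ i =>
      rw [show 2 * (i+1) + 2 = 2*i+1+1+1+1 by ring] at h
      simp [alt] at h; omega

theorem exists_alt {b c : ℕ} : ∀ l : List ℕ, l.IsChain (· ≠ ·) → (∀ x ∈ l, x = b ∨ x = c) →
    l = alt b c l.length ∨ l = alt c b l.length := by
  intro l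
  induction l with
  | nil => intros; simp [alt]
  | cons x l ih =>
    intro h hm
    have hl : l.IsChain (· ≠ ·) := by
      cases l with
      | nil => simp
      | cons y l => exact (List.isChain_cons_cons.1 h).2
    have h1 := ih hl (fun y hy => hm y (by simp [hy]))
    have h2 := hm x (by simp)
    cases l with
    | nil => rcases h2 with rfl | rfl <;> simp [alt]
    | cons y l =>
      have h3 := (List.isChain_cons_cons.1 h).1
      rcases h1 with h1 | h1
      · right
        have hy : y = b := by
          simp only [alt, List.length_cons, List.cons.injEq] at h1; exact h1.1
        have hx : x = c := by
          rcases h2 with h2 | h2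
          · exact absurd (h2.trans hy.symm) h3
          · exact h2
        rw [List.length_cons, alt, ← h1, hx]
      · left
        have hy : y = c := by
          simp only [alt, List.length_cons, List.cons.injEq] at h1; exact h1.1
        have hx : x = b := by
          rcases h2 with h2 | h2
          · exact h2
          · exact absurd (h2.trans hy.symm) h3
        rw [List.length_cons, alt, ← h1, hx]

theorem count_alt_notMem {n x y z : ℕ} (h1 : z ≠ x) (h2 : z ≠ y) : (alt x y n).count z = 0 := by
  rw [List.count_eq_zero]
  intro h
  rcases mem_alt h with h | h <;> contradiction

/-- Bad strings stay bad under merging. -/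
theorem fwd {s t : List ℕ} (hB : B s) (hc : Child s t) : B t := by
  rcases hB with hB | hB
  swap
  · exact iv_down hB hc
  obtain ⟨p, q, r, hd, h⟩ := hB
  obtain ⟨a, u, v, rfl, rfl⟩ := hc
  have hd' := hd
  obtain ⟨-, -, -, hpq, hpr, hqr⟩ := hd'
  left
  refine ⟨p, q, r, hd, Or.inl ?_⟩
  rcases h with h | ⟨j, h⟩ | ⟨i, j, h⟩
  · simp only [AltN, altN_append, altN_reverse, List.length_cons, List.length_append,
      List.length_reverse] at h ⊢
    obtain ⟨h1, h2, h3, h4⟩ := h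
    have hu : u.length % 2 = 1 := by
      by_cases hq : a = q
      · have := h1.1 hq
        have := h3.1 hq
        omega
      · have : ¬ _ := fun e => hq (h1.2 e)
        have : ¬ _ := fun e => hq (h3.2 e)
        omega
    refine ⟨(altN_congr q u ?_).1 h2, ?_, (altN_congr q v ?_).1 h4⟩
    · omega
    · rw [h3]; omega
    · omega
  · exfalso
    simp only [List.cons.injEq] at h
    obtain ⟨rfl, h⟩ := h
    have : a ∈ alt r q (2*j+4) := by rw [← h]; simp
    rcases mem_alt this with h | h <;> contradiction
  · simp only [List.cons.injEq] at h
    obtain ⟨rfl, h⟩ := h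
    have hm1 : a ∉ alt q r (2*i+2) := by
      intro h; rcases mem_alt h with h | h <;> contradiction
    have hm2 : a ∉ q :: alt r q (2*j) := by
      intro h
      rcases List.mem_cons.1 h with h | h
      · contradiction
      · rcases mem_alt h with h | h <;> contradiction
    have := (List.append_cons_inj_of_notMem hm1 hm2).1 h.symm
    obtain ⟨rfl, -, rfl⟩ := this
    simp only [AltN, altN_append, altN_reverse, List.length_cons, List.length_append,
      List.length_reverse, alt_length]
    refine ⟨(altN_alt_even q r hqr.symm _ _).1 (by omega), ?_, ?_,
      (altN_alt_even q r hqr.symm _ _).2 (by omega)⟩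
    · constructor
      · intro h; exact absurd h hpq
      · omega
    · simp; omega

/-- A string all of whose mergings are bad is bad. -/
theorem bwd {s : List ℕ} (hf : Full s) (hn : s.IsChain (· ≠ ·)) (hl : 4 ≤ s.length)
    (hall : ∀ t, Child s t → B t) : B s := by
  by_cases h4 : ∃ t, Child s t ∧ B4 t
  · obtain ⟨t, hc, ht⟩ := h4
    exact iv_up ht hc hn hall
  replace hall : ∀ t, Child s t → B3 t := by
    intro t ht
    rcases hall t ht with h | h
    · exact h
    · exact absurd ⟨t, ht, h⟩ h4
  clear h4
  cases s with
  | nil => simp at hl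
  | cons a l =>
  have ha : a < 3 := (hf a).1 (by simp)
  by_cases hal : a ∈ l
  swap
  · obtain ⟨b, c, hb, hc, hab, hac, hbc⟩ :
        ∃ b c, b < 3 ∧ c < 3 ∧ a ≠ b ∧ a ≠ c ∧ b ≠ c := by
      have : a = 0 ∨ a = 1 ∨ a = 2 := by omega
      rcases this with rfl | rfl | rfl
      · exact ⟨1, 2, by omega⟩
      · exact ⟨0, 2, by omega⟩
      · exact ⟨0, 1, by omega⟩
    have hln : l.IsChain (· ≠ ·) := by
      cases l with
      | nil => simp
      | cons y l => exact (List.isChain_cons_cons.1 hn).2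
    have hm : ∀ x ∈ l, x = b ∨ x = c := by
      intro x hx
      have h1 : x < 3 := (hf x).1 (by simp [hx])
      have h2 : x ≠ a := by rintro rfl; exact hal hx
      omega
    obtain ⟨x, y, hx, hy, hax, hay, hxy, hlx⟩ :
        ∃ x y, x < 3 ∧ y < 3 ∧ a ≠ x ∧ a ≠ y ∧ x ≠ y ∧ l = alt x y l.length := by
      rcases exists_alt l hln hm with h | h
      · exact ⟨b, c, hb, hc, hab, hac, hbc, h⟩
      · exact ⟨c, b, hc, hb, hac, hab, hbc.symm, h⟩
    simp only [List.length_cons] at hl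
    left
    rcases Nat.mod_two_eq_zero_or_one l.length with hp | hp
    · refine ⟨a, y, x, ⟨ha, hy, hx, hay, hax, hxy.symm⟩, Or.inr (Or.inl ⟨(l.length-4)/2, ?_⟩)⟩
      rw [show 2 * ((l.length-4)/2)+4 = l.length by omega, ← hlx]
    · refine ⟨a, x, y, ⟨ha, hx, hy, hax, hay, hxy⟩, Or.inl ⟨?_, ?_⟩⟩
      · simp only [List.length_cons]
        constructor
        · intro h; exact absurd h hax
        · omega
      · rw [hlx]
        apply (altN_alt_even x y hxy.symm _ _).1
        simp; omega
  obtain ⟨u, v, rfl, hau⟩ := List.eq_append_cons_of_mem hal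
  have hu0 : u ≠ [] := by
    rintro rfl
    exact (List.isChain_cons_cons.1 hn).1 rfl
  have h1 := hall _ ⟨a, u, v, rfl, rfl⟩
  obtain ⟨p, q, r, hd, h⟩ := h1
  have hd' := hd
  obtain ⟨hp3, hq3, hr3, hpq, hpr, hqr⟩ := hd'
  rcases h with h | ⟨j, h⟩ | ⟨i, j, h⟩
  · -- type II
    simp only [AltN, altN_append, altN_reverse, List.length_cons, List.length_append,
      List.length_reverse] at h
    obtain ⟨h2, h3, h5⟩ := h
    by_cases haq : a = q
    · subst haq
      obtain ⟨x, rfl⟩ : ∃ x, u = [x] := by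
        cases u with
        | nil => exact absurd rfl hu0
        | cons x u =>
          cases u with
          | nil => exact ⟨x, rfl⟩
          | cons y u =>
            exfalso
            simp only [List.mem_cons, not_or] at hau
            simp only [AltN] at h2
            have e1 : ¬ _ := fun e => hau.1 (h2.1.2 e).symm
            have e2 : ¬ _ := fun e => hau.2.1 (h2.2.1.2 e).symm
            omega
      left
      refine ⟨p, a, r, hd, Or.inl ?_⟩
      simp only [List.length_cons, List.length_nil] at h3 h5
      simp only [AltN, List.cons_append, List.nil_append, List.length_cons] at h2 ⊢
      have hxa : x ≠ a := by
        rintro rfl; simp at hau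
      have h3' := h3.1 trivial
      refine ⟨by simp; omega, ⟨by intro h; exact absurd h hxa, by omega⟩, by simp; omega, ?_⟩
      exact (altN_congr a v (by omega)).1 h5
    · have h3' : ¬ _ := fun e => haq (h3.2 e)
      rcases Nat.mod_two_eq_zero_or_one u.length with hp | hp
      swap
      · left
        refine ⟨p, q, r, hd, Or.inl ?_⟩
        simp only [AltN, altN_append, List.length_cons, List.length_append]
        refine ⟨⟨by intro h; exact absurd h haq, by omega⟩, (altN_congr q u (by omega)).1 h2,
          ⟨by intro h; exact absurd h haq, by omega⟩, (altN_congr q v (by omega)).1 h5⟩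
      obtain ⟨b, hb3, hab, hqb⟩ : ∃ b, b < 3 ∧ a ≠ b ∧ q ≠ b := by
        by_contra hcon
        push Not at hcon
        have := hcon 0 (by omega)
        have := hcon 1 (by omega)
        have := hcon 2 (by omega)
        omega
      have hulen : 0 < u.length := List.length_pos_iff.2 hu0
      have hmem : ∀ x ∈ u, x = q ∨ x = b := by
        intro x hx
        have e1 : x < 3 := (hf x).1 (by simp [hx])
        have e2 : x ≠ a := by rintro rfl; exact hau hx
        omega
      have hualt := (altN_two q b u _ h2 hmem hqb.symm).1 (by omega)
      by_cases hav : a ∈ v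
      · exfalso
        obtain ⟨u2, w, rfl, hau2⟩ := List.eq_append_cons_of_mem hav
        have h6 := hall _ ⟨a, u ++ a :: u2, w, by simp, rfl⟩
        simp only [List.length_append, List.length_cons] at h2 h3 h5 h3'
        simp only [AltN, altN_append] at h5
        obtain ⟨h5, h7, h8⟩ := h5
        have h7' : ¬ _ := fun e => haq (h7.2 e)
        have hwq : ∃ w', w = q :: w' := by
          cases w with
          | nil => simp at h3' h7'; omega
          | cons x w =>
            refine ⟨w, ?_⟩
            have := h8.1.2 (by simp at h3' h7' ⊢; omega)
            rw [this]
        obtain ⟨w', rfl⟩ := hwq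
        simp only [List.length_cons] at h2 h3 h5 h3' h7' h7 h8
        have hu2 : ∃ t, u2.reverse = q :: t := by
          have e := (altN_reverse q u2 0).2 ((altN_congr q u2 (by omega)).1 h5)
          cases hr : u2.reverse with
          | nil =>
            have := congrArg List.length hr
            simp at this; subst this; simp at h7' h3'; omega
          | cons x t =>
            rw [hr] at e
            exact ⟨t, by rw [e.1.2 rfl]⟩
        obtain ⟨t, hu2⟩ := hu2
        have hu2l : u2.length = t.length + 1 := by
          have := congrArg List.length hu2
          simpa using this
        have huq : q ∈ u := by
          rw [hualt]
          cases hh : u.length with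
          | zero => omega
          | succ n => simp [alt]
        have hcu : 1 ≤ u.count q := List.one_le_count_iff.2 huq
        obtain ⟨p', q', r', ⟨-, -, -, hpq', hpr', hqr'⟩, h | ⟨j, h⟩ | ⟨i, j, h⟩⟩ := h6
        · simp only [AltN, altN_append, List.reverse_append, List.reverse_cons, List.length_cons,
            List.length_append, List.length_reverse, List.length_nil, List.append_assoc,
            List.cons_append, List.nil_append] at h
          obtain ⟨k1, k2, k3, k4, k5, k6⟩ := h
          have e1 : q = q' := k5.2 (by omega)
          exact haq ((k2.2 (by omega)).trans e1.symm)
        · have hc := congrArg (List.count q) h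
          rw [List.reverse_append, List.reverse_cons, hu2] at h
          simp only [List.cons_append, List.cons.injEq] at h
          obtain ⟨rfl, -⟩ := h
          simp [count_alt_notMem hpr' hpq', haq] at hc
          omega
        · have hc := congrArg (List.count q) h
          have hc2 := congrArg (List.count q) hu2
          rw [List.reverse_append, List.reverse_cons, hu2] at h
          simp only [List.cons_append, List.cons.injEq] at h
          obtain ⟨rfl, -⟩ := h
          simp [count_alt_notMem hpr' hpq', count_alt_notMem hpq' hpr', haq,
            hpq'.symm] at hc hc2
          omega
      · left
        refine ⟨a, q, b, ⟨ha, hq3, hb3, haq, hab, hqb⟩, Or.inr (Or.inr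
          ⟨(u.length-2)/2, (v.length-1)/2, ?_⟩)⟩
        have hmemv : ∀ x ∈ v, x = q ∨ x = b := by
          intro x hx
          have e1 : x < 3 := (hf x).1 (by simp [hx])
          have e2 : x ≠ a := by rintro rfl; exact hav hx
          omega
        have hvalt := (altN_two q b v _ h5 hmemv hqb.symm).1 (by omega)
        rw [show 2 * ((u.length-2)/2) + 2 = u.length by omega, ← hualt]
        rw [show v.length = 2 * ((v.length-1)/2) + 1 by omega, alt] at hvalt
        rw [← hvalt]
  · -- type I
    obtain ⟨u', hu'⟩ : ∃ u', u.reverse = p :: u' := by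
      cases hr : u.reverse with
      | nil => simp at hr; exact absurd hr hu0
      | cons x t =>
        rw [hr] at h
        simp only [List.cons_append, List.cons.injEq] at h
        exact ⟨t, by rw [h.1]⟩
    have hu : u = u'.reverse ++ [p] := by
      have := congrArg List.reverse hu'
      simpa using this
    subst hu
    simp only [List.mem_append, List.mem_reverse, List.mem_singleton, not_or] at hau
    obtain ⟨hau', hap⟩ := hau
    rw [hu'] at h
    simp only [List.cons_append, List.cons.injEq, true_and] at h
    simp only [alt] at h
    cases u' with
    | nil =>
      simp only [List.nil_append, List.cons.injEq] at h
      obtain ⟨rfl, rfl⟩ := h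
      exfalso
      have := hall (q :: a :: p :: a :: q :: alt a q (2*j)) ⟨a, [p,a,q], q :: alt a q (2*j), by simp, by simp⟩
      exact L1 this (by simp; omega) rfl hpq.symm hap
    | cons x u' =>
      simp only [List.cons_append, List.cons.injEq] at h
      obtain ⟨rfl, h⟩ := h
      have hax : a ≠ x := fun e => hau' (by simp [e])
      have haq : a = q := by omega
      subst haq
      cases u' with
      | cons y u' =>
        exfalso
        simp only [List.cons_append, List.cons.injEq] at h
        exact hau' (by simp [h.1])
      | nil =>
        simp only [List.nil_append, List.cons.injEq, true_and] at h
        subst h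
        have := hall (x :: a :: p :: x :: a :: alt x a (2*j))
          ⟨a, [x,p,a,x], alt x a (2*j), by simp, by simp⟩
        obtain ⟨j', h⟩ := L2 this (by simp; omega) rfl hpr.symm
        cases j with
        | zero => exact Or.inr ⟨p, a, x, hd, by simp [ivList, alt]⟩
        | succ j =>
          exfalso
          cases j' with
          | zero => simp [alt, Nat.mul_succ] at h
          | succ j' => simp [alt, Nat.mul_succ] at h; omega
  · -- type III
    obtain ⟨u', hu'⟩ : ∃ u', u.reverse = p :: u' := by
      cases hr : u.reverse with
      | nil => simp at hr; exact absurd hr hu0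
      | cons x t =>
        rw [hr] at h
        simp only [List.cons_append, List.cons.injEq] at h
        exact ⟨t, by rw [h.1]⟩
    have hu : u = u'.reverse ++ [p] := by
      have := congrArg List.reverse hu'
      simpa using this
    subst hu
    simp only [List.mem_append, List.mem_reverse, List.mem_singleton, not_or] at hau
    obtain ⟨hau', hap⟩ := hau
    rw [hu'] at h
    simp only [List.cons_append, List.cons.injEq, true_and] at h
    simp only [alt, List.cons_append] at h
    cases u' with
    | nil =>
      simp only [List.nil_append, List.cons.injEq] at h
      obtain ⟨rfl, rfl⟩ := h
      exfalso
      cases i with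
      | zero =>
        have := hall (p :: r :: a :: p :: a :: alt r a (2*j))
          ⟨a, [p,a,r,p], alt r a (2*j), by simp [alt], by simp⟩
        obtain ⟨j', h⟩ := L2 this (by simp; omega) rfl hpq
        simp at h; omega
      | succ i =>
        have := hall (r :: a :: p :: a :: r :: (alt a r (2*i) ++ p :: a :: alt r a (2*j)))
          ⟨a, [p,a,r], r :: (alt a r (2*i) ++ p :: a :: alt r a (2*j)),
            by simp [alt, Nat.mul_succ], by simp⟩
        exact L1 this (by simp; omega) rfl hpr.symm hap
    | cons x u' =>
      simp only [List.cons_append, List.cons.injEq] at h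
      obtain ⟨rfl, h⟩ := h
      have hax : a ≠ x := fun e => hau' (by simp [e])
      have har : a = r := by omega
      subst har
      cases u' with
      | cons y u' =>
        exfalso
        simp only [List.cons_append, List.cons.injEq] at h
        exact hau' (by simp [h.1])
      | nil =>
        simp only [List.nil_append, List.cons.injEq, true_and] at h
        subst h
        cases i with
        | succ i =>
          exfalso
          have := hall (x :: a :: p :: x :: a :: (alt x a (2*i) ++ p :: x :: alt a x (2*j)))
            ⟨a, [x,p,a,x], alt x a (2*i) ++ p :: x :: alt a x (2*j),
              by simp [alt, Nat.mul_succ], by simp⟩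
          obtain ⟨j', h⟩ := L2 this (by simp; omega) rfl hpq.symm
          cases i with
          | zero =>
            cases j' with
            | zero => simp [alt] at h
            | succ j' => simp [alt, Nat.mul_succ] at h; omega
          | succ i =>
            cases j' with
            | zero => simp [alt, Nat.mul_succ] at h
            | succ j' => simp [alt, Nat.mul_succ] at h; omega
        | zero =>
          cases j with
          | zero =>
            exact Or.inr ⟨a, x, p, ⟨hr3, hq3, hp3, hqr.symm, hpr.symm, hpq.symm⟩,
              by simp [ivList, alt]⟩
          | succ j =>
            exfalso
            have := hall (x :: p :: a :: p :: x :: a :: x :: alt a x (2*j))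
              ⟨a, [x,p,a,p,x], x :: alt a x (2*j), by simp [alt, Nat.mul_succ], by simp⟩
            exact L1 this (by simp; omega) rfl hqr hpr

end FlipTernary

namespace FlipTernary

def consN (x : ℕ) (l : List ℕ) : List ℕ := if l.head? = some x then l else x :: l

/-- Collapse runs of equal symbols. -/
def nrm (l : List ℕ) : List ℕ := l.foldr consN []

theorem nrm_cons (x : ℕ) (l : List ℕ) : nrm (x :: l) = consN x (nrm l) := rfl

theorem consN_head (x : ℕ) (l : List ℕ) : (consN x l).head? = some x := by
  unfold consN
  split_ifs with h
  · exact h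
  · rfl

theorem consN_idem (x : ℕ) (l : List ℕ) : consN x (consN x l) = consN x l := by
  conv_lhs => unfold consN
  rw [if_pos]
  · rfl
  · exact consN_head x l

theorem chain_consN {x : ℕ} {l : List ℕ} (h : l.IsChain (· ≠ ·)) :
    (consN x l).IsChain (· ≠ ·) := by
  unfold consN
  split_ifs with h1
  · exact h
  · cases l with
    | nil => simp
    | cons y l =>
      rw [List.isChain_cons_cons]
      refine ⟨?_, h⟩
      rintro rfl
      simp at h1

theorem nrm_chain (l : List ℕ) : (nrm l).IsChain (· ≠ ·) := by
  induction l with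
  | nil => simp [nrm]
  | cons x l ih => exact chain_consN ih

theorem mem_consN {x y : ℕ} {l : List ℕ} : y ∈ consN x l ↔ y = x ∨ y ∈ l := by
  unfold consN
  split_ifs with h
  · constructor
    · exact Or.inr
    · rintro (rfl | h1)
      · exact List.mem_of_mem_head? h
      · exact h1
  · simp

theorem mem_nrm {y : ℕ} {l : List ℕ} : y ∈ nrm l ↔ y ∈ l := by
  induction l with
  | nil => simp [nrm]
  | cons x l ih => rw [nrm_cons, mem_consN, ih, List.mem_cons]

theorem foldr_nrm (m x : List ℕ) : x.foldr consN m = (nrm x).foldr consN m := by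
  induction x with
  | nil => simp [nrm]
  | cons x l ih =>
    rw [List.foldr_cons, ih, nrm_cons]
    by_cases h : (nrm l).head? = some x
    · have e : consN x (nrm l) = nrm l := by unfold consN; rw [if_pos h]
      rw [e]
      cases hl : nrm l with
      | nil => simp [hl] at h
      | cons y l' =>
        rw [hl] at h
        simp at h
        subst h
        rw [List.foldr_cons, consN_idem]
    · have e : consN x (nrm l) = x :: nrm l := by unfold consN; rw [if_neg h]
      rw [e, List.foldr_cons]

theorem J2 (l m : List ℕ) (h : (l ++ m).IsChain (· ≠ ·)) : l.foldr consN m = l ++ m := by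
  induction l with
  | nil => rfl
  | cons x l ih =>
    have h1 : (l ++ m).IsChain (· ≠ ·) := List.IsChain.tail h
    rw [List.foldr_cons, ih h1]
    unfold consN
    rw [if_neg, List.cons_append]
    intro h2
    cases hl : l ++ m with
    | nil => simp [hl] at h2
    | cons y t =>
      rw [List.cons_append, hl, List.isChain_cons_cons] at h
      rw [hl] at h2
      simp at h2
      exact h.1 h2.symm

theorem J1 (l m : List ℕ) (a : ℕ) (h : (l ++ [a]).IsChain (· ≠ ·))
    (h2 : (a :: m).IsChain (· ≠ ·)) : (l ++ [a]).foldr consN (a :: m) = l ++ a :: m := by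
  rw [List.foldr_append]
  have : List.foldr consN (a :: m) [a] = a :: m := by simp [consN]
  rw [this, J2]
  exact List.isChain_split.2 ⟨h, h2⟩

theorem nrm_self (l : List ℕ) (h : l.IsChain (· ≠ ·)) : nrm l = l := by
  have := J2 l [] (by simpa using h)
  simpa [nrm] using this

theorem nrm_append (x y : List ℕ) : nrm (x ++ y) = (nrm x).foldr consN (nrm y) := by
  rw [← foldr_nrm]
  simp [nrm, List.foldr_append]

theorem join_cases (l m : List ℕ) (hl : l.IsChain (· ≠ ·)) (hm : m.IsChain (· ≠ ·)) :
    l.foldr consN m = l ++ m ∨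
    ∃ l' a m', l = l' ++ [a] ∧ m = a :: m' ∧ l.foldr consN m = l' ++ a :: m' := by
  rcases List.eq_nil_or_concat l with rfl | ⟨l', a, rfl⟩
  · left; rfl
  · rw [List.concat_eq_append] at hl ⊢
    cases m with
    | nil => left; exact J2 _ _ (by simpa using hl)
    | cons b m =>
      by_cases hab : a = b
      · subst hab
        right
        exact ⟨l', a, m, rfl, rfl, J1 l' m a hl hm⟩
      · left
        apply J2
        rw [List.append_assoc, List.singleton_append, List.isChain_split]
        refine ⟨hl, ?_⟩
        show List.IsChain _ (a :: b :: m)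
        rw [List.isChain_cons_cons]
        exact ⟨hab, hm⟩

theorem nrm_reverse (l : List ℕ) : nrm l.reverse = (nrm l).reverse := by
  induction l with
  | nil => rfl
  | cons x l ih =>
    have e : nrm [x] = [x] := by simp [nrm, consN]
    rw [List.reverse_cons, nrm_append, ih, e, nrm_cons]
    have hc : (nrm l).reverse.IsChain (· ≠ ·) := by
      rw [← ih]; exact nrm_chain _
    unfold consN
    split_ifs with h
    · cases hl : nrm l with
      | nil => simp [hl] at h
      | cons y l' =>
        rw [hl] at h hc
        simp at h
        subst h
        rw [List.reverse_cons] at hc ⊢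
        exact J1 _ _ _ hc (by simp)
    · rw [List.reverse_cons]
      apply J2
      cases hl : nrm l with
      | nil => simp
      | cons y l' =>
        rw [hl] at h hc
        rw [List.reverse_cons] at hc ⊢
        rw [List.append_assoc, List.singleton_append, List.isChain_split]
        refine ⟨hc, ?_⟩
        simp at h ⊢
        exact h

theorem flip_nrm {s u : List ℕ} (h : FlipStep s u) :
    (nrm s).length ≤ (nrm u).length + 1 ∧
    ((nrm s).length = (nrm u).length + 1 → Child (nrm s) (nrm u)) := by
  obtain ⟨i, -, -, rfl⟩ := h
  unfold pflip
  have hs : s = s.take i ++ s.drop i := (List.take_append_drop i s).symm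
  generalize s.take i = x at hs ⊢
  generalize s.drop i = y at hs ⊢
  subst hs
  have hrc : (nrm x).reverse.IsChain (· ≠ ·) := by
    rw [← nrm_reverse]; exact nrm_chain _
  rw [nrm_append, nrm_append, nrm_reverse]
  have hyc := nrm_chain y
  have hxc := nrm_chain x
  generalize nrm x = X at *
  generalize nrm y = Y at *
  rcases join_cases X Y hxc hyc with h1 | ⟨l1, a1, m1, e1, f1, h1⟩
  · rcases join_cases _ Y hrc hyc with h2 | ⟨l2, a2, m2, e2, f2, h2⟩
    · rw [h1, h2]; simp
    · rw [h1, h2]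
      have e : X = a2 :: l2.reverse := by
        have := congrArg List.reverse e2
        simpa using this
      subst e
      subst f2
      refine ⟨by simp, fun _ => ⟨a2, l2.reverse, m2, by simp, by simp⟩⟩
  · have g1 := congrArg List.length e1
    have g2 := congrArg List.length f1
    simp at g1 g2
    rcases join_cases _ Y hrc hyc with h2 | ⟨l2, a2, m2, e2, f2, h2⟩
    · rw [h1, h2]; simp; omega
    · rw [h1, h2]
      have g3 := congrArg List.length e2
      have g4 := congrArg List.length f2
      simp at g3 g4
      simp; omega

theorem nrm_split (s : List ℕ) : ∀ l m, nrm s = l ++ m → ∃ x y, s = x ++ y ∧ nrm x = l ∧ nrm y = m := by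
  induction s with
  | nil =>
    intro l m h
    simp [nrm] at h
    exact ⟨[], [], rfl, by simp [nrm, h.1], by simp [nrm, h.2]⟩
  | cons a s ih =>
    intro l m h
    cases l with
    | nil => exact ⟨[], a :: s, rfl, rfl, h⟩
    | cons b l =>
      rw [nrm_cons] at h
      unfold consN at h
      split_ifs at h with h1
      · obtain ⟨x, y, rfl, hx, hy⟩ := ih _ _ h
        refine ⟨a :: x, y, rfl, ?_, hy⟩
        rw [nrm_cons, hx]
        rw [h] at h1
        simp at h1
        subst h1
        simp [consN]
      · simp only [List.cons_append, List.cons.injEq] at h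
        obtain ⟨rfl, h⟩ := h
        obtain ⟨x, y, rfl, hx, hy⟩ := ih _ _ h
        refine ⟨a :: x, y, rfl, ?_, hy⟩
        rw [nrm_cons, hx]
        unfold consN
        rw [if_neg]
        intro h2
        apply h1
        rw [h]
        cases l with
        | nil => simp at h2
        | cons c l => simpa using h2

theorem child_lift {s t : List ℕ} (h : Child (nrm s) t) : ∃ u, FlipStep s u ∧ nrm u = t := by
  obtain ⟨a, w, v, h, rfl⟩ := h
  obtain ⟨x, y, rfl, hx, hy⟩ := nrm_split s (a :: w) (a :: v) h
  have hx0 : x ≠ [] := by rintro rfl; simp [nrm] at hx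
  refine ⟨x.reverse ++ y, ⟨x.length, List.length_pos_iff.2 hx0, by simp, by simp [pflip]⟩, ?_⟩
  rw [nrm_append, nrm_reverse, hx, hy, List.reverse_cons]
  apply J1
  · rw [← List.reverse_cons, ← hx, ← nrm_reverse]; exact nrm_chain _
  · rw [← hy]; exact nrm_chain _

theorem grouped_cons (x : ℕ) (l : List ℕ) :
    Grouped (x :: l) ↔ Grouped l ∧ (x ∈ l → l.head? = some x) := by
  constructor
  · intro h
    refine ⟨?_, ?_⟩
    · intro i j k hij hjk he
      exact h i.succ j.succ k.succ (by simpa using hij) (by simpa using hjk) he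
    · intro hx
      obtain ⟨k, hk⟩ := List.get_of_mem hx
      cases l with
      | nil => simp at hx
      | cons y l =>
        by_cases hk0 : k.val = 0
        · have : k = ⟨0, by simp⟩ := Fin.ext hk0
          rw [this] at hk
          simpa using hk
        · have := h ⟨0, by simp⟩ ⟨1, by simp⟩ k.succ (Fin.mk_lt_mk.2 Nat.zero_lt_one)
            (Fin.lt_def.2 (show 1 < k.val + 1 by omega)) (by simpa using hk.symm)
          simpa using this
  · rintro ⟨h, hx⟩ i j k hij hjk he
    obtain ⟨j, hj⟩ := j
    obtain ⟨k, hk⟩ := k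
    obtain ⟨i, hi⟩ := i
    simp only [Fin.lt_def] at hij hjk
    obtain ⟨j, rfl⟩ : ∃ j', j = j' + 1 := ⟨j - 1, by omega⟩
    obtain ⟨k, rfl⟩ : ∃ k', k = k' + 1 := ⟨k - 1, by omega⟩
    simp only [List.length_cons] at hi hj hk
    cases i with
    | succ i =>
      exact h ⟨i, by omega⟩ ⟨j, by omega⟩ ⟨k, by omega⟩ (Fin.mk_lt_mk.2 (by omega))
        (Fin.mk_lt_mk.2 (by omega)) he
    | zero =>
      have hkx : x = l.get ⟨k, by omega⟩ := he
      have hxl : x ∈ l := by rw [hkx]; exact List.get_mem _ _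
      have h0 := hx hxl
      show l.get ⟨j, by omega⟩ = x
      have hl0 : l.get ⟨0, by omega⟩ = x := by
        cases l with
        | nil => simp at hxl
        | cons y l => simpa using h0
      by_cases hj0 : j = 0
      · subst hj0; exact hl0
      · rw [← hl0]
        exact h ⟨0, by omega⟩ ⟨j, by omega⟩ ⟨k, by omega⟩ (Fin.mk_lt_mk.2 (by omega))
          (Fin.mk_lt_mk.2 (by omega)) (by rw [hl0, hkx])

theorem head_nrm (l : List ℕ) : (nrm l).head? = l.head? := by
  cases l with
  | nil => rfl
  | cons x l => rw [nrm_cons, consN_head]; rfl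

theorem grouped_iff (l : List ℕ) : Grouped l ↔ (nrm l).Nodup := by
  induction l with
  | nil =>
    simp only [nrm, List.foldr_nil, List.nodup_nil, iff_true]
    intro i
    exact absurd i.2 (by simp)
  | cons x l ih =>
    rw [grouped_cons, ih, nrm_cons]
    unfold consN
    rw [head_nrm]
    split_ifs with h
    · simp [h]
    · rw [List.nodup_cons, mem_nrm]
      simp only [h, imp_false]
      tauto

theorem full_nrm {s : List ℕ} (h : Full s) : Full (nrm s) := fun a => by rw [mem_nrm]; exact h a

theorem full_flip {s u : List ℕ} (h : Full s) (hs : FlipStep s u) : Full u := by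
  obtain ⟨i, -, -, rfl⟩ := hs
  intro a
  rw [← h a]
  conv_rhs => rw [← List.take_append_drop i s]
  simp only [pflip, List.mem_append, List.mem_reverse]

theorem full_perm {s : List ℕ} (h : Full s) : [0,1,2] ⊆ s := by
  intro x hx
  rw [h x]
  simp at hx
  omega

theorem full_len {s : List ℕ} (h : Full s) : 3 ≤ s.length := by
  have : [0,1,2].Nodup := by decide
  simpa using (List.subperm_of_subset this (full_perm h)).length_le

theorem nodup_len {s : List ℕ} (h : Full s) (hn : s.Nodup) : s.length ≤ 3 := by
  have : s ⊆ [0,1,2] := by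
    intro x hx
    have := (h x).1 hx
    simp; omega
  simpa using (List.subperm_of_subset hn this).length_le

theorem len_nodup {s : List ℕ} (h : Full s) (hl : s.length = 3) : s.Nodup := by
  have h1 : [0,1,2].Nodup := by decide
  have h2 := List.subperm_of_subset h1 (full_perm h)
  have h3 : [0,1,2].Perm s := h2.perm_of_length_le (by simp [hl])
  exact h3.nodup_iff.1 h1

theorem B_len {s : List ℕ} (hf : Full s) (h : B s) : 4 ≤ s.length := by
  have hl := full_len hf
  rcases h with ⟨p, q, r, hd, h | ⟨j, h⟩ | ⟨i, j, h⟩⟩ | ⟨p, q, r, hd, h⟩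
  · by_contra hc
    have h3 : s.length = 3 := by omega
    have hn := len_nodup hf h3
    match s, h3 with
    | [x, y, z], _ =>
      simp [AltN] at h
      simp [h.1, h.2.2] at hn
  · rw [h]; simp
  · rw [h]; simp
    omega
  · simp [ivList] at h
    rcases h with h | h | h | h | h | h | h | h <;> simp [h]

theorem reach_lower (m : ℕ) : ∀ s t, Full s → Grouped t → ReachIn m s t →
    (nrm s).length ≤ m + 3 ∧ ((nrm s).length = m + 3 → ¬ B (nrm s)) := by
  induction m with
  | zero =>
    rintro s t hf hg rfl
    have := nodup_len (full_nrm hf) ((grouped_iff s).1 hg)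
    refine ⟨by omega, fun _ hB => ?_⟩
    have := B_len (full_nrm hf) hB
    omega
  | succ m ih =>
    rintro s t hf hg ⟨u, hu, hr⟩
    obtain ⟨h1, h2⟩ := ih u t (full_flip hf hu) hg hr
    obtain ⟨h3, h4⟩ := flip_nrm hu
    refine ⟨by omega, fun he hB => ?_⟩
    exact h2 (by omega) (fwd hB (h4 (by omega)))

theorem child_len {s t : List ℕ} (h : Child s t) : s.length = t.length + 1 := by
  obtain ⟨a, u, v, rfl, rfl⟩ := h
  simp

theorem reach_good (m : ℕ) : ∀ s, Full s → (nrm s).length = m + 3 → ¬ B (nrm s) →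
    ∃ t, Grouped t ∧ ReachIn m s t := by
  induction m with
  | zero =>
    intro s hf hl _
    exact ⟨s, (grouped_iff s).2 (len_nodup (full_nrm hf) (by omega)), rfl⟩
  | succ m ih =>
    intro s hf hl hB
    by_contra hcon
    apply hB
    apply bwd (full_nrm hf) (nrm_chain s) (by omega)
    intro t hc
    by_contra hBt
    obtain ⟨u, hu, rfl⟩ := child_lift hc
    have := child_len hc
    obtain ⟨t, hg, hr⟩ := ih u (full_flip hf hu) (by omega) hBt
    exact hcon ⟨t, hg, u, hu, hr⟩

theorem B_last {l : List ℕ} {a : ℕ} (hl : 3 ≤ l.length) (h : B (l ++ [a])) : a ∈ l := by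
  have key : ∀ s : List ℕ, ∀ q, 2 ≤ s.count q → s = l ++ [a] → a = q → a ∈ l := by
    rintro s q h1 rfl rfl
    by_contra h2
    rw [List.count_append, List.count_eq_zero.2 h2] at h1
    simp at h1
  have klast : ∀ s : List ℕ, ∀ q, s.getLast? = some q → l ++ [a] = s → a = q := by
    rintro s q h1 rfl
    simpa using h1
  rcases h with ⟨p, q, r, ⟨-, -, -, hpq, hpr, hqr⟩, h | ⟨j, h⟩ | ⟨i, j, h⟩⟩ | ⟨p, q, r, -, h⟩
  · simp only [altN_append, AltN, List.length_append, List.length_cons, List.length_nil] at h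
    have ha : a = q := h.2.1.2 (by omega)
    subst ha
    by_contra hal
    match l, hl with
    | x :: y :: l, _ =>
      simp only [List.mem_cons, not_or] at hal
      simp only [AltN] at h
      have e1 : ¬ _ := fun e => hal.1 (h.1.1.2 e).symm
      have e2 : ¬ _ := fun e => hal.2.1 (h.1.2.1.2 e).symm
      omega
  · have e : ∀ n x y, (alt x y (2*n+2)).getLast? = some y := by
      intro n
      induction n with
      | zero => intro x y; simp [alt]
      | succ n ih =>
        intro x y
        have := ih x y
        rw [show 2 * (n+1) + 2 = 2*n+2+1+1 by ring, alt, alt, List.getLast?_cons_cons, List.getLast?_cons, this]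
        rfl
    refine key _ q ?_ h.symm (klast _ q ?_ h)
    · simp [alt, List.count_cons]
      split_ifs <;> omega
    · rw [show 2*j+4 = 2*(j+1)+2 by ring, List.getLast?_cons, e]; rfl
  · have e : ∀ n x y, (y :: alt x y (2*n)).getLast? = some y := by
      intro n
      induction n with
      | zero => intro x y; simp [alt]
      | succ n ih =>
        intro x y
        rw [show 2 * (n+1) = 2*n+1+1 by ring, alt, alt, List.getLast?_cons_cons, List.getLast?_cons_cons]
        exact ih x y
    refine key _ q ?_ h.symm (klast _ q ?_ h)
    · simp [alt, List.count_cons]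
      split_ifs <;> omega
    · have : p :: (alt q r (2*i+2) ++ p :: q :: alt r q (2*j)) =
        (p :: alt q r (2*i+2) ++ [p]) ++ (q :: alt r q (2*j)) := by simp
      rw [this, List.getLast?_append, e]; rfl
  · simp only [ivList, List.mem_cons, List.not_mem_nil, or_false] at h
    rcases h with h | h | h | h | h | h | h | h <;>
      exact key _ q (by simp [List.count_cons]; try omega) h.symm (klast _ q (by simp) h)

theorem reach_bad (m : ℕ) : ∀ s, Full s → (nrm s).length = m + 3 → B (nrm s) →
    ∃ t, Grouped t ∧ ReachIn (m+1) s t := by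
  induction m with
  | zero =>
    intro s hf hl hB
    have := B_len (full_nrm hf) hB
    omega
  | succ m ih =>
    intro s hf hl hB
    by_cases hc : ∃ t, Child (nrm s) t
    · obtain ⟨t, hc⟩ := hc
      have hBt := fwd hB hc
      obtain ⟨u, hu, rfl⟩ := child_lift hc
      have := child_len hc
      obtain ⟨t, hg, hr⟩ := ih u (full_flip hf hu) (by omega) hBt
      exact ⟨t, hg, u, hu, hr⟩
    · have hs : FlipStep s s.reverse :=
        ⟨s.length, by have := full_len hf; omega, le_refl _, by simp [pflip]⟩
      have hnb : ¬ B (nrm s.reverse) := by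
        intro hB'
        rw [nrm_reverse] at hB'
        cases hn : nrm s with
        | nil => simp [hn] at hl
        | cons a l =>
          rw [hn, List.reverse_cons] at hB'
          rw [hn] at hl
          simp at hl
          have := B_last (by simp; omega) hB'
          rw [List.mem_reverse] at this
          obtain ⟨u, v, rfl, -⟩ := List.eq_append_cons_of_mem this
          exact hc ⟨_, a, u, v, hn, rfl⟩
      obtain ⟨t, hg, hr⟩ := reach_good (m+1) s.reverse (full_flip hf hs)
        (by rw [nrm_reverse]; simpa using hl) hnb
      exact ⟨t, hg, s.reverse, hs, hr⟩

theorem groupDist_eq {s : List ℕ} (hf : Full s) (hn : s.IsChain (· ≠ ·)) :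
    (B s → groupDist s = s.length - 2) ∧ (¬ B s → groupDist s = s.length - 3) := by
  have hl := full_len hf
  have hns := nrm_self s hn
  have hle : ∀ m t, Grouped t → ReachIn m s t → s.length ≤ m + 3 ∧ (s.length = m+3 → ¬ B s) := by
    intro m t hg hr
    have := reach_lower m s t hf hg hr
    rwa [hns] at this
  constructor
  · intro hB
    obtain ⟨t, hg, hr⟩ := reach_bad (s.length - 3) s hf (by rw [hns]; omega) (by rwa [hns])
    rw [show s.length - 3 + 1 = s.length - 2 by omega] at hr
    apply le_antisymm
    · exact Nat.sInf_le ⟨t, hg, hr⟩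
    · refine le_csInf (Set.nonempty_of_mem (x := _) (⟨t, hg, hr⟩ : _ ∈ {m | ∃ t, Grouped t ∧ ReachIn m s t})) ?_
      rintro m ⟨t', hg', hr'⟩
      have := hle m t' hg' hr'
      have : s.length ≠ m + 3 := fun e => this.2 e hB
      omega
  · intro hB
    obtain ⟨t, hg, hr⟩ := reach_good (s.length - 3) s hf (by rw [hns]; omega) (by rwa [hns])
    apply le_antisymm
    · exact Nat.sInf_le ⟨t, hg, hr⟩
    · refine le_csInf (Set.nonempty_of_mem (x := _) (⟨t, hg, hr⟩ : _ ∈ {m | ∃ t, Grouped t ∧ ReachIn m s t})) ?_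
      rintro m ⟨t', hg', hr'⟩
      have := hle m t' hg' hr'
      omega

end FlipTernary

namespace FlipTernary

theorem altN_map {f : ℕ → ℕ} {c d : ℕ} (l : List ℕ) (h : ∀ x ∈ l, (f x = d ↔ x = c)) :
    ∀ k, (AltN d k (l.map f) ↔ AltN c k l) := by
  induction l with
  | nil => intro k; simp [AltN]
  | cons x l ih =>
    intro k
    simp only [List.map_cons, AltN, h x (by simp)]
    rw [ih (fun y hy => h y (by simp [hy]))]

theorem altN_flat1 (xs : List ℕ) (h : ∀ x ∈ xs, x = 0 ∨ x = 1) : ∀ k, k % 2 = 1 →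
    AltN 2 k (xs.map (fun x => [x,2])).flatten := by
  induction xs with
  | nil => intro k _; trivial
  | cons x xs ih =>
    intro k hk
    have h1 := h x (by simp)
    have := ih (fun y hy => h y (by simp [hy])) (k+1+1) (by omega)
    simp only [List.map_cons, List.flatten_cons, List.cons_append, List.nil_append, AltN]
    refine ⟨by omega, by simp; omega, this⟩

theorem altN_flat2 (xs : List ℕ) (h : ∀ x ∈ xs, x = 0 ∨ x = 1) : ∀ k, k % 2 = 0 →
    AltN 2 k ((xs.map (fun x => [2,x])).flatten ++ [2]) := by
  induction xs with
  | nil => intro k hk; simp [AltN, hk]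
  | cons x xs ih =>
    intro k hk
    have h1 := h x (by simp)
    have := ih (fun y hy => h y (by simp [hy])) (k+1+1) (by omega)
    simp only [List.map_cons, List.flatten_cons, List.cons_append, List.nil_append, AltN]
    refine ⟨by simp; omega, by omega, this⟩

theorem flat_len1 (xs : List ℕ) : (xs.map (fun x => [x,2])).flatten.length = 2 * xs.length := by
  induction xs with
  | nil => rfl
  | cons x xs ih => simp at ih ⊢; omega

theorem flat_len2 (xs : List ℕ) : (xs.map (fun x => [2,x])).flatten.length = 2 * xs.length := by
  induction xs with
  | nil => rfl
  | cons x xs ih => simp at ih ⊢; omega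

theorem flat_of_altN (n : ℕ) : ∀ l : List ℕ, (∀ x ∈ l, x < 3) → AltN 2 (l.length + 1) l →
    (l.length = 2*n → ∃ xs : List ℕ, xs.length = n ∧ (∀ x ∈ xs, x = 0 ∨ x = 1) ∧
      l = (xs.map (fun x => [x,2])).flatten) ∧
    (l.length = 2*n+1 → ∃ xs : List ℕ, xs.length = n ∧ (∀ x ∈ xs, x = 0 ∨ x = 1) ∧
      l = (xs.map (fun x => [2,x])).flatten ++ [2]) := by
  induction n with
  | zero =>
    intro l hm h
    constructor
    · intro hl
      exact ⟨[], rfl, by simp, by simpa using hl⟩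
    · intro hl
      match l, hl with
      | [x], _ =>
        simp [AltN] at h
        exact ⟨[], rfl, by simp, by simp [h]⟩
  | succ n ih =>
    intro l hm h
    match l with
    | [] => exact ⟨by simp, by simp⟩
    | [x] => exact ⟨by intro h; simp at h; omega, by simp⟩
    | x :: y :: l =>
      simp only [AltN, List.length_cons] at h
      have ih' := ih l (fun z hz => hm z (by simp [hz])) ((altN_congr 2 l (by omega)).1 h.2.2)
      have hx := hm x (by simp)
      have hy := hm y (by simp)
      constructor
      · intro hl
        simp only [List.length_cons] at hl
        obtain ⟨xs, h1, h2, h3⟩ := ih'.1 (by omega)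
        have hx2 : x ≠ 2 := by intro e; have := h.1.1 e; omega
        have hy2 : y = 2 := h.2.1.2 (by omega)
        refine ⟨x :: xs, by simp [h1], ?_, by simp [hy2]; simpa using h3⟩
        intro z hz
        rcases List.mem_cons.1 hz with rfl | hz
        · omega
        · exact h2 z hz
      · intro hl
        simp only [List.length_cons] at hl
        obtain ⟨xs, h1, h2, h3⟩ := ih'.2 (by omega)
        have hy2 : y ≠ 2 := by intro e; have := h.2.1.1 e; omega
        have hx2 : x = 2 := h.1.2 (by omega)
        refine ⟨y :: xs, by simp [h1], ?_, by simp [hx2]; simpa using h3⟩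
        intro z hz
        rcases List.mem_cons.1 hz with rfl | hz
        · omega
        · exact h2 z hz

theorem B_of_bad {s : List ℕ} (hf : Full s) (h : BadTernary s) : B s := by
  obtain ⟨f, ⟨-, -, hsurj⟩, h⟩ := h
  obtain ⟨p, hp3, hp⟩ := hsurj (show (0:ℕ) ∈ {x | x < 3} by simp)
  obtain ⟨r, hr3, hr⟩ := hsurj (show (1:ℕ) ∈ {x | x < 3} by simp)
  obtain ⟨q, hq3, hq⟩ := hsurj (show (2:ℕ) ∈ {x | x < 3} by simp)
  simp only [Set.mem_ofPred_eq] at hp3 hq3 hr3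
  have hpq : p ≠ q := by rintro rfl; omega
  have hpr : p ≠ r := by rintro rfl; omega
  have hqr : q ≠ r := by rintro rfl; omega
  have hd : Dist3 p q r := ⟨hp3, hq3, hr3, hpq, hpr, hqr⟩
  have hall : ∀ x ∈ s, x = p ∨ x = q ∨ x = r := by
    intro x hx
    have := (hf x).1 hx
    omega
  set g : ℕ → ℕ := fun n => if n = 0 then p else if n = 1 then r else q with hg
  have hs : s = (s.map f).map g := by
    rw [List.map_map]
    conv_lhs => rw [← List.map_id s]
    apply List.map_congr_left
    intro x hx
    rcases hall x hx with rfl | rfl | rfl <;> simp [hg, hp, hq, hr]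
  have hII : AltN 2 (s.length + 1) (s.map f) → B s := by
    intro h
    refine Or.inl ⟨p, q, r, hd, Or.inl ?_⟩
    refine (altN_map s ?_ _).1 h
    intro x hx
    rcases hall x hx with rfl | rfl | rfl <;> simp [hp, hq, hr] <;> omega
  have hlen : (s.map f).length = s.length := by simp
  have g0 : g 0 = p := by simp [hg]
  have g1 : g 1 = r := by simp [hg]
  have g2 : g 2 = q := by simp [hg]
  rcases h with ⟨j, hj, h⟩ | ⟨j, hj, h⟩ | ⟨xs, hx, hxs, h⟩ | ⟨xs, hx, hxs, h⟩ | ⟨i, j, hi, h⟩ | h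
  · refine Or.inl ⟨p, q, r, hd, Or.inr (Or.inl ⟨j - 2, ?_⟩)⟩
    rw [hs, h, rep_alt, List.map_cons, map_alt, g0, g1, g2, show 2 * (j-2) + 4 = 2*j by omega]
  · apply hII
    rw [← hlen, h, rep_alt]
    simp only [AltN, List.length_cons, alt_length]
    exact ⟨by omega, by simp; omega, (altN_alt_even 2 1 (by omega) _ _).2 (by omega)⟩
  · apply hII
    rw [← hlen, h]
    exact altN_flat1 xs hxs _ (by rw [flat_len1]; omega)
  · apply hII
    rw [← hlen, h]
    exact altN_flat2 xs hxs _ (by rw [List.length_append, flat_len2]; simp; omega)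
  · refine Or.inl ⟨p, q, r, hd, Or.inr (Or.inr ⟨i - 1, j, ?_⟩)⟩
    rw [hs, h, rep_alt, rep_alt, show 2 * (i-1) + 2 = 2*i by omega]
    simp only [List.map_cons, List.map_append, map_alt, g0, g1, g2]
  · refine Or.inr ⟨p, q, r, hd, ?_⟩
    rw [hs]
    rcases h with h | h | h | h | h | h | h | h <;> rw [h] <;> simp [g0, g1, g2, ivList]

theorem bad_of_B {s : List ℕ} (hf : Full s) (h : B s) : BadTernary s := by
  have hl4 := B_len hf h
  have key : ∃ p q r, Dist3 p q r ∧
      (AltN q (s.length+1) s ∨ T1 p q r s ∨ T3 p q r s ∨ s ∈ ivList p q r) := by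
    rcases h with ⟨p, q, r, h, h2⟩ | ⟨p, q, r, h, h2⟩
    · exact ⟨p, q, r, h, by tauto⟩
    · exact ⟨p, q, r, h, by tauto⟩
  clear h
  obtain ⟨p, q, r, ⟨hp3, hq3, hr3, hpq, hpr, hqr⟩, h⟩ := key
  set f : ℕ → ℕ := fun n => if n = p then 0 else if n = r then 1 else 2 with hfd
  have f0 : f p = 0 := by simp [hfd]
  have f1 : f r = 1 := by simp [hfd, hpr.symm]
  have f2 : f q = 2 := by simp [hfd, hpq.symm, hqr]
  have hall : ∀ x, x < 3 → x = p ∨ x = q ∨ x = r := by intro x hx; omega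
  refine ⟨f, ⟨?_, ?_, ?_⟩, ?_⟩
  · intro x hx
    rcases hall x hx with rfl | rfl | rfl <;> simp [f0, f1, f2]
  · intro x hx y hy hxy
    rcases hall x hx with rfl | rfl | rfl <;> rcases hall y hy with rfl | rfl | rfl <;>
      first | rfl | (exfalso; simp only [f0, f1, f2] at hxy; omega)
  · intro y hy
    simp only [Set.mem_ofPred_eq] at hy
    have : y = 0 ∨ y = 1 ∨ y = 2 := by omega
    rcases this with rfl | rfl | rfl
    · exact ⟨p, hp3, f0⟩
    · exact ⟨r, hr3, f1⟩
    · exact ⟨q, hq3, f2⟩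
  · have hm : ∀ x ∈ s.map f, x < 3 := by
      intro x hx
      obtain ⟨y, hy, rfl⟩ := List.mem_map.1 hx
      rcases hall y ((hf y).1 hy) with rfl | rfl | rfl <;> simp [f0, f1, f2]
    rcases h with h | ⟨j, h⟩ | ⟨i, j, h⟩ | h
    · have h2 : AltN 2 ((s.map f).length + 1) (s.map f) := by
        rw [List.length_map]
        refine (altN_map s ?_ _).2 h
        intro x hx
        rcases hall x ((hf x).1 hx) with rfl | rfl | rfl <;> simp [f0, f1, f2] <;> omega
      have h3 := flat_of_altN (s.length/2) (s.map f) hm h2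
      rcases Nat.mod_two_eq_zero_or_one s.length with hp | hp
      · obtain ⟨xs, e1, e2, e3⟩ := h3.1 (by simp; omega)
        exact Or.inr (Or.inr (Or.inl ⟨xs, by rintro rfl; simp at e1; omega, e2, e3⟩))
      · obtain ⟨xs, e1, e2, e3⟩ := h3.2 (by simp; omega)
        exact Or.inr (Or.inr (Or.inr (Or.inl ⟨xs, by rintro rfl; simp at e1; omega, e2, e3⟩)))
    · left
      refine ⟨j+2, by omega, ?_⟩
      rw [h, rep_alt, List.map_cons, map_alt, f0, f1, f2, show 2 * (j+2) = 2*j+4 by ring]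
    · refine Or.inr (Or.inr (Or.inr (Or.inr (Or.inl ⟨i+1, j, by omega, ?_⟩))))
      rw [h, rep_alt, rep_alt, show 2 * (i+1) = 2*i+2 by ring]
      simp only [List.map_cons, List.map_append, map_alt, f0, f1, f2]
    · refine Or.inr (Or.inr (Or.inr (Or.inr (Or.inr ?_))))
      simp only [ivList, List.mem_cons, List.not_mem_nil, or_false] at h
      rcases h with h | h | h | h | h | h | h | h <;> rw [h] <;> simp [f0, f1, f2]

end FlipTernary

theorem grouping_ternary_characterisation (n : ℕ) (s : List ℕ)
    (hlen : s.length = n) (hfull : FullyKary 3 s) (hnorm : Normalized s) :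
    (groupDist s = n - 2 ↔ BadTernary s) ∧
    (¬ BadTernary s → groupDist s = n - 3) := by
  have hB : BadTernary s ↔ FlipTernary.B s :=
    ⟨FlipTernary.B_of_bad hfull, FlipTernary.bad_of_B hfull⟩
  have hl := FlipTernary.full_len hfull
  obtain ⟨h1, h2⟩ := FlipTernary.groupDist_eq hfull hnorm
  subst hlen
  rw [hB]
  refine ⟨⟨fun h => ?_, h1⟩, h2⟩
  by_contra hn
  have := h2 hn
  omega
end

section
/- For all n > 3, the prefix reversal diameter δ(n,3) of fully ternary strings of length n satisfies n − 1 ≤ δ(n,3) and 3·δ(n,3) ≤ 4n; that is, d(s,t) ≤ (4/3)n for all compatible fully ternary strings s, t of length n, and there exist compatible fully ternary strings s, t of length n with d(s,t) ≥ n − 1. -/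
theorem pflip_append_left (A B : List ℕ) : pflip A.length (A ++ B) = A.reverse ++ B := by
  simp [pflip]

theorem flipStep_split {s t : List ℕ} (h : FlipStep s t) :
    ∃ A B, A ≠ [] ∧ s = A ++ B ∧ t = A.reverse ++ B := by
  obtain ⟨i, h1, h2, rfl⟩ := h
  refine ⟨s.take i, s.drop i, ?_, by simp, rfl⟩
  intro h
  have := congrArg List.length h
  simp at this
  rcases this with h | h
  · omega
  · subst h
    simp at h2
    omega

theorem flipStep_mk (A B : List ℕ) (hA : A ≠ []) : FlipStep (A ++ B) (A.reverse ++ B) := by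
  refine ⟨A.length, ?_, by simp, (pflip_append_left A B).symm⟩
  exact List.length_pos_iff.mpr hA

theorem flipStep_symm {s t : List ℕ} (h : FlipStep s t) : FlipStep t s := by
  obtain ⟨A, B, hA, rfl, rfl⟩ := flipStep_split h
  have := flipStep_mk A.reverse B (by simpa using hA)
  simpa using this

theorem flipStep_append {s t : List ℕ} (x : List ℕ) (h : FlipStep s t) :
    FlipStep (s ++ x) (t ++ x) := by
  obtain ⟨A, B, hA, rfl, rfl⟩ := flipStep_split h
  have := flipStep_mk A (B ++ x) hA
  simpa using this

theorem reachIn_trans : ∀ (m : ℕ) {k : ℕ} {s t u : List ℕ}, ReachIn m s t → ReachIn k t u →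
    ReachIn (m + k) s u
  | 0, k, s, t, u, h, h' => by
    have h : s = t := h
    subst h
    simpa using h'
  | m + 1, k, s, t, u, h, h' => by
    obtain ⟨v, hv, h⟩ := h
    have := reachIn_trans m h h'
    rw [show m + 1 + k = (m + k) + 1 by omega]
    exact ⟨v, hv, this⟩

theorem reachIn_one {s t : List ℕ} (h : FlipStep s t) : ReachIn 1 s t := ⟨t, h, rfl⟩

theorem reachIn_symm : ∀ (m : ℕ) {s t : List ℕ}, ReachIn m s t → ReachIn m t s
  | 0, s, t, h => Eq.symm h
  | m + 1, s, t, h => by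
    obtain ⟨v, hv, h⟩ := h
    exact reachIn_trans m (reachIn_symm m h) (reachIn_one (flipStep_symm hv))

theorem reachIn_append : ∀ (m : ℕ) {s t : List ℕ} (x : List ℕ), ReachIn m s t →
    ReachIn m (s ++ x) (t ++ x)
  | 0, s, t, x, h => by
    have h : s = t := h
    subst h
    rfl
  | m + 1, s, t, x, h => by
    obtain ⟨v, hv, h⟩ := h
    exact ⟨v ++ x, flipStep_append x hv, reachIn_append m x h⟩

/-- Two flips bring a letter to the end of the string. -/
theorem bring_to_end (A B : List ℕ) (y : ℕ) :
    ReachIn 2 (A ++ y :: B) ((B.reverse ++ A) ++ [y]) := by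
  refine ⟨y :: A.reverse ++ B, ?_, ?_⟩
  · have := flipStep_mk (A ++ [y]) B (by simp)
    simpa using this
  · apply reachIn_one
    have := flipStep_mk (y :: A.reverse ++ B) [] (by simp)
    simpa using this

theorem reach_bound (a : ℕ) : ∀ (n : ℕ) (s t : List ℕ), s.length = n → s.Perm t →
    ∃ m, ReachIn m s t ∧ m + 2 * s.count a ≤ 2 * n := by
  -- one letter different from `a` that is last in the target costs two flips
  have key : ∀ n : ℕ, (∀ (s t : List ℕ), s.length = n → s.Perm t →
      ∃ m, ReachIn m s t ∧ m + 2 * s.count a ≤ 2 * n) →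
      ∀ (s t : List ℕ) (y : ℕ), y ≠ a → s.length = n + 1 → s.Perm (t ++ [y]) →
      ∃ m, ReachIn m s (t ++ [y]) ∧ m + 2 * s.count a ≤ 2 * (n + 1) := by
    intro n ih s t y hy hs hp
    have hmem : y ∈ s := hp.mem_iff.mpr (by simp)
    obtain ⟨A, B, rfl⟩ := List.append_of_mem hmem
    have hp2 : (B.reverse ++ A).Perm t := by
      rw [List.perm_iff_count] at hp ⊢
      intro z
      have := hp z
      simp only [List.count_append, List.count_cons, List.count_reverse, List.count_nil] at this ⊢
      omega
    obtain ⟨m, hm, hb⟩ := ih (B.reverse ++ A) t (by simp at hs ⊢; omega) hp2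
    refine ⟨2 + m, reachIn_trans 2 (bring_to_end A B y) (reachIn_append m [y] hm), ?_⟩
    have : (y == a) = false := by simpa using hy
    simp only [List.count_append, List.count_cons, List.count_reverse, this] at hb ⊢
    simp
    omega
  intro n
  induction n with
  | zero =>
    intro s t hs hp
    have : s = [] := List.length_eq_zero_iff.mp hs
    subst this
    have : t = [] := by simpa using hp
    subst this
    exact ⟨0, rfl, by simp⟩
  | succ n ih =>
    intro s t hs hp
    have ht : t.length = n + 1 := by rw [← hp.length_eq, hs]
    rcases List.eq_nil_or_concat s with rfl | ⟨s', x, rfl⟩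
    · simp at hs
    rcases List.eq_nil_or_concat t with rfl | ⟨t', y, rfl⟩
    · simp at ht
    simp only [List.concat_eq_append] at *
    by_cases hxy : x = y
    · subst hxy
      have hp2 : s'.Perm t' := (List.perm_append_right_iff [x]).mp hp
      obtain ⟨m, hm, hb⟩ := ih s' t' (by simpa using hs) hp2
      refine ⟨m, reachIn_append m [x] hm, ?_⟩
      have : List.count a [x] ≤ 1 := by simpa using List.count_le_length (a := a) (l := [x])
      rw [List.count_append]
      omega
    · by_cases hy : y = a
      · have hx : x ≠ a := fun h => hxy (h.trans hy.symm)
        obtain ⟨m, hm, hb⟩ := key n ih (t' ++ [y]) s' x hx ht hp.symm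
        refine ⟨m, reachIn_symm m hm, ?_⟩
        rw [hp.count_eq a]
        exact hb
      · exact key n ih (s' ++ [x]) t' y hy hs hp

theorem count_ternary : ∀ (s : List ℕ), (∀ x ∈ s, x < 3) →
    s.count 0 + s.count 1 + s.count 2 = s.length
  | [], _ => by simp
  | x :: s, h => by
    have ih := count_ternary s (fun y hy => h y (List.mem_cons_of_mem _ hy))
    have hx := h x (by simp)
    interval_cases x <;> simp <;> omega

/-! Lower bound -/

/-- Good adjacencies. -/
def good : ℕ → ℕ → ℕ
  | 0, 0 => 1
  | 1, 1 => 1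
  | 1, 2 => 1
  | 2, 1 => 1
  | 1, 3 => 1
  | 3, 1 => 1
  | _, _ => 0

theorem good_symm (x y : ℕ) : good x y = good y x := by
  unfold good
  split <;> (try rfl)
  split <;> simp_all

theorem good_le (x y : ℕ) : good x y ≤ 1 := by
  unfold good
  split <;> simp

/-- Number of good adjacencies. -/
def cnt : List ℕ → ℕ
  | [] => 0
  | [_] => 0
  | x :: y :: l => good x y + cnt (y :: l)

theorem cnt_append : ∀ (A B : List ℕ), cnt A + cnt B ≤ cnt (A ++ B) ∧
    cnt (A ++ B) ≤ cnt A + cnt B + 1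
  | [], B => by simp [cnt]
  | [x], [] => by simp [cnt]
  | [x], y :: B => by
    have := good_le x y
    simp [cnt]
    omega
  | x :: y :: A, B => by
    have := cnt_append (y :: A) B
    simp only [List.cons_append, cnt] at this ⊢
    omega

theorem cnt_snoc : ∀ (A : List ℕ) (x y : ℕ), cnt (A ++ [x, y]) = cnt (A ++ [x]) + good x y
  | [], x, y => by simp [cnt]
  | [z], x, y => by simp [cnt]
  | z :: w :: A, x, y => by
    have := cnt_snoc (w :: A) x y
    simp only [List.cons_append, cnt] at this ⊢
    omega

theorem cnt_reverse : ∀ (A : List ℕ), cnt A.reverse = cnt A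
  | [] => rfl
  | [x] => rfl
  | x :: y :: A => by
    have ih := cnt_reverse (y :: A)
    have h := cnt_snoc A.reverse y x
    have e : (x :: y :: A).reverse = A.reverse ++ [y, x] := by simp
    have e2 : (y :: A).reverse = A.reverse ++ [y] := by simp
    rw [e, h, ← e2, ih, good_symm]
    simp only [cnt]
    omega

theorem cnt_step {s t : List ℕ} (h : FlipStep s t) : cnt (t ++ [3]) ≤ cnt (s ++ [3]) + 1 := by
  obtain ⟨A, B, hA, rfl, rfl⟩ := flipStep_split h
  have h1 := cnt_append A (B ++ [3])
  have h2 := cnt_append A.reverse (B ++ [3])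
  rw [cnt_reverse] at h2
  simp only [List.append_assoc]
  omega

theorem cnt_reach : ∀ (m : ℕ) {s t : List ℕ}, ReachIn m s t → cnt (t ++ [3]) ≤ cnt (s ++ [3]) + m
  | 0, s, t, h => by
    have h : s = t := h
    subst h
    simp
  | m + 1, s, t, h => by
    obtain ⟨v, hv, h⟩ := h
    have h1 := cnt_step hv
    have h2 := cnt_reach m h
    omega

/-- Alternating string of length `m` over `{0, 1}` ending in `0`. -/
def alt : ℕ → List ℕ
  | 0 => []
  | m + 1 => (m % 2) :: alt m

theorem alt_length : ∀ m, (alt m).length = m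
  | 0 => rfl
  | m + 1 => by simp [alt, alt_length m]

theorem alt_lt : ∀ m, ∀ x ∈ alt m, x < 2
  | 0 => by simp [alt]
  | m + 1 => by
    intro x hx
    simp only [alt, List.mem_cons] at hx
    rcases hx with rfl | hx
    · omega
    · exact alt_lt m x hx

theorem alt_cnt : ∀ m, cnt (alt (m + 1) ++ [2, 0, 3]) = 0
  | 0 => by simp [alt, cnt, good]
  | m + 1 => by
    have ih := alt_cnt m
    rw [alt]
    simp only [alt, List.cons_append, cnt] at ih ⊢
    rw [ih]
    rcases Nat.mod_two_eq_zero_or_one m with h | h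
    · have h' : (m + 1) % 2 = 1 := by omega
      simp [h, h', good]
    · have h' : (m + 1) % 2 = 0 := by omega
      simp [h, h', good]

theorem cnt_ones : ∀ q, cnt (2 :: (List.replicate (q + 1) 1 ++ [3])) = q + 2
  | 0 => by simp [cnt, good]
  | q + 1 => by
    have ih := cnt_ones q
    simp only [List.replicate_succ, List.cons_append, cnt] at ih ⊢
    simp only [good] at ih ⊢
    omega

theorem cnt_zeros (l : List ℕ) : ∀ p, p + cnt (2 :: l) ≤ cnt (List.replicate (p + 1) 0 ++ 2 :: l)
  | 0 => by simp [cnt]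
  | p + 1 => by
    have ih := cnt_zeros l p
    simp only [List.replicate_succ, List.cons_append, cnt] at ih ⊢
    simp only [good] at ih ⊢
    omega

theorem exists_reach {s t : List ℕ} (h : s.Perm t) : ReachIn (flipDist s t) s t := by
  obtain ⟨m, hm, -⟩ := reach_bound 0 s.length s t rfl h
  exact Nat.sInf_mem (s := {m | ReachIn m s t}) ⟨m, hm⟩

theorem lower_bound (k : ℕ) : ∃ s t : List ℕ, s.length = k + 4 ∧ t.length = k + 4 ∧
    FullyKary 3 s ∧ FullyKary 3 t ∧ Compatible s t ∧ k + 3 ≤ flipDist s t := by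
  obtain ⟨s, hs⟩ : ∃ s, s = alt (k + 2) ++ [2, 0] := ⟨_, rfl⟩
  have hlen : s.length = k + 4 := by simp [hs, alt_length]
  have hlt : ∀ x ∈ s, x < 3 := by
    intro x hx
    simp only [hs, List.mem_append, List.mem_cons, List.not_mem_nil, or_false] at hx
    rcases hx with hx | rfl | rfl
    · have := alt_lt _ x hx
      omega
    · omega
    · omega
  have hm1 : 1 ∈ s := by
    rw [hs]
    simp only [alt, List.mem_append, List.mem_cons]
    omega
  have hm0 : 0 ∈ s := by simp [hs]
  have hc2 : s.count 2 = 1 := by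
    have : (alt (k + 2)).count 2 = 0 := List.count_eq_zero.mpr (fun h => by
      have := alt_lt _ _ h
      omega)
    rw [hs, List.count_append, this]
    rfl
  have hsum := count_ternary s hlt
  obtain ⟨p, hp⟩ : ∃ p, s.count 0 = p + 1 :=
    ⟨s.count 0 - 1, by have := List.count_pos_iff.mpr hm0; omega⟩
  obtain ⟨q, hq⟩ : ∃ q, s.count 1 = q + 1 :=
    ⟨s.count 1 - 1, by have := List.count_pos_iff.mpr hm1; omega⟩
  obtain ⟨t, ht⟩ : ∃ t, t = List.replicate (p + 1) 0 ++ 2 :: List.replicate (q + 1) 1 := ⟨_, rfl⟩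
  have hcomp : Compatible s t := by
    intro a
    by_cases ha : a < 3
    · interval_cases a
      · rw [hp, ht]; simp [List.count_replicate]
      · rw [hq, ht]; simp [List.count_replicate]
      · rw [hc2, ht]; simp [List.count_replicate]
    · rw [List.count_eq_zero.mpr (fun h => ha (hlt a h))]
      symm
      rw [List.count_eq_zero, ht]
      simp only [List.mem_append, List.mem_cons, List.mem_replicate]
      omega
  have hperm : s.Perm t := List.perm_iff_count.mpr hcomp
  have hfull : FullyKary 3 s := by
    intro a
    refine ⟨hlt a, fun ha => ?_⟩
    interval_cases a
    · exact hm0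
    · exact hm1
    · exact List.count_pos_iff.mp (by omega)
  refine ⟨s, t, hlen, by rw [← hperm.length_eq, hlen], hfull, ?_, hcomp, ?_⟩
  · intro a
    rw [← hperm.mem_iff]
    exact hfull a
  · have h := cnt_reach _ (exists_reach hperm)
    have h1 : cnt (s ++ [3]) = 0 := by
      have := alt_cnt (k + 1)
      rw [hs]
      simpa using this
    have h2 := cnt_zeros (List.replicate (q + 1) 1 ++ [3]) p
    rw [cnt_ones] at h2
    have h3 : t ++ [3] = List.replicate (p + 1) 0 ++ 2 :: (List.replicate (q + 1) 1 ++ [3]) := by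
      rw [ht]
      simp only [List.append_assoc, List.cons_append]
    rw [← h3] at h2
    omega

theorem ternary_diameter_bounds (n : ℕ) (hn : 3 < n) :
    (∀ s t : List ℕ, s.length = n → t.length = n → FullyKary 3 s → FullyKary 3 t →
      Compatible s t → 3 * flipDist s t ≤ 4 * n) ∧
    (∃ s t : List ℕ, s.length = n ∧ t.length = n ∧ FullyKary 3 s ∧ FullyKary 3 t ∧
      Compatible s t ∧ n - 1 ≤ flipDist s t) := by
  refine ⟨?_, ?_⟩
  · intro s t hs _ hfs _ hc
    have hperm : s.Perm t := List.perm_iff_count.mpr hc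
    have hsum := count_ternary s (fun x hx => (hfs x).mp hx)
    have hd : ∀ a, flipDist s t + 2 * s.count a ≤ 2 * n := by
      intro a
      obtain ⟨m, hm, hb⟩ := reach_bound a n s t hs hperm
      have : flipDist s t ≤ m := Nat.sInf_le hm
      omega
    have h0 := hd 0
    have h1 := hd 1
    have h2 := hd 2
    omega
  · obtain ⟨k, rfl⟩ : ∃ k, n = k + 4 := ⟨n - 4, by omega⟩
    exact lower_bound k
end

section
/- Let n ≥ 1 and let X = X_1 X_2 … X_n and Y = Y_1 Y_2 … Y_n be compatible strings whose symbols lie in {0, 1, …, n−1}. Define the binary strings x = ∏_{i=1}^{n} (1 0^{X_i + 1} 1)^{2n+1} and y = ∏_{i=1}^{n} (1 0^{Y_i + 1} 1)^{2n+1}, where ∏ denotes concatenation, 0^m denotes m consecutive 0s, and (w)^m denotes m consecutive copies of the string w. Then d(x, y) = d(X, Y). -/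
namespace FlipEnc

/-- The binary codeword of a symbol. -/
def ww (a : ℕ) : List ℕ := 1 :: (List.replicate (a+1) 0 ++ [1])

/-- Decode a list of pieces: a labelled piece is an intact codeword. -/
def dec (col : ℕ → ℕ) : List (ℕ ⊕ List ℕ) → List ℕ
  | [] => []
  | (Sum.inl i :: P) => ww (col i) ++ dec col P
  | (Sum.inr l :: P) => l ++ dec col P

/-- The labels of the intact pieces. -/
def lab : List (ℕ ⊕ List ℕ) → List ℕ
  | [] => []
  | (Sum.inl i :: P) => i :: lab P
  | (Sum.inr _ :: P) => lab P

lemma ww_reverse (a : ℕ) : (ww a).reverse = ww a := by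
  simp [ww]

lemma dec_append (col : ℕ → ℕ) (P Q : List (ℕ ⊕ List ℕ)) :
    dec col (P ++ Q) = dec col P ++ dec col Q := by
  induction P with
  | nil => simp [dec]
  | cons p P ih => cases p <;> simp [dec, ih]

lemma lab_append (P Q : List (ℕ ⊕ List ℕ)) : lab (P ++ Q) = lab P ++ lab Q := by
  induction P with
  | nil => simp [lab]
  | cons p P ih => cases p <;> simp [lab, ih]

lemma exists_rev (col : ℕ → ℕ) (P : List (ℕ ⊕ List ℕ)) :
    ∃ P', dec col P' = (dec col P).reverse ∧ lab P' = (lab P).reverse := by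
  induction P with
  | nil => exact ⟨[], by simp [dec, lab]⟩
  | cons p P ih =>
    obtain ⟨P', h1, h2⟩ := ih
    cases p with
    | inl i => exact ⟨P' ++ [Sum.inl i], by simp [dec_append, lab_append, dec, lab, h1, h2, ww_reverse]⟩
    | inr l => exact ⟨P' ++ [Sum.inr l.reverse], by simp [dec_append, lab_append, dec, lab, h1, h2]⟩

lemma exists_split (col : ℕ → ℕ) (P : List (ℕ ⊕ List ℕ)) : ∀ A B, dec col P = A ++ B →
    ∃ P1 P2, dec col P1 = A ∧ dec col P2 = B ∧ (lab P1 ++ lab P2).Sublist (lab P) ∧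
      (lab P).length ≤ (lab P1 ++ lab P2).length + 1 := by
  induction P with
  | nil =>
    intro A B h
    simp [dec] at h
    exact ⟨[], [], by simp [dec, lab, h]⟩
  | cons p P ih =>
    intro A B h
    cases p with
    | inl i =>
      simp only [dec] at h
      rcases List.append_eq_append_iff.1 h with ⟨t, h1, h2⟩ | ⟨t, h1, h2⟩
      · obtain ⟨P1, P2, e1, e2, e3, e4⟩ := ih _ _ h2
        refine ⟨Sum.inl i :: P1, P2, by simp [dec, e1, h1], e2, ?_, ?_⟩
        · simpa [lab] using e3
        · simp [lab] at e4 ⊢; omega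
      · refine ⟨[Sum.inr A], Sum.inr t :: P, by simp [dec], by simp [dec, h2], ?_, ?_⟩
        · simp [lab]
        · simp [lab]
    | inr l =>
      simp only [dec] at h
      rcases List.append_eq_append_iff.1 h with ⟨t, h1, h2⟩ | ⟨t, h1, h2⟩
      · obtain ⟨P1, P2, e1, e2, e3, e4⟩ := ih _ _ h2
        refine ⟨Sum.inr l :: P1, P2, by simp [dec, e1, h1], e2, ?_, ?_⟩
        · simpa [lab] using e3
        · simp [lab] at e4 ⊢; omega
      · refine ⟨[Sum.inr A], Sum.inr t :: P, by simp [dec], by simp [dec, h2], ?_, ?_⟩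
        · simp [lab]
        · simp [lab]

lemma flipStep_of_append (A B : List ℕ) (h : A ++ B ≠ []) : FlipStep (A ++ B) (A.reverse ++ B) := by
  cases A with
  | nil =>
    cases B with
    | nil => simp at h
    | cons b B => exact ⟨1, le_refl _, by simp, by simp [pflip]⟩
  | cons a A =>
    exact ⟨(a :: A).length, by simp, by simp, by simp [pflip]⟩

lemma flipStep_perm {s t : List ℕ} (h : FlipStep s t) : s.Perm t := by
  obtain ⟨i, -, -, rfl⟩ := h
  unfold pflip
  conv_lhs => rw [← List.take_append_drop i s]
  exact (List.reverse_perm _).symm.append_right _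

lemma reachIn_perm : ∀ (m : ℕ) {s t : List ℕ}, ReachIn m s t → s.Perm t
  | 0, s, t, h => by
    have h : s = t := h
    rw [h]
  | (m+1), s, t, h => by
    obtain ⟨u, h1, h2⟩ := h
    exact (flipStep_perm h1).trans (reachIn_perm m h2)

lemma reachIn_map (f : ℕ → ℕ) : ∀ (m : ℕ) {s t : List ℕ}, ReachIn m s t → ReachIn m (s.map f) (t.map f)
  | 0, s, t, h => by
    have h : s = t := h
    subst h
    exact rfl
  | (m+1), s, t, h => by
    obtain ⟨u, ⟨i, h1, h2, rfl⟩, h3⟩ := h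
    refine ⟨_, ⟨i, h1, by simpa using h2, rfl⟩, ?_⟩
    have := reachIn_map f m h3
    simpa [pflip, List.map_take, List.map_drop] using this

lemma reachIn_append (B : List ℕ) : ∀ (m : ℕ) {s t : List ℕ}, ReachIn m s t → ReachIn m (s ++ B) (t ++ B)
  | 0, s, t, h => by
    have h : s = t := h
    subst h
    exact rfl
  | (m+1), s, t, h => by
    obtain ⟨u, ⟨i, h1, h2, rfl⟩, h3⟩ := h
    refine ⟨_, ⟨i, h1, by simp; omega, rfl⟩, ?_⟩
    have := reachIn_append B m h3
    simpa [pflip, List.take_append_of_le_length h2, List.drop_append_of_le_length h2] using this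

lemma exists_reach (Y : List ℕ) : ∀ X : List ℕ, X.Perm Y → ∃ m, m ≤ 2 * Y.length ∧ ReachIn m X Y := by
  induction Y using List.reverseRecOn with
  | nil =>
    intro X h
    exact ⟨0, by simp, h.eq_nil⟩
  | append_singleton Y a ih =>
    intro X h
    have ha : a ∈ X := h.mem_iff.2 (by simp)
    obtain ⟨A, B, rfl⟩ := List.append_of_mem ha
    have hp : (B.reverse ++ A).Perm Y := by
      have h1 : (a :: (A ++ B)).Perm (a :: Y) :=
        (List.perm_middle.symm.trans h).trans (List.perm_append_singleton a Y)
      have h2 := h1.cons_inv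
      exact (((List.reverse_perm B).append_right A).trans List.perm_append_comm).trans h2
    obtain ⟨m, hm, hr⟩ := ih _ hp
    refine ⟨m + 2, by simp; omega, ?_⟩
    refine ⟨(A ++ [a]).reverse ++ B, ?_, (B.reverse ++ A) ++ [a], ?_, reachIn_append [a] m hr⟩
    · have := flipStep_of_append (A ++ [a]) B (by simp)
      simpa using this
    · have := flipStep_of_append ((A ++ [a]).reverse ++ B) [] (by simp)
      simpa using this

lemma track (col : ℕ → ℕ) (y : List ℕ) : ∀ (m : ℕ) (P : List (ℕ ⊕ List ℕ)),
    ReachIn m (dec col P) y → ∃ P', dec col P' = y ∧ (lab P).length ≤ (lab P').length + m ∧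
      ∀ R, R ≠ [] → R.Sublist (lab P') → ∃ R0, R0.Sublist (lab P) ∧ ReachIn m R0 R := by
  intro m
  induction m with
  | zero =>
    intro P h
    exact ⟨P, h, by simp, fun R _ hR => ⟨R, hR, rfl⟩⟩
  | succ m ih =>
    intro P h
    obtain ⟨u, ⟨i, -, -, rfl⟩, h⟩ := h
    obtain ⟨P1, P2, e1, e2, e3, e4⟩ := exists_split col P _ _ (List.take_append_drop i (dec col P)).symm
    obtain ⟨P1', f1, f2⟩ := exists_rev col P1
    have hd : dec col (P1' ++ P2) = pflip i (dec col P) := by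
      rw [dec_append, f1, e1, e2, pflip]
    rw [← hd] at h
    obtain ⟨P', g1, g2, g3⟩ := ih _ h
    refine ⟨P', g1, ?_, ?_⟩
    · simp [lab_append, f2] at g2 e4; omega
    · intro R hR hs
      obtain ⟨R0, k1, k2⟩ := g3 R hR hs
      rw [lab_append, f2, List.sublist_append_iff] at k1
      obtain ⟨A, B, rfl, kA, kB⟩ := k1
      refine ⟨A.reverse ++ B, ?_, A ++ B, ?_, k2⟩
      · refine List.Sublist.trans (List.Sublist.append ?_ kB) e3
        simpa using kA.reverse
      · have hne : A.reverse ++ B ≠ [] := by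
          intro h0
          have : A ++ B = [] := by simpa using h0
          rw [this] at k2
          exact hR (reachIn_perm m k2).symm.eq_nil
        have := flipStep_of_append A.reverse B hne
        simpa using this

lemma zeros_inj : ∀ (a c : ℕ) (v F : List ℕ),
    List.replicate a 0 ++ 1 :: v = List.replicate c 0 ++ 1 :: F → a = c ∧ v = F
  | 0, 0, v, F, h => by simpa using h
  | 0, c+1, v, F, h => by simp [List.replicate_succ] at h
  | a+1, 0, v, F, h => by simp [List.replicate_succ] at h
  | a+1, c+1, v, F, h => by
    simp only [List.replicate_succ, List.cons_append, List.cons.injEq, true_and] at h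
    have := zeros_inj a c v F h
    exact ⟨by omega, this.2⟩

/-- Concatenation of codewords. -/
def flat (Q : List ℕ) : List ℕ := (Q.map ww).flatten

lemma flat_ne (Q : List ℕ) (l : List ℕ) : flat Q ≠ 0 :: l := by
  cases Q <;> simp [flat, ww]

lemma parse_one (a : ℕ) (v : List ℕ) (Q : List ℕ) : ∀ u, u ++ (ww a ++ v) = flat Q →
    ∃ Q1 Q2, Q = Q1 ++ a :: Q2 ∧ v = flat Q2 := by
  induction Q with
  | nil => intro u h; simp [flat, ww] at h
  | cons c Q ih =>
    intro u h
    have hf : flat (c :: Q) = ww c ++ flat Q := by simp [flat]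
    rw [hf] at h
    rcases List.append_eq_append_iff.1 h with ⟨t, h1, h2⟩ | ⟨t, h1, h2⟩
    · skip
      cases u with
      | nil =>
        simp only [List.nil_append] at h
        simp only [ww, List.cons_append, List.cons.injEq, true_and, List.append_assoc, List.nil_append] at h
        have := zeros_inj _ _ _ _ h
        refine ⟨[], Q, ?_, this.2⟩
        simp; omega
      | cons b u =>
        simp only [ww, List.cons_append, List.cons.injEq] at h1
        have h1 := h1.2
        rcases List.append_eq_append_iff.1 h1 with ⟨t', k1, k2⟩ | ⟨t', k1, k2⟩
        · skip
          cases t' with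
          | nil =>
            exfalso
            simp at k2
            subst k2
            simp [ww, List.replicate_succ] at h2
            exact flat_ne _ _ h2.symm
          | cons z t' =>
            simp at k2
            obtain ⟨-, -, rfl⟩ := k2
            obtain ⟨Q1, Q2, q1, q2⟩ := ih [] (by simpa using h2)
            exact ⟨c :: Q1, Q2, by simp [q1], q2⟩
        · exfalso
          subst k2
          cases t' with
          | nil =>
            simp [ww, List.replicate_succ] at h2
            exact flat_ne _ _ h2.symm
          | cons z t' =>
            have hz : z = 0 := List.eq_of_mem_replicate (n := c+1) (by rw [k1]; simp)
            subst hz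
            simp [ww] at h2
    · obtain ⟨Q1, Q2, q1, q2⟩ := ih t h2.symm
      exact ⟨c :: Q1, Q2, by simp [q1], q2⟩

lemma parse (col : ℕ → ℕ) (P : List (ℕ ⊕ List ℕ)) : ∀ u Q, u ++ dec col P = flat Q →
    ((lab P).map col).Sublist Q := by
  induction P with
  | nil => intro u Q _; simp [lab]
  | cons p P ih =>
    intro u Q h
    cases p with
    | inr l => exact ih (u ++ l) Q (by simpa [dec] using h)
    | inl i =>
      obtain ⟨Q1, Q2, rfl, q2⟩ := parse_one _ _ _ _ h
      have := ih [] Q2 (by simpa using q2)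
      simp only [lab, List.map_cons]
      exact (this.cons_cons _).trans (List.sublist_append_right _ _)

/-- The initial label list: each label below `n` repeated `k` times. -/
def labs (n k : ℕ) : List ℕ := (List.range n).flatMap (List.replicate k)

lemma labs_succ (n k : ℕ) : labs (n+1) k = labs n k ++ List.replicate k n := by
  simp [labs, List.range_succ]

lemma mem_labs {n k i : ℕ} (h : i ∈ labs n k) : i < n := by
  obtain ⟨a, ha, hb⟩ := List.mem_flatMap.1 h
  have := List.eq_of_mem_replicate hb
  have := List.mem_range.1 ha
  omega

lemma labs_count (n k i : ℕ) (h : i < n) : (labs n k).count i = k := by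
  induction n with
  | zero => omega
  | succ n ih =>
    rw [labs_succ, List.count_append, List.count_replicate]
    by_cases hi : i = n
    · subst hi
      have : (labs i k).count i = 0 := List.count_eq_zero.2 fun h => by
        have := mem_labs h; omega
      simp [this]
    · rw [ih (by omega)]
      simp; intro h; omega

lemma labs_sorted (n k : ℕ) : (labs n k).Pairwise (· ≤ ·) := by
  induction n with
  | zero => simp [labs]
  | succ n ih =>
    rw [labs_succ, List.pairwise_append]
    refine ⟨ih, ?_, ?_⟩
    · simp [List.pairwise_replicate]
    · intro a ha b hb
      have := mem_labs ha
      have := List.eq_of_mem_replicate hb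
      omega

lemma countP_mem (S : Finset ℕ) (L : List ℕ) : L.countP (fun i => decide (i ∈ S)) = ∑ i ∈ S, L.count i := by
  induction L with
  | nil => simp
  | cons a L ih =>
    simp only [List.countP_cons, List.count_cons, Finset.sum_add_distrib, ih]
    simp

lemma countP_labs (n k : ℕ) (S : Finset ℕ) (hS : ∀ i ∈ S, i < n) :
    (labs n k).countP (fun i => decide (i ∈ S)) = S.card * k := by
  rw [countP_mem, Finset.sum_congr rfl (fun i hi => labs_count n k i (hS i hi))]
  simp

lemma countP_drop {L L' : List ℕ} (p : ℕ → Bool) (m : ℕ) (h : L'.Subperm L)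
    (hl : L.length ≤ L'.length + m) : L.countP p ≤ L'.countP p + m := by
  have h1 := List.length_eq_countP_add_countP p (l := L)
  have h2 := List.length_eq_countP_add_countP p (l := L')
  have h3 := h.countP_le (fun a => decide ¬ p a = true)
  omega

lemma dec_labs (col : ℕ → ℕ) (L : List ℕ) : dec col (L.map Sum.inl) = flat (L.map col) := by
  induction L with
  | nil => simp [dec, flat]
  | cons a L ih => simp [dec, flat, ih]

lemma lab_labs (L : List ℕ) : lab (L.map Sum.inl) = L := by
  induction L with
  | nil => simp [lab]
  | cons a L ih => simp [lab, ih]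

/-- The encoding. -/
def enc (k : ℕ) (X : List ℕ) : List ℕ := (X.map (fun a => rep (ww a) k)).flatten

lemma enc_eq (k : ℕ) (col : ℕ → ℕ) (l : List ℕ) :
    enc k (l.map col) = flat ((l.flatMap (List.replicate k)).map col) := by
  induction l with
  | nil => simp [enc, flat]
  | cons a l ih =>
    have h1 : enc k ((a :: l).map col) = rep (ww (col a)) k ++ enc k (l.map col) := by simp [enc]
    rw [h1, ih]
    simp [flat, rep]

lemma rep_reverse (w : List ℕ) (hw : w.reverse = w) (k : ℕ) : (rep w k).reverse = rep w k := by
  simp [rep, List.reverse_flatten, hw]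

lemma enc_reverse (k : ℕ) (X : List ℕ) : enc k X.reverse = (enc k X).reverse := by
  induction X with
  | nil => simp [enc]
  | cons a X ih =>
    have h1 : ∀ Y, enc k (a :: Y) = rep (ww a) k ++ enc k Y := by simp [enc]
    have h2 : enc k (X.reverse ++ [a]) = enc k X.reverse ++ rep (ww a) k := by simp [enc]
    rw [List.reverse_cons, h2, h1, ih, List.reverse_append, rep_reverse _ (ww_reverse a)]

lemma enc_append (k : ℕ) (X Y : List ℕ) : enc k (X ++ Y) = enc k X ++ enc k Y := by
  simp [enc]

lemma reachIn_enc (k : ℕ) (hk : 1 ≤ k) : ∀ (m : ℕ) {s t : List ℕ}, ReachIn m s t →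
    ReachIn m (enc k s) (enc k t)
  | 0, s, t, h => by
    have h : s = t := h
    subst h
    exact rfl
  | (m+1), s, t, h => by
    obtain ⟨u, ⟨i, h1, h2, rfl⟩, h3⟩ := h
    refine ⟨_, ?_, reachIn_enc k hk m h3⟩
    have hs : enc k s = enc k (s.take i) ++ enc k (s.drop i) := by
      rw [← enc_append, List.take_append_drop]
    rw [pflip, enc_append, enc_reverse, hs]
    apply flipStep_of_append
    rw [← hs]
    cases s with
    | nil => simp at h2; omega
    | cons a s =>
      obtain ⟨k, rfl⟩ := Nat.exists_eq_add_of_le' hk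
      simp [enc, rep, ww, List.replicate_succ]

lemma exists_matching (n k m : ℕ) (hm : m < k) (Z : List (ℕ × ℕ))
    (h1 : ∀ S : Finset ℕ, (∀ i ∈ S, i < n) →
      S.card * k ≤ (Z.map Prod.fst).countP (fun i => decide (i ∈ S)) + m)
    (h2 : (Z.map Prod.snd).Sublist (labs n k)) :
    ∃ e : Fin n ≃ Fin n, ∀ i, ((e i).1, i.1) ∈ Z := by
  classical
  let t : Fin n → Finset (Fin n) := fun i => Finset.univ.filter (fun j => (i.1, j.1) ∈ Z)
  obtain ⟨f, hf, hft⟩ := (Finset.all_card_le_biUnion_card_iff_exists_injective t).1 (by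
    intro S
    let S' : Finset ℕ := S.map Fin.valEmbedding
    let N' : Finset ℕ := (S.biUnion t).map Fin.valEmbedding
    have a1 := h1 S' (by intro i hi; simp only [S', Finset.mem_map] at hi; obtain ⟨j, -, rfl⟩ := hi; exact j.2)
    have a2 : N'.card * k = _ := (countP_labs n k N'
      (by intro i hi; simp only [N', Finset.mem_map] at hi; obtain ⟨j, -, rfl⟩ := hi; exact j.2)).symm
    have a3 := h2.countP_le (p := fun i => decide (i ∈ N'))
    rw [← a2] at a3
    rw [List.countP_map] at a1 a3
    have a4 : Z.countP ((fun i => decide (i ∈ S')) ∘ Prod.fst) ≤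
        Z.countP ((fun i => decide (i ∈ N')) ∘ Prod.snd) := by
      apply List.countP_mono_left
      rintro ⟨i, j⟩ hz hi
      have hj : j < n := mem_labs (h2.subset (List.mem_map_of_mem hz))
      simp only [Function.comp, decide_eq_true_eq, S', N', Finset.mem_map, Finset.mem_biUnion] at hi ⊢
      obtain ⟨i', hi', rfl⟩ := hi
      exact ⟨⟨j, hj⟩, ⟨i', hi', by simpa [t] using hz⟩, rfl⟩
    have c1 : S'.card = S.card := Finset.card_map _
    have c2 : N'.card = (S.biUnion t).card := Finset.card_map _
    rw [c1] at a1
    rw [c2] at a3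
    by_contra hlt
    push Not at hlt
    have : ((S.biUnion t).card + 1) * k ≤ S.card * k := Nat.mul_le_mul_right _ hlt
    rw [Nat.add_mul] at this
    omega)
  let e := Equiv.ofBijective f (Finite.injective_iff_bijective.1 hf)
  refine ⟨e.symm, fun i => ?_⟩
  have := hft (e.symm i)
  have h3 : f (e.symm i) = i := e.apply_symm_apply i
  rw [h3] at this
  simpa [t] using this

lemma sorted_eq_range (n : ℕ) (L : List ℕ) (hs : L.Pairwise (· ≤ ·)) (hp : L.Perm (List.range n)) :
    L = List.range n := by
  refine List.Perm.eq_of_pairwise (le := (· ≤ ·)) ?_ hs ?_ hp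
  · intro a b _ _ h1 h2; omega
  · exact List.pairwise_lt_range.imp le_of_lt

lemma exists_select (n k : ℕ) (Z : List (ℕ × ℕ)) (h2 : (Z.map Prod.snd).Sublist (labs n k))
    (g : ℕ → ℕ) (hg : ∀ j, j < n → (g j, j) ∈ Z) :
    ((List.range n).map (fun j => (g j, j))).Sublist Z := by
  classical
  let W := (Z.filter (fun z => decide (z.1 = g z.2))).dedup
  have hW : W.Sublist Z := (List.dedup_sublist _).trans List.filter_sublist
  have hmem : ∀ z ∈ W, z.1 = g z.2 := by
    intro z hz
    simp [W] at hz
    exact hz.2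
  have hsn : W.map Prod.snd = List.range n := by
    apply sorted_eq_range
    · exact (labs_sorted n k).sublist ((hW.map _).trans h2)
    · rw [List.perm_ext_iff_of_nodup ?_ List.nodup_range]
      · intro j
        simp only [List.mem_range]
        constructor
        · intro hj
          exact mem_labs (((hW.map _).trans h2).subset hj)
        · intro hj
          exact List.mem_map.2 ⟨(g j, j), by simp [W, hg j hj], rfl⟩
      · refine List.Nodup.map_on ?_ (List.nodup_dedup _)
        rintro ⟨a, b⟩ hx ⟨c, d⟩ hy h
        have := hmem _ hx
        have := hmem _ hy
        simp_all
  have : (List.range n).map (fun j => (g j, j)) = W := by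
    rw [← hsn, List.map_map]
    conv_rhs => rw [← List.map_id W]
    apply List.map_congr_left
    rintro ⟨a, b⟩ hz
    have := hmem _ hz
    simp at this ⊢
    exact this.symm
  rw [this]
  exact hW

lemma lower (n : ℕ) (hn : 1 ≤ n) (X Y : List ℕ) (hX : X.length = n) (hY : Y.length = n)
    (k m : ℕ) (hm : m < k) (h : ReachIn m (enc k X) (enc k Y)) : ReachIn m X Y := by
  classical
  let cX : ℕ → ℕ := fun i => X.getD i 0
  let cY : ℕ → ℕ := fun i => Y.getD i 0
  have eX : (List.range n).map cX = X := by
    apply List.ext_getElem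
    · simp [hX]
    · intro i h1 h2; simp [cX, h2]
  have eY : (List.range n).map cY = Y := by
    apply List.ext_getElem
    · simp [hY]
    · intro i h1 h2; simp [cY, h2]
  have encX : enc k X = dec cX ((labs n k).map Sum.inl) := by
    have := enc_eq k cX (List.range n)
    rw [eX] at this
    rw [dec_labs, this]; rfl
  have encY : enc k Y = flat ((labs n k).map cY) := by
    have := enc_eq k cY (List.range n)
    rw [eY] at this
    rw [this]; rfl
  rw [encX] at h
  obtain ⟨P', p1, p2, p3⟩ := track cX _ m _ h
  rw [lab_labs] at p2 p3
  have hsub : (lab P').Subperm (labs n k) := by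
    by_cases h0 : lab P' = []
    · rw [h0]; exact List.nil_subperm
    · obtain ⟨R0, r1, r2⟩ := p3 _ h0 (List.Sublist.refl _)
      exact ⟨R0, reachIn_perm m r2, r1⟩
  have hpar := parse cX P' [] ((labs n k).map cY) (by rw [← encY, ← p1]; rfl)
  obtain ⟨T, t1, t2⟩ := List.sublist_map_iff.1 hpar
  have hlen : (lab P').length = T.length := by simpa using congrArg List.length t2
  let Z := (lab P').zip T
  have z1 : Z.map Prod.fst = lab P' := List.map_fst_zip hlen.le
  have z2 : Z.map Prod.snd = T := List.map_snd_zip hlen.ge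
  have zc : ∀ z ∈ Z, cX z.1 = cY z.2 := by
    intro z hz
    obtain ⟨i, hi, rfl⟩ := List.mem_iff_getElem.1 hz
    simp only [Z, List.length_zip] at hi
    have h1 : i < ((lab P').map cX).length := by simp; omega
    have h2 : i < (T.map cY).length := by simp; omega
    have : ((lab P').map cX)[i] = (T.map cY)[i] := by simp only [t2]
    simpa [Z] using this
  obtain ⟨e, he⟩ := exists_matching n k m hm Z (by
    intro S hS
    rw [z1, ← countP_labs n k S hS]
    exact countP_drop _ m hsub p2) (by rw [z2]; exact t1)
  let g : ℕ → ℕ := fun j => if hj : j < n then (e ⟨j, hj⟩).1 else 0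
  have hg : ∀ j, j < n → (g j, j) ∈ Z := by
    intro j hj
    simpa [g, hj] using he ⟨j, hj⟩
  have hsel := (exists_select n k Z (by rw [z2]; exact t1) g hg).map Prod.fst
  rw [z1, List.map_map] at hsel
  have hR : (List.range n).map (Prod.fst ∘ fun j => (g j, j)) = (List.range n).map g := rfl
  rw [hR] at hsel
  obtain ⟨R0, r1, r2⟩ := p3 _ (by simp; omega) hsel
  have hgp : ((List.range n).map g).Perm (List.range n) := by
    have hnd : ((List.range n).map g).Nodup := by
      refine List.Nodup.map_on ?_ List.nodup_range
      intro a ha b hb hab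
      simp only [List.mem_range] at ha hb
      simp only [g, ha, hb, dif_pos] at hab
      have := e.injective (Fin.ext hab)
      simpa using this
    rw [List.perm_ext_iff_of_nodup hnd List.nodup_range]
    intro a
    simp only [List.mem_map, List.mem_range]
    constructor
    · rintro ⟨j, hj, rfl⟩
      simp [g, hj]
    · intro ha
      refine ⟨(e.symm ⟨a, ha⟩).1, (e.symm ⟨a, ha⟩).2, ?_⟩
      simp [g]
  have hR0 : R0 = List.range n :=
    sorted_eq_range n R0 ((labs_sorted n k).sublist r1) ((reachIn_perm m r2).trans hgp)
  rw [hR0] at r2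
  have := reachIn_map cX m r2
  rw [eX, List.map_map] at this
  have hfin : (List.range n).map (cX ∘ g) = Y := by
    rw [← eY]
    apply List.map_congr_left
    intro j hj
    exact zc _ (hg j (by simpa using hj))
  rwa [hfin] at this

end FlipEnc

theorem binary_encoding_preserves_distance (n : ℕ) (hn : 1 ≤ n) (X Y : List ℕ)
    (hX : X.length = n) (hY : Y.length = n)
    (hXsym : ∀ a ∈ X, a < n) (hYsym : ∀ a ∈ Y, a < n)
    (hcomp : Compatible X Y) :
    flipDist
      ((X.map (fun a => rep (1 :: (List.replicate (a+1) 0 ++ [1])) (2*n+1))).flatten)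
      ((Y.map (fun a => rep (1 :: (List.replicate (a+1) 0 ++ [1])) (2*n+1))).flatten)
    = flipDist X Y := by
  have hk : 1 ≤ 2 * n + 1 := by omega
  change flipDist (FlipEnc.enc (2*n+1) X) (FlipEnc.enc (2*n+1) Y) = flipDist X Y
  have hp : X.Perm Y := List.perm_iff_count.2 hcomp
  obtain ⟨m0, hm0, hr0⟩ := FlipEnc.exists_reach Y X hp
  have hd : ReachIn (flipDist X Y) X Y := Nat.sInf_mem (s := {m | ReachIn m X Y}) ⟨m0, hr0⟩
  have hd' := FlipEnc.reachIn_enc (2*n+1) hk _ hd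
  have hle : flipDist (FlipEnc.enc (2*n+1) X) (FlipEnc.enc (2*n+1) Y) ≤ flipDist X Y :=
    Nat.sInf_le hd'
  refine le_antisymm hle ?_
  have he : ReachIn (flipDist (FlipEnc.enc (2*n+1) X) (FlipEnc.enc (2*n+1) Y)) _ _ :=
    Nat.sInf_mem (s := {m | ReachIn m (FlipEnc.enc (2*n+1) X) (FlipEnc.enc (2*n+1) Y)}) ⟨_, hd'⟩
  have hd0 : flipDist X Y ≤ m0 := Nat.sInf_le hr0
  exact Nat.sInf_le (FlipEnc.lower n hn X Y hX hY (2*n+1) _ (by omega) he)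
end
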